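/- arXiv:1601.04858 — 4 statements merged into one kernel-verified Lean document; each statement's English description precedes it below -/
import Mathlib

section
/- Let $n\ge 2$ and let $w_1,\ldots,w_n$ be real numbers with $\sum_{i=1}^n w_i=0$ and $\sum_{i=1}^n w_i^2=1$. Let $\pi$ be a uniform random permutation of $\{1,\ldots,n\}$. Then for every $L\in\mathbb{R}$, $\mathbb{P}\{|\sum_{i=1}^n w_i \pi(i) - Ln| \le \sqrt{n}\} \le (C/\sqrt{n})\, e^{-c|L|}$ for absolute constants $C,c>0$. -/
open Finset

/-- averaging over a family of commuting involutions -/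
lemma swap_avg {Ω ι 𝕜 : Type*} [Fintype Ω] [DecidableEq ι] [Field 𝕜] [CharZero 𝕜] (e : ℝ → 𝕜)
    (he : ∀ x y, e (x + y) = e x * e y) (X : Ω → ℝ) (a : ι → Ω → ℝ) (s : ι → Ω ≃ Ω)
    (hX : ∀ v p, X (s v p) = X p - 2 * a v p)
    (ha : ∀ v u p, u ≠ v → a u (s v p) = a u p)
    (B : Ω → 𝕜) (hB : ∀ v p, B (s v p) = B p) (T : Finset ι) :
    ∑ p, B p * e (X p) = ∑ p, B p * (e (X p - ∑ v ∈ T, a v p) *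
      ∏ v ∈ T, ((e (a v p) + e (- a v p)) / 2)) := by
  induction T using Finset.induction_on with
  | empty => simp
  | insert v T hv ih =>
    rw [ih]
    have h2 : (2 : 𝕜) ≠ 0 := two_ne_zero
    have key : ∀ G : Ω → 𝕜, ∑ p, G p = ∑ p, (G p + G (s v p)) / 2 := by
      intro G
      rw [← Finset.sum_div, Finset.sum_add_distrib, Equiv.sum_comp (s v) G]
      field_simp
      ring
    rw [key]
    refine Finset.sum_congr rfl fun p _ => ?_
    have h1 : ∀ u ∈ T, a u (s v p) = a u p := fun u hu =>
      ha v u p (fun h => hv (h ▸ hu))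
    rw [hB, hX, Finset.sum_congr rfl h1, Finset.prod_insert hv, Finset.sum_insert hv]
    rw [Finset.prod_congr rfl (fun u hu => by rw [h1 u hu] :
      ∀ u ∈ T, (e (a u (s v p)) + e (- a u (s v p))) / 2 = (e (a u p) + e (- a u p)) / 2)]
    have e1 : X p - ∑ u ∈ T, a u p = (X p - (a v p + ∑ u ∈ T, a u p)) + a v p := by ring
    have e2 : X p - 2 * a v p - ∑ u ∈ T, a u p
      = (X p - (a v p + ∑ u ∈ T, a u p)) + (- a v p) := by ring
    rw [e1, e2, he, he]
    ring

/-- negative association of permutations, product form -/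
lemma perm_na (n : ℕ) (f : Fin n → Fin n → ℝ) (h0 : ∀ i v, 0 ≤ f i v)
    (hf : ∀ i, Monotone (f i)) (T : Finset (Fin n)) :
    ∑ p : Equiv.Perm (Fin n), ∏ i ∈ T, f i (p i)
      ≤ (n.factorial : ℝ) * ∏ i ∈ T, ((∑ v, f i v) / n) := by
  induction T using Finset.induction_on with
  | empty => simp [Fintype.card_perm]
  | insert j T hj ih =>
    have hn : 0 < n := j.pos
    have hn' : (0:ℝ) < n := by exact_mod_cast hn
    set P : Equiv.Perm (Fin n) → ℝ := fun p => ∏ i ∈ T, f i (p i) with hP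
    set g : Fin n → ℝ := fun k => ∑ p : Equiv.Perm (Fin n), if p j = k then P p else 0 with hg
    have hP0 : ∀ p, 0 ≤ P p := fun p => Finset.prod_nonneg fun i _ => h0 _ _
    have hsum : ∀ F : Fin n → ℝ, ∑ p : Equiv.Perm (Fin n), F (p j) * P p = ∑ k, F k * g k := by
      intro F
      simp only [hg, Finset.mul_sum]
      rw [Finset.sum_comm]
      refine Finset.sum_congr rfl fun p _ => ?_
      simp
    have hganti : Antitone g := by
      intro k k' hkk
      simp only [hg]
      rw [← Equiv.sum_comp (Equiv.mulLeft (Equiv.swap k k'))]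
      refine Finset.sum_le_sum fun p _ => ?_
      change (if Equiv.swap k k' (p j) = k' then P (Equiv.swap k k' * p) else 0) ≤
        (if p j = k then P p else 0)
      by_cases h : p j = k
      · rw [if_pos h, if_pos (by rw [h, Equiv.swap_apply_left])]
        refine Finset.prod_le_prod (fun i _ => h0 _ _) fun i hi => hf i ?_
        have hij : p i ≠ k := by
          rw [← h]
          intro hh
          exact hj (p.injective hh ▸ hi)
        simp only [Equiv.Perm.mul_apply]
        by_cases h' : p i = k'
        · rw [h', Equiv.swap_apply_right]; exact hkk
        · rw [Equiv.swap_apply_of_ne_of_ne hij h']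
      · rw [if_neg h, if_neg]
        intro hh
        apply h
        rw [Equiv.swap_apply_eq_iff, Equiv.swap_apply_right] at hh
        exact hh
    have hav : Antivary (f j) g := (hf j).antivary hganti
    have hch := hav.card_smul_sum_le_sum_smul_sum
    simp only [smul_eq_mul, Fintype.card_fin, nsmul_eq_mul] at hch
    have e1 : ∑ p : Equiv.Perm (Fin n), ∏ i ∈ insert j T, f i (p i) = ∑ k, f j k * g k := by
      rw [← hsum]
      exact Finset.sum_congr rfl fun p _ => Finset.prod_insert hj
    have e2 : ∑ k, g k = ∑ p, P p := by
      have := hsum (fun _ => 1)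
      simpa using this.symm
    rw [e1, Finset.prod_insert hj]
    rw [e2] at hch
    have hS : 0 ≤ ∑ k, f j k := Finset.sum_nonneg fun k _ => h0 _ _
    have := mul_le_mul_of_nonneg_left ih hS
    have h3 : (n:ℝ) * ∑ k, f j k * g k ≤ (∑ k, f j k) * ((n.factorial : ℝ) * ∏ i ∈ T, ((∑ v, f i v) / n)) :=
      hch.trans this
    rw [← le_div_iff₀' hn'] at h3
    refine h3.trans (le_of_eq ?_)
    ring

/-- centred, rescaled values -/
noncomputable def xval (n : ℕ) (v : Fin n) : ℝ := ((v : ℕ) + 1 - ((n:ℝ) + 1) / 2) / n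

lemma xval_rev (n : ℕ) (v : Fin n) : xval n (Fin.rev v) = - xval n v := by
  unfold xval
  have h : ((Fin.rev v : Fin n) : ℕ) + (v + 1) = n := by
    rw [Fin.val_rev]; omega
  have h' : (((Fin.rev v : Fin n) : ℕ) : ℝ) = n - (v + 1) := by
    have : ((((Fin.rev v : Fin n) : ℕ) + (v + 1) : ℕ) : ℝ) = n := by exact_mod_cast h
    push_cast at this
    linarith
  rw [h']
  ring

lemma xval_abs (n : ℕ) (v : Fin n) : |xval n v| ≤ 1 / 2 := by
  have hn : (0:ℝ) < n := by exact_mod_cast v.pos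
  have hv : ((v:ℕ):ℝ) + 1 ≤ n := by exact_mod_cast v.isLt
  have hv0 : (0:ℝ) ≤ ((v:ℕ):ℝ) := Nat.cast_nonneg _
  unfold xval
  rw [abs_div, abs_of_pos hn, div_le_iff₀ hn, abs_le]
  constructor <;> linarith

lemma avg_exp (n : ℕ) (hn : 0 < n) (t : ℝ) :
    (∑ v : Fin n, Real.exp (t * xval n v)) / n ≤ Real.exp (t ^ 2 / 8) := by
  have hn' : (0:ℝ) < n := by exact_mod_cast hn
  have h1 : ∑ v : Fin n, Real.exp (t * xval n v) = ∑ v : Fin n, Real.cosh (t * xval n v) := by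
    have h2 : ∑ v : Fin n, Real.exp (t * xval n v) = ∑ v : Fin n, Real.exp (-(t * xval n v)) := by
      rw [← Equiv.sum_comp Fin.revPerm]
      refine Finset.sum_congr rfl fun v _ => ?_
      rw [Fin.revPerm_apply, xval_rev]
      ring_nf
    have : ∑ v : Fin n, Real.cosh (t * xval n v)
        = (∑ v : Fin n, Real.exp (t * xval n v) + ∑ v : Fin n, Real.exp (-(t * xval n v))) / 2 := by
      rw [← Finset.sum_add_distrib, Finset.sum_div]
      exact Finset.sum_congr rfl fun v _ => Real.cosh_eq _
    rw [this, ← h2]; ring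
  rw [h1, div_le_iff₀ hn']
  calc ∑ v : Fin n, Real.cosh (t * xval n v) ≤ ∑ v : Fin n, Real.exp (t ^ 2 / 8) := by
        refine Finset.sum_le_sum fun v _ => (Real.cosh_le_exp_half_sq _).trans ?_
        apply Real.exp_le_exp.2
        have := xval_abs n v
        have h4 : (xval n v) ^ 2 ≤ (1/2)^2 := sq_le_sq' (by linarith [abs_le.1 this]) (abs_le.1 this).2
        nlinarith [sq_nonneg t]
    _ = _ := by simp; ring

lemma mgf_pos (n : ℕ) (hn : 0 < n) (u : Fin n → ℝ) (hu : ∀ i, 0 ≤ u i) :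
    ∑ p : Equiv.Perm (Fin n), Real.exp (∑ i, u i * xval n (p i))
      ≤ n.factorial * Real.exp ((∑ i, u i ^ 2) / 8) := by
  have hn' : (0:ℝ) < n := by exact_mod_cast hn
  have := perm_na n (fun i v => Real.exp (u i * xval n v)) (fun i v => (Real.exp_pos _).le)
    (fun i v v' hv => by
      apply Real.exp_le_exp.2
      apply mul_le_mul_of_nonneg_left _ (hu i)
      unfold xval
      have : ((v:ℕ):ℝ) ≤ ((v':ℕ):ℝ) := by exact_mod_cast hv
      gcongr) Finset.univ
  simp only [Real.exp_sum]
  refine this.trans ?_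
  rw [Finset.sum_div, Real.exp_sum]
  refine mul_le_mul_of_nonneg_left ?_ (by positivity)
  exact Finset.prod_le_prod (fun i _ => by positivity) fun i _ => avg_exp n hn _

lemma mgf_neg (n : ℕ) (hn : 0 < n) (u : Fin n → ℝ) (hu : ∀ i, 0 ≤ u i) :
    ∑ p : Equiv.Perm (Fin n), Real.exp (-∑ i, u i * xval n (p i))
      ≤ n.factorial * Real.exp ((∑ i, u i ^ 2) / 8) := by
  rw [← Equiv.sum_comp (Equiv.mulLeft (Fin.revPerm))]
  refine le_trans (le_of_eq ?_) (mgf_pos n hn u hu)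
  refine Finset.sum_congr rfl fun p _ => ?_
  congr 1
  rw [← Finset.sum_neg_distrib]
  refine Finset.sum_congr rfl fun i _ => ?_
  simp only [Equiv.coe_mulLeft, Equiv.Perm.mul_apply, Fin.revPerm_apply, xval_rev]
  ring

noncomputable def XX {n : ℕ} (w : Fin n → ℝ) (p : Equiv.Perm (Fin n)) : ℝ := ∑ i, w i * xval n (p i)

lemma mgf (n : ℕ) (hn : 0 < n) (w : Fin n → ℝ) (h2 : ∑ i, w i ^ 2 = 1) (t : ℝ) (ht : t ^ 2 = 4) :
    ∑ p : Equiv.Perm (Fin n), Real.exp (t * XX w p) ≤ n.factorial * Real.exp 1 := by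
  set u : Fin n → ℝ := fun i => 2 * max (t * w i) 0 with hu
  set u' : Fin n → ℝ := fun i => 2 * max (-(t * w i)) 0 with hu'
  have hd : ∀ i, max (t * w i) 0 - max (-(t * w i)) 0 = t * w i := by
    intro i
    rcases le_total (t * w i) 0 with h | h
    · rw [max_eq_right h, max_eq_left (by linarith)]; ring
    · rw [max_eq_left h, max_eq_right (by linarith)]; ring
  have hs : ∀ i, u i ^ 2 + u' i ^ 2 = 16 * w i ^ 2 := by
    intro i
    simp only [hu, hu']
    have : (t * w i) ^ 2 = 4 * w i ^ 2 := by rw [mul_pow, ht]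
    rcases le_total (t * w i) 0 with h | h
    · rw [max_eq_right h, max_eq_left (by linarith)]; nlinarith
    · rw [max_eq_left h, max_eq_right (by linarith)]; nlinarith
  have hsum : ∑ i, u i ^ 2 + ∑ i, u' i ^ 2 = 16 := by
    rw [← Finset.sum_add_distrib, Finset.sum_congr rfl fun i _ => hs i, ← Finset.mul_sum, h2]
    norm_num
  have hcs := Finset.sum_mul_sq_le_sq_mul_sq Finset.univ
    (fun p : Equiv.Perm (Fin n) => Real.exp ((∑ i, u i * xval n (p i)) / 2))
    (fun p => Real.exp ((-∑ i, u' i * xval n (p i)) / 2))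
  have e0 : ∀ p : Equiv.Perm (Fin n), Real.exp ((∑ i, u i * xval n (p i)) / 2) *
      Real.exp ((-∑ i, u' i * xval n (p i)) / 2) = Real.exp (t * XX w p) := by
    intro p
    rw [← Real.exp_add]
    congr 1
    unfold XX
    rw [Finset.mul_sum, neg_div, Finset.sum_div, Finset.sum_div, ← sub_eq_add_neg, ← Finset.sum_sub_distrib]
    refine Finset.sum_congr rfl fun i _ => ?_
    rw [← mul_assoc, ← hd i]
    simp only [hu, hu']
    ring
  have e1 : ∀ y : ℝ, Real.exp (y / 2) ^ 2 = Real.exp y := by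
    intro y
    rw [← Real.exp_nat_mul]; congr 1; push_cast; ring
  simp only [e0, e1] at hcs
  have A := mgf_pos n hn u (fun i => by simp only [hu]; positivity)
  have B := mgf_neg n hn u' (fun i => by simp only [hu']; positivity)
  have hAB := mul_le_mul A B (Finset.sum_nonneg fun p _ => (Real.exp_pos _).le) (by positivity)
  apply le_of_sq_le_sq _ (by positivity)
  refine hcs.trans (hAB.trans (le_of_eq ?_))
  have : Real.exp ((∑ i, u i ^ 2) / 8) * Real.exp ((∑ i, u' i ^ 2) / 8) = Real.exp 1 ^ 2 := by
    rw [← Real.exp_add, ← add_div, hsum, ← Real.exp_nat_mul]; norm_num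
  linear_combination (n.factorial : ℝ) ^ 2 * this
lemma exch (n : ℕ) (S : Finset (Fin n)) (d : Fin n) (_hd : d ∉ S) (u : Fin n → ℝ)
    (F : Equiv.Perm (Fin n) → ℝ)
    (hF : ∀ d', d' ∉ S → ∀ p, F (p * Equiv.swap d d') = F p) :
    ((n:ℝ) - #S) * ∑ p, F p * u (p d) = ∑ p, F p * (∑ i, u i - ∑ s ∈ S, u (p s)) := by
  have h1 : ∀ p : Equiv.Perm (Fin n), ∑ i, u i - ∑ s ∈ S, u (p s) = ∑ d' ∈ Sᶜ, u (p d') := by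
    intro p
    rw [← Equiv.sum_comp p u, ← Finset.sum_add_sum_compl S]; ring
  simp only [h1, Finset.mul_sum (s := Sᶜ)]
  rw [Finset.sum_comm]
  have h2 : ∀ d' ∈ Sᶜ, ∑ p, F p * u (p d') = ∑ p, F p * u (p d) := by
    intro d' hd'
    rw [← Equiv.sum_comp (Equiv.mulRight (Equiv.swap d d'))]
    refine Finset.sum_congr rfl fun p _ => ?_
    rw [Equiv.coe_mulRight, hF d' (by simpa using hd')]
    simp
  rw [Finset.sum_congr rfl h2, Finset.sum_const, nsmul_eq_mul, Finset.card_compl, Fintype.card_fin,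
    Nat.cast_sub (by simpa using Finset.card_le_univ S)]

section moments
variable (n : ℕ) (w : Fin n → ℝ) (h1 : ∑ i, w i = 0) (h2 : ∑ i, w i ^ 2 = 1)

lemma M22 (h2 : ∑ i, w i ^ 2 = 1) (a b : Fin n) (hab : a ≠ b) :
    (n:ℝ) * ((n:ℝ) - 1) * ∑ p : Equiv.Perm (Fin n), w (p a) ^ 2 * w (p b) ^ 2 ≤ n.factorial := by
  have e1 := exch n ∅ a (by simp) (fun i => w i ^ 2) (fun _ => 1) (by simp)
  have e2 := exch n {a} b (by simpa using hab.symm) (fun i => w i ^ 2) (fun p => w (p a) ^ 2) (by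
    intro d' hd' p
    simp only [Equiv.Perm.mul_apply]
    rw [Equiv.swap_apply_of_ne_of_ne hab (by rintro rfl; simp at hd')])
  simp only [h2, one_mul, sum_const, card_univ, Fintype.card_perm, Fintype.card_fin, Finset.card_empty,
    Finset.sum_empty, Finset.card_singleton, Finset.sum_singleton, nsmul_eq_mul, Nat.cast_zero,
    Nat.cast_one, sub_zero, mul_one] at e1 e2
  rw [mul_assoc, e2, ← e1]
  gcongr with p
  nlinarith [sq_nonneg (w (p a) ^ 2)]

lemma M31 (h1 : ∑ i, w i = 0) (hn : 2 ≤ n) (a b : Fin n) (hab : a ≠ b) :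
    ∑ p : Equiv.Perm (Fin n), w (p a) ^ 3 * w (p b) ≤ 0 := by
  have e2 := exch n {a} b (by simpa using hab.symm) w (fun p => w (p a) ^ 3) (by
    intro d' hd' p
    simp only [Equiv.Perm.mul_apply]
    rw [Equiv.swap_apply_of_ne_of_ne hab (by rintro rfl; simp at hd')])
  simp only [h1, Finset.card_singleton, Finset.sum_singleton, Nat.cast_one, zero_sub] at e2
  have hn' : (2:ℝ) ≤ n := by exact_mod_cast hn
  have : ∑ p : Equiv.Perm (Fin n), w (p a) ^ 3 * -w (p a) ≤ 0 :=
    Finset.sum_nonpos fun p _ => by nlinarith [sq_nonneg (w (p a) ^ 2)]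
  by_contra hc
  push Not at hc
  nlinarith

lemma M211 (h1 : ∑ i, w i = 0) (h2 : ∑ i, w i ^ 2 = 1) (hn : 4 ≤ n) (a b c : Fin n)
    (hab : a ≠ b) (hac : a ≠ c) (hbc : b ≠ c) :
    - (n.factorial : ℝ) ≤ (n:ℝ) * ((n:ℝ) - 1) * ((n:ℝ) - 2) *
      ∑ p : Equiv.Perm (Fin n), w (p a) ^ 2 * w (p b) * w (p c) := by
  have e2 := exch n {a, b} c (by simp [hac.symm, hbc.symm]) w (fun p => w (p a) ^ 2 * w (p b)) (by
    intro d' hd' p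
    simp only [Finset.mem_insert, Finset.mem_singleton, not_or] at hd'
    simp only [Equiv.Perm.mul_apply]
    rw [Equiv.swap_apply_of_ne_of_ne hac (Ne.symm hd'.1), Equiv.swap_apply_of_ne_of_ne hbc (Ne.symm hd'.2)])
  rw [Finset.card_pair hab] at e2
  simp only [h1, Finset.sum_pair hab, zero_sub] at e2
  have hn' : (4:ℝ) ≤ n := by exact_mod_cast hn
  have e3 : ∑ p : Equiv.Perm (Fin n), w (p a) ^ 2 * w (p b) * -(w (p a) + w (p b))
    = - ∑ p : Equiv.Perm (Fin n), w (p a) ^ 3 * w (p b)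
      - ∑ p : Equiv.Perm (Fin n), w (p a) ^ 2 * w (p b) ^ 2 := by
    rw [← Finset.sum_neg_distrib, ← Finset.sum_sub_distrib]
    exact Finset.sum_congr rfl fun p _ => by ring
  rw [e3] at e2
  push_cast at e2
  have m22 := M22 n w h2 a b hab
  have m31 := M31 n w h1 (by omega) a b hab
  rw [mul_assoc, e2]
  have : 0 ≤ (n:ℝ) * ((n:ℝ) - 1) := mul_nonneg (by linarith) (by linarith)
  nlinarith

lemma M1111 (h1 : ∑ i, w i = 0) (h2 : ∑ i, w i ^ 2 = 1) (hn : 4 ≤ n) (a b c d : Fin n)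
    (hab : a ≠ b) (hac : a ≠ c) (hbc : b ≠ c) (had : a ≠ d) (hbd : b ≠ d) (hcd : c ≠ d) :
    (n:ℝ) * ((n:ℝ) - 1) * ((n:ℝ) - 2) * ((n:ℝ) - 3) *
      ∑ p : Equiv.Perm (Fin n), w (p a) * w (p b) * w (p c) * w (p d) ≤ 3 * n.factorial := by
  have e2 := exch n {a, b, c} d (by simp [had.symm, hbd.symm, hcd.symm]) w
   (fun p => w (p a) * w (p b) * w (p c)) (by
    intro d' hd' p
    simp only [Finset.mem_insert, Finset.mem_singleton, not_or] at hd'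
    simp only [Equiv.Perm.mul_apply]
    rw [Equiv.swap_apply_of_ne_of_ne had (Ne.symm hd'.1),
      Equiv.swap_apply_of_ne_of_ne hbd (Ne.symm hd'.2.1),
      Equiv.swap_apply_of_ne_of_ne hcd (Ne.symm hd'.2.2)])
  have ha : a ∉ ({b, c} : Finset (Fin n)) := by simp [hab, hac]
  rw [Finset.card_insert_of_notMem ha, Finset.card_pair hbc] at e2
  simp only [h1, Finset.sum_insert ha, Finset.sum_pair hbc, zero_sub] at e2
  have hn' : (4:ℝ) ≤ n := by exact_mod_cast hn
  have e3 : ∑ p : Equiv.Perm (Fin n), w (p a) * w (p b) * w (p c) * -(w (p a) + (w (p b) + w (p c)))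
    = - ∑ p : Equiv.Perm (Fin n), w (p a) ^ 2 * w (p b) * w (p c)
      - ∑ p : Equiv.Perm (Fin n), w (p b) ^ 2 * w (p a) * w (p c)
      - ∑ p : Equiv.Perm (Fin n), w (p c) ^ 2 * w (p a) * w (p b) := by
    rw [← Finset.sum_neg_distrib, ← Finset.sum_sub_distrib, ← Finset.sum_sub_distrib]
    exact Finset.sum_congr rfl fun p _ => by ring
  rw [e3] at e2
  push_cast at e2
  have k1 := M211 n w h1 h2 hn a b c hab hac hbc
  have k2 := M211 n w h1 h2 hn b a c hab.symm hbc hac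
  have k3 := M211 n w h1 h2 hn c a b hac.symm hbc.symm hab
  rw [mul_assoc, e2]
  linarith

lemma Zmom (h1 : ∑ i, w i = 0) (h2 : ∑ i, w i ^ 2 = 1) (hn : 4 ≤ n) (h : ℕ) (hh : 2 * h ≤ n)
    (lo hi : Fin h → Fin n) (hlo : Function.Injective lo) (hhi : Function.Injective hi)
    (hlh : ∀ u v, lo u ≠ hi v) :
    ∑ p : Equiv.Perm (Fin n), (∑ v, w (p (lo v)) * w (p (hi v))) ^ 2 ≤ 3 / n * n.factorial := by
  have hn' : (4:ℝ) ≤ n := by exact_mod_cast hn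
  have hh' : (2:ℝ) * h ≤ n := by exact_mod_cast hh
  have hf : (0:ℝ) < n.factorial := by exact_mod_cast n.factorial_pos
  have e1 : ∀ p : Equiv.Perm (Fin n), (∑ v, w (p (lo v)) * w (p (hi v))) ^ 2
     = ∑ u, ∑ v, (w (p (lo u)) * w (p (hi u))) * (w (p (lo v)) * w (p (hi v))) := by
    intro p; rw [sq, Finset.sum_mul_sum]
  simp only [e1]
  rw [Finset.sum_comm]
  have hA : ∀ u v : Fin h, ∑ p : Equiv.Perm (Fin n), (w (p (lo u)) * w (p (hi u))) * (w (p (lo v)) * w (p (hi v)))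
      ≤ (if u = v then 4 / 3 / (n:ℝ) ^ 2 * (n.factorial : ℝ) else 0) + 32 / n ^ 4 * (n.factorial : ℝ) := by
    intro u v
    by_cases huv : u = v
    · subst huv
      rw [if_pos rfl]
      have := M22 n w h2 (lo u) (hi u) (hlh u u)
      have e : ∑ p : Equiv.Perm (Fin n), (w (p (lo u)) * w (p (hi u))) * (w (p (lo u)) * w (p (hi u)))
        = ∑ p : Equiv.Perm (Fin n), w (p (lo u)) ^ 2 * w (p (hi u)) ^ 2 :=
        Finset.sum_congr rfl fun p _ => by ring
      rw [e]
      set Q := ∑ p : Equiv.Perm (Fin n), w (p (lo u)) ^ 2 * w (p (hi u)) ^ 2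
      have hQ : 0 ≤ Q := Finset.sum_nonneg fun p _ => by positivity
      have : Q ≤ 4 / 3 / n ^ 2 * n.factorial := by
        rw [div_mul_eq_mul_div, le_div_iff₀ (by positivity)]
        nlinarith
      have : 0 ≤ 32 / (n:ℝ) ^ 4 * (n.factorial : ℝ) := by positivity
      linarith
    · rw [if_neg huv, zero_add]
      have := M1111 n w h1 h2 hn (lo u) (hi u) (lo v) (hi v) (hlh _ _) (hlo.ne huv)
        (hlh _ _).symm (hlh _ _) (hhi.ne huv) (hlh _ _)
      have e : ∑ p : Equiv.Perm (Fin n), (w (p (lo u)) * w (p (hi u))) * (w (p (lo v)) * w (p (hi v)))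
        = ∑ p : Equiv.Perm (Fin n), w (p (lo u)) * w (p (hi u)) * w (p (lo v)) * w (p (hi v)) :=
        Finset.sum_congr rfl fun p _ => by ring
      rw [e]
      set Q := ∑ p : Equiv.Perm (Fin n), w (p (lo u)) * w (p (hi u)) * w (p (lo v)) * w (p (hi v))
      rcases le_total Q 0 with hQ | hQ
      · exact hQ.trans (by positivity)
      rw [div_mul_eq_mul_div, le_div_iff₀ (by positivity)]
      have b1 : (3:ℝ)/4 * n ≤ n - 1 := by linarith
      have b2 : (1:ℝ)/2 * n ≤ n - 2 := by linarith
      have b3 : (1:ℝ)/4 * n ≤ n - 3 := by linarith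
      have : (n:ℝ) * ((3:ℝ)/4 * n) * ((1:ℝ)/2 * n) * ((1:ℝ)/4 * n) ≤
        (n:ℝ) * ((n:ℝ) - 1) * ((n:ℝ) - 2) * ((n:ℝ) - 3) := by
        gcongr
        · exact mul_nonneg (mul_nonneg (by linarith) (by linarith)) (by linarith)
        · exact mul_nonneg (by linarith) (by linarith)
      have := mul_le_mul_of_nonneg_right this hQ
      nlinarith
  calc _ = ∑ u : Fin h, ∑ v : Fin h, ∑ p : Equiv.Perm (Fin n), (w (p (lo u)) * w (p (hi u))) * (w (p (lo v)) * w (p (hi v))) := by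
        refine Finset.sum_congr rfl fun u _ => ?_
        rw [Finset.sum_comm]
    _ ≤ ∑ u : Fin h, ∑ v : Fin h, ((if u = v then 4 / 3 / (n:ℝ) ^ 2 * (n.factorial : ℝ) else 0) + 32 / n ^ 4 * (n.factorial : ℝ)) :=
        Finset.sum_le_sum fun u _ => Finset.sum_le_sum fun v _ => hA u v
    _ = (h:ℝ) * (4 / 3 / n ^ 2 * n.factorial) + (h:ℝ) * (h * (32 / n ^ 4 * (n.factorial : ℝ))) := by
        simp [Finset.sum_add_distrib]
    _ ≤ (n/2 :ℝ) * (4 / 3 / n ^ 2 * n.factorial) + (n/2 :ℝ) * (n/2 * (32 / n ^ 4 * (n.factorial : ℝ))) := by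
        have : (h:ℝ) ≤ n / 2 := by linarith
        gcongr
    _ = (2/3/n + 8 / n^2) * n.factorial := by field_simp; ring
    _ ≤ _ := by
        gcongr
        rw [div_add_div _ _ (by positivity) (by positivity), div_le_div_iff₀ (by positivity) (by positivity)]
        have : (n:ℝ) * (2/3 * n^2 + n * 8) ≤ n * (3 * n^2) := by gcongr; nlinarith
        nlinarith
end moments

def lo (n : ℕ) (v : Fin (n / 2)) : Fin n := ⟨v, by omega⟩
def hi (n : ℕ) (v : Fin (n / 2)) : Fin n := ⟨n / 2 + v, by omega⟩

lemma lo_inj (n : ℕ) : Function.Injective (lo n) := by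
  intro u v h
  simp only [lo, Fin.mk.injEq] at h
  exact Fin.ext h

lemma hi_inj (n : ℕ) : Function.Injective (hi n) := by
  intro u v h
  simp only [hi, Fin.mk.injEq] at h
  exact Fin.ext (by omega)

lemma lo_ne_hi (n : ℕ) (u v) : lo n u ≠ hi n v := by
  intro h
  simp only [lo, hi, Fin.mk.injEq] at h
  omega

lemma sum_pairs (n : ℕ) (F : Fin n → ℝ) (M : ℝ) (hM : 0 ≤ M) (hF : ∀ u, F u ≤ M) :
    ∑ u, F u ≤ ∑ v, (F (lo n v) + F (hi n v)) + M := by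
  classical
  have hA : Disjoint (univ.image (lo n)) (univ.image (hi n)) := by
    rw [Finset.disjoint_left]
    intro x hx hx'
    simp only [mem_image, mem_univ, true_and] at hx hx'
    obtain ⟨u, rfl⟩ := hx
    obtain ⟨v, hv⟩ := hx'
    exact lo_ne_hi n u v hv.symm
  have h1 : ∑ v, (F (lo n v) + F (hi n v)) = ∑ u ∈ univ.image (lo n) ∪ univ.image (hi n), F u := by
    rw [Finset.sum_union hA, Finset.sum_image (fun _ _ _ _ h => lo_inj n h),
      Finset.sum_image (fun _ _ _ _ h => hi_inj n h), Finset.sum_add_distrib]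
  have hc : #(univ.image (lo n) ∪ univ.image (hi n))ᶜ ≤ 1 := by
    rw [Finset.card_compl, Finset.card_union_of_disjoint hA, Finset.card_image_of_injective _ (lo_inj n),
      Finset.card_image_of_injective _ (hi_inj n)]
    simp only [card_univ, Fintype.card_fin]
    omega
  rw [h1, ← Finset.sum_add_sum_compl (univ.image (lo n) ∪ univ.image (hi n)) F]
  gcongr
  calc _ ≤ #(univ.image (lo n) ∪ univ.image (hi n))ᶜ • M := Finset.sum_le_card_nsmul _ _ _ (fun x _ => hF x)
    _ ≤ 1 * M := by
      rw [nsmul_eq_mul]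
      gcongr
      exact_mod_cast hc
    _ = M := one_mul _

noncomputable def YY {n : ℕ} (w : Fin n → ℝ) (p : Equiv.Perm (Fin n)) : ℝ :=
  ∑ v, (w (p⁻¹ (lo n v)) - w (p⁻¹ (hi n v))) ^ 2

lemma one_le_nm (n : ℕ) (w : Fin n → ℝ) (h2 : ∑ i, w i ^ 2 = 1) (m : ℝ) (hm : ∀ i, |w i| ≤ m) :
    1 ≤ (n:ℝ) * m ^ 2 := by
  calc (1:ℝ) = ∑ i, w i ^ 2 := h2.symm
    _ ≤ ∑ i : Fin n, m ^ 2 := Finset.sum_le_sum fun i _ => by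
        rw [← sq_abs]; exact pow_le_pow_left₀ (abs_nonneg _) (hm i) 2
    _ = _ := by simp

lemma Ybad (n : ℕ) (w : Fin n → ℝ) (h1 : ∑ i, w i = 0) (h2 : ∑ i, w i ^ 2 = 1)
    (m : ℝ) (hm : ∀ i, |w i| ≤ m) :
    ((univ.filter fun p : Equiv.Perm (Fin n) => YY w p < 1 / 4).card : ℝ) ≤ 48 * m ^ 2 * n.factorial := by
  have hf : (0:ℝ) < n.factorial := by exact_mod_cast n.factorial_pos
  have hnm := one_le_nm n w h2 m hm
  rcases le_or_gt (1/4) (m ^ 2) with hm4 | hm4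
  · have : ((univ.filter fun p : Equiv.Perm (Fin n) => YY w p < 1 / 4).card : ℝ) ≤ n.factorial := by
      have := Finset.card_filter_le (univ : Finset (Equiv.Perm (Fin n))) (fun p => YY w p < 1 / 4)
      rw [card_univ, Fintype.card_perm, Fintype.card_fin] at this
      exact_mod_cast this
    nlinarith
  · have hn4 : 4 ≤ n := by
      by_contra hc
      have : (n:ℝ) ≤ 3 := by exact_mod_cast (by omega : n ≤ 3)
      nlinarith [sq_nonneg m]
    have hn' : (0:ℝ) < n := by exact_mod_cast (by omega : 0 < n)
    have hZ := Zmom n w h1 h2 hn4 (n / 2) (by omega) (lo n) (hi n) (lo_inj n) (hi_inj n) (lo_ne_hi n)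
    rw [← Equiv.sum_comp (Equiv.inv _)] at hZ
    simp only [Equiv.inv_apply] at hZ
    have hY : ∀ p : Equiv.Perm (Fin n), YY w p < 1 / 4 →
        1 / 16 ≤ (∑ v, w (p⁻¹ (lo n v)) * w (p⁻¹ (hi n v))) ^ 2 := by
      intro p hp
      have hs := sum_pairs n (fun u => w (p⁻¹ u) ^ 2) (m ^ 2) (sq_nonneg m) (fun u => by
        rw [← sq_abs]; exact pow_le_pow_left₀ (abs_nonneg _) (hm _) 2)
      rw [Equiv.sum_comp p⁻¹ (fun u => w u ^ 2), h2] at hs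
      have e : YY w p = ∑ v, (w (p⁻¹ (lo n v)) ^ 2 + w (p⁻¹ (hi n v)) ^ 2) -
          2 * ∑ v, w (p⁻¹ (lo n v)) * w (p⁻¹ (hi n v)) := by
        unfold YY
        rw [Finset.mul_sum, ← Finset.sum_sub_distrib]
        exact Finset.sum_congr rfl fun v _ => by ring
      nlinarith
    have : (1/16:ℝ) * ((univ.filter fun p : Equiv.Perm (Fin n) => YY w p < 1 / 4).card : ℝ) ≤ 3 / n * n.factorial := by
      refine le_trans ?_ hZ
      rw [mul_comm, ← nsmul_eq_mul]
      refine (Finset.card_nsmul_le_sum _ _ _ (fun p hp => hY p (by simpa using hp))).trans ?_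
      exact Finset.sum_le_univ_sum_of_nonneg fun p => sq_nonneg _
    have h3 : 3 / (n:ℝ) ≤ 3 * m ^ 2 := by
      rw [div_le_iff₀ hn']; nlinarith
    have := mul_le_mul_of_nonneg_right h3 hf.le
    linarith

lemma norm_cosh_le (x y : ℝ) (hx : |x| ≤ 1) (hy : |y| ≤ 1) :
    ‖Complex.cosh (x + y * Complex.I)‖ ≤ Real.cosh x * Real.exp (-(y ^ 2) / 32) := by
  have e1 : ‖Complex.cosh (x + y * Complex.I)‖ ^ 2 = Real.cosh x ^ 2 - Real.sin y ^ 2 := by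
    rw [Complex.cosh_add, Complex.cosh_mul_I, Complex.sinh_mul_I, ← Complex.ofReal_cosh,
      ← Complex.ofReal_sinh, ← Complex.ofReal_cos, ← Complex.ofReal_sin, Complex.sq_norm,
      Complex.normSq_apply]
    simp only [Complex.add_re, Complex.add_im, Complex.mul_re, Complex.mul_im, Complex.ofReal_re,
      Complex.ofReal_im, Complex.I_re, Complex.I_im]
    linear_combination Real.cosh x ^ 2 * Real.sin_sq_add_cos_sq y - Real.sin y ^ 2 * Real.cosh_sq x
  have hc1 : 1 ≤ Real.cosh x := Real.one_le_cosh x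
  have hc2 : Real.cosh x ≤ 2 := by
    refine (Real.cosh_le_exp_half_sq x).trans ?_
    have : x ^ 2 / 2 ≤ 1 / 2 := by nlinarith [abs_le.1 hx]
    refine (Real.exp_le_exp.2 this).trans ?_
    have h := Real.exp_one_lt_d9
    have h' : Real.exp (1/2) ^ 2 = Real.exp 1 := by
      rw [← Real.exp_nat_mul]; norm_num
    nlinarith [Real.exp_pos (1/2)]
  have hs : y ^ 2 / 4 ≤ Real.sin y ^ 2 := by
    have key : ∀ z : ℝ, 0 ≤ z → z ≤ 1 → z / 2 ≤ Real.sin z := by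
      intro z h0 h1
      rcases h0.eq_or_lt with rfl | h0
      · simp
      have := Real.sin_gt_sub_cube h0
      nlinarith [pow_pos h0 2, mul_pos h0 h0]
    have h := key |y| (abs_nonneg y) hy
    have h2 : Real.sin |y| ^ 2 = Real.sin y ^ 2 := by
      rcases abs_choice y with h | h <;> rw [h]
      rw [Real.sin_neg]; ring
    rw [← h2, ← sq_abs y]
    nlinarith [abs_nonneg y]
  apply le_of_sq_le_sq _ (by positivity)
  rw [e1, mul_pow]
  have e2 : Real.exp (-(y^2)/32) ^ 2 = Real.exp (-(y^2)/16) := by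
    rw [← Real.exp_nat_mul]; congr 1; push_cast; ring
  rw [e2]
  have h3 : 1 - y^2/16 ≤ Real.exp (-(y^2)/16) := by
    have := Real.add_one_le_exp (-(y^2)/16); linarith
  have h4 : Real.cosh x ^ 2 * (1 - y^2/16) ≤ Real.cosh x ^ 2 * Real.exp (-(y^2)/16) := by gcongr
  have h5 : Real.cosh x ^ 2 ≤ 4 := by nlinarith
  nlinarith [sq_nonneg y]

noncomputable def aa {n : ℕ} (w : Fin n → ℝ) (v : Fin (n / 2)) (p : Equiv.Perm (Fin n)) : ℝ :=
  (w (p⁻¹ (lo n v)) - w (p⁻¹ (hi n v))) * (xval n (lo n v) - xval n (hi n v)) / 2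

lemma xdiff (n : ℕ) (v : Fin (n / 2)) :
    xval n (lo n v) - xval n (hi n v) = - (((n / 2 : ℕ) : ℝ) / n) := by
  unfold xval lo hi
  push_cast
  ring

def ss (n : ℕ) (v : Fin (n / 2)) : Equiv.Perm (Fin n) ≃ Equiv.Perm (Fin n) :=
  Equiv.mulLeft (Equiv.swap (lo n v) (hi n v))

lemma ss_inv (n : ℕ) (v : Fin (n / 2)) (p : Equiv.Perm (Fin n)) (u : Fin n) :
    (ss n v p)⁻¹ u = p⁻¹ (Equiv.swap (lo n v) (hi n v) u) := by
  simp [ss, mul_inv_rev]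

lemma aa_ne {n : ℕ} (w : Fin n → ℝ) (v u : Fin (n / 2)) (p : Equiv.Perm (Fin n)) (h : u ≠ v) :
    aa w u (ss n v p) = aa w u p := by
  unfold aa
  rw [ss_inv, ss_inv, Equiv.swap_apply_of_ne_of_ne ((lo_inj n).ne h) (lo_ne_hi n _ _),
    Equiv.swap_apply_of_ne_of_ne (lo_ne_hi n _ _).symm ((hi_inj n).ne h)]

lemma aa_self {n : ℕ} (w : Fin n → ℝ) (v : Fin (n / 2)) (p : Equiv.Perm (Fin n)) :
    aa w v (ss n v p) = - aa w v p := by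
  unfold aa
  rw [ss_inv, ss_inv, Equiv.swap_apply_left, Equiv.swap_apply_right]
  ring

lemma XX_inv {n : ℕ} (w : Fin n → ℝ) (p : Equiv.Perm (Fin n)) :
    XX w p = ∑ u, w (p⁻¹ u) * xval n u := by
  unfold XX
  rw [← Equiv.sum_comp p (fun u => w (p⁻¹ u) * xval n u)]
  simp

lemma XX_ss {n : ℕ} (w : Fin n → ℝ) (v : Fin (n / 2)) (p : Equiv.Perm (Fin n)) :
    XX w (ss n v p) = XX w p - 2 * aa w v p := by
  rw [XX_inv, XX_inv]
  have h : ∑ u, w ((ss n v p)⁻¹ u) * xval n u - ∑ u, w (p⁻¹ u) * xval n u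
      = ∑ u ∈ ({lo n v, hi n v} : Finset (Fin n)), (w ((ss n v p)⁻¹ u) - w (p⁻¹ u)) * xval n u := by
    rw [← Finset.sum_sub_distrib]
    symm
    rw [← Finset.sum_subset (Finset.subset_univ ({lo n v, hi n v} : Finset (Fin n)))]
    · exact Finset.sum_congr rfl fun u _ => by ring
    · intro u _ hu
      simp only [mem_insert, mem_singleton, not_or] at hu
      rw [ss_inv, Equiv.swap_apply_of_ne_of_ne hu.1 hu.2]
      ring
  rw [Finset.sum_pair (lo_ne_hi n v v), ss_inv, ss_inv, Equiv.swap_apply_left, Equiv.swap_apply_right] at h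
  unfold aa
  linarith

lemma YY_eq {n : ℕ} (hn : 2 ≤ n) (w : Fin n → ℝ) (p : Equiv.Perm (Fin n)) :
    YY w p / 36 ≤ ∑ v, aa w v p ^ 2 := by
  unfold YY aa
  rw [Finset.sum_div]
  refine Finset.sum_le_sum fun v _ => ?_
  rw [xdiff]
  have hn' : (0:ℝ) < n := by exact_mod_cast (by omega : 0 < n)
  have h3 : 1 / 3 ≤ ((n / 2 : ℕ) : ℝ) / n := by
    rw [le_div_iff₀ hn']
    have : (n:ℝ) ≤ 3 * ((n / 2 : ℕ) : ℝ) := by exact_mod_cast (by omega : n ≤ 3 * (n / 2))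
    linarith
  set q := ((n / 2 : ℕ) : ℝ) / n
  set d := w (p⁻¹ (lo n v)) - w (p⁻¹ (hi n v))
  have : (1/3)^2 ≤ q ^ 2 := pow_le_pow_left₀ (by norm_num) h3 2
  have := mul_le_mul_of_nonneg_left this (sq_nonneg d)
  linarith [this, show (d * -q / 2)^2 = d^2 * q^2 / 4 by ring]

lemma aa_abs {n : ℕ} (hn : 2 ≤ n) (w : Fin n → ℝ) (m : ℝ) (hm : ∀ i, |w i| ≤ m)
    (v : Fin (n / 2)) (p : Equiv.Perm (Fin n)) : |aa w v p| ≤ m := by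
  unfold aa
  rw [xdiff]
  have hn' : (0:ℝ) < n := by exact_mod_cast (by omega : 0 < n)
  have h3 : ((n / 2 : ℕ) : ℝ) / n ≤ 1 := by
    rw [div_le_iff₀ hn', one_mul]
    exact_mod_cast (by omega : n / 2 ≤ n)
  have h0 : 0 ≤ ((n / 2 : ℕ) : ℝ) / n := by positivity
  have hd : |w (p⁻¹ (lo n v)) - w (p⁻¹ (hi n v))| ≤ 2 * m := by
    have := abs_sub (w (p⁻¹ (lo n v))) (w (p⁻¹ (hi n v)))
    linarith [hm (p⁻¹ (lo n v)), hm (p⁻¹ (hi n v))]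
  rw [abs_div, abs_mul, abs_neg, abs_of_nonneg h0, abs_two]
  have := mul_le_mul hd h3 h0 ((abs_nonneg _).trans hd)
  linarith

/-- the tilted Fourier bound -/
lemma fourier_tilt (n : ℕ) (hn : 2 ≤ n) (w : Fin n → ℝ) (h1 : ∑ i, w i = 0) (h2 : ∑ i, w i ^ 2 = 1)
    (m : ℝ) (hm : ∀ i, |w i| ≤ m) (hm0 : 0 < m) (hm1 : m ≤ 1) (θ r : ℝ) (hθ : θ ^ 2 = 1)
    (hr : |r| * m ≤ 1) :
    ‖∑ p : Equiv.Perm (Fin n), Complex.exp ((θ + r * Complex.I) * XX w p)‖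
      ≤ n.factorial * (2 * (Real.exp (-(r ^ 2) / 4608) + 7 * m)) := by
  have hθ1 : |θ| = 1 := by
    rw [← abs_one, ← sq_eq_sq_iff_abs_eq_abs, hθ]; norm_num
  have hf : (0:ℝ) < n.factorial := by exact_mod_cast n.factorial_pos
  set z : ℂ := θ + r * Complex.I with hz
  have s1 := swap_avg (Ω := Equiv.Perm (Fin n)) (ι := Fin (n/2)) (𝕜 := ℂ) (fun x => Complex.exp (z * x))
    (fun x y => by rw [← Complex.exp_add]; push_cast; ring_nf) (XX w) (aa w) (ss n) (fun v p => XX_ss w v p)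
    (fun v u p h => aa_ne w v u p h) (fun _ => 1) (fun _ _ => rfl) univ
  simp only [one_mul] at s1
  set D : Equiv.Perm (Fin n) → ℝ := fun p => Real.exp (-(r ^ 2) / 32 * ∑ v, aa w v p ^ 2) with hD
  have s2 := swap_avg (Ω := Equiv.Perm (Fin n)) (ι := Fin (n/2)) (𝕜 := ℝ) (fun x => Real.exp (θ * x))
    (fun x y => by rw [← Real.exp_add]; ring_nf) (XX w) (aa w) (ss n) (fun v p => XX_ss w v p)
    (fun v u p h => aa_ne w v u p h) D (fun v p => by
      simp only [hD]
      congr 2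
      refine Finset.sum_congr rfl fun u _ => ?_
      by_cases h : u = v
      · subst h; rw [aa_self]; ring
      · rw [aa_ne w v u p h]) univ
  have step1 : ‖∑ p : Equiv.Perm (Fin n), Complex.exp (z * XX w p)‖
      ≤ ∑ p, D p * Real.exp (θ * XX w p) := by
    rw [s1, s2]
    refine (norm_sum_le _ _).trans (Finset.sum_le_sum fun p _ => ?_)
    rw [norm_mul, norm_prod]
    have hre : ‖Complex.exp (z * ((XX w p - ∑ v, aa w v p : ℝ) : ℂ))‖
        = Real.exp (θ * (XX w p - ∑ v, aa w v p)) := by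
      rw [Complex.norm_exp]
      congr 1
      simp [hz]
    rw [hre]
    have hprod : ∏ v, ‖(Complex.exp (z * (aa w v p : ℝ)) + Complex.exp (z * ((- aa w v p : ℝ) : ℂ))) / 2‖
        ≤ D p * ∏ v, ((Real.exp (θ * aa w v p) + Real.exp (θ * - aa w v p)) / 2) := by
      simp only [hD]
      rw [Finset.mul_sum, Real.exp_sum, ← Finset.prod_mul_distrib]
      refine Finset.prod_le_prod (fun v _ => norm_nonneg _) fun v _ => ?_
      have ha := aa_abs hn w m hm v p
      have := norm_cosh_le (θ * aa w v p) (r * aa w v p)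
        (by rw [abs_mul, hθ1]; linarith) (by
          rw [abs_mul]
          exact (mul_le_mul_of_nonneg_left ha (abs_nonneg r)).trans hr)
      rw [Complex.cosh, Real.cosh_eq] at this
      calc _ = ‖(Complex.exp (((θ * aa w v p : ℝ) : ℂ) + ((r * aa w v p : ℝ) : ℂ) * Complex.I) +
              Complex.exp (-(((θ * aa w v p : ℝ) : ℂ) + ((r * aa w v p : ℝ) : ℂ) * Complex.I))) / 2‖ := by
            congr 4
            · simp only [hz]; push_cast; ring
            · simp only [hz]; push_cast; ring
        _ ≤ _ := this
        _ = _ := by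
            rw [mul_comm, mul_neg]
            congr 2
            ring
    calc _ ≤ Real.exp (θ * (XX w p - ∑ v, aa w v p)) *
        (D p * ∏ v, ((Real.exp (θ * aa w v p) + Real.exp (θ * - aa w v p)) / 2)) := by gcongr
      _ = _ := by ring
  refine step1.trans ?_
  have hcs := Finset.sum_mul_sq_le_sq_mul_sq Finset.univ D (fun p => Real.exp (θ * XX w p))
  have e1 : ∀ p : Equiv.Perm (Fin n), Real.exp (θ * XX w p) ^ 2 = Real.exp ((2 * θ) * XX w p) := by
    intro p
    rw [← Real.exp_nat_mul]; congr 1; push_cast; ring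
  simp only [e1] at hcs
  have hmgf := mgf n (by omega) w h2 (2 * θ) (by rw [mul_pow, hθ]; norm_num)
  have hD2 : ∑ p, D p ^ 2 ≤ n.factorial * (Real.exp (-(r ^ 2) / 4608) ^ 2 + 48 * m ^ 2) := by
    have hp : ∀ p, D p ^ 2 ≤ Real.exp (-(r ^ 2) / 4608) ^ 2 + if YY w p < 1 / 4 then 1 else 0 := by
      intro p
      have hy := YY_eq hn w p
      simp only [hD]
      rw [← Real.exp_nat_mul, ← Real.exp_nat_mul]
      push_cast
      split_ifs with h
      · have hs : 0 ≤ ∑ v, aa w v p ^ 2 := Finset.sum_nonneg fun v _ => sq_nonneg _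
        have : Real.exp (2 * (-(r ^ 2) / 32 * ∑ v, aa w v p ^ 2)) ≤ 1 := by
          rw [Real.exp_le_one_iff]
          nlinarith [mul_nonneg (sq_nonneg r) hs]
        have := Real.exp_pos (2 * (-(r ^ 2) / 4608))
        linarith
      · rw [add_zero]
        apply Real.exp_le_exp.2
        push Not at h
        have : 1 / 144 ≤ ∑ v, aa w v p ^ 2 := by linarith
        nlinarith [mul_le_mul_of_nonneg_left this (sq_nonneg r)]
    refine (Finset.sum_le_sum fun p _ => hp p).trans ?_
    rw [Finset.sum_add_distrib, Finset.sum_boole, Finset.sum_const, card_univ, Fintype.card_perm, Fintype.card_fin,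
      nsmul_eq_mul]
    have := Ybad n w h1 h2 m hm
    linarith
  have hfin := hcs.trans (mul_le_mul hD2 hmgf (Finset.sum_nonneg fun p _ => (Real.exp_pos _).le) (by positivity))
  apply le_of_sq_le_sq _ (by positivity)
  refine hfin.trans ?_
  have he : Real.exp 1 ≤ 4 := by have := Real.exp_one_lt_d9; linarith
  set q := Real.exp (-(r ^ 2) / 4608)
  have hq : 0 < q := Real.exp_pos _
  calc _ ≤ (n.factorial : ℝ) * (q ^ 2 + 48 * m ^ 2) * (n.factorial * 4) := by gcongr
    _ = (n.factorial : ℝ)^2 * (4 * (q ^ 2 + 48 * m ^ 2)) := by ring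
    _ ≤ (n.factorial : ℝ)^2 * (4 * (q + 7 * m)^2) := by
        gcongr
        nlinarith [mul_pos hq hm0, sq_nonneg m]
    _ = _ := by ring

lemma geo_sum (q : ℝ) (hq0 : 0 ≤ q) (hq1 : q < 1) (S : Finset ℕ) (φ : ℕ → ℕ)
    (hφ : ∀ a ∈ S, ∀ b ∈ S, φ a = φ b → a = b) : ∑ l ∈ S, q ^ φ l ≤ (1 - q)⁻¹ := by
  classical
  rw [← Finset.sum_image (f := fun k => q ^ k) (g := φ) (s := S) (fun a ha b hb h => hφ a ha b hb h),
    ← tsum_geometric_of_lt_one hq0 hq1]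
  exact (summable_geometric_of_lt_one hq0 hq1).sum_le_tsum _ (fun i _ => by positivity)

lemma gauss_sum (κ : ℝ) (hκ : 0 < κ) (N j : ℕ) :
    ∑ l ∈ range N, Real.exp (-κ * ((j:ℝ) - l) ^ 2) ≤ 2 * (1 - Real.exp (-κ))⁻¹ := by
  have hq1 : Real.exp (-κ) < 1 := by rw [Real.exp_lt_one_iff]; linarith
  have hq0 : 0 ≤ Real.exp (-κ) := (Real.exp_pos _).le
  have key : ∀ k : ℕ, Real.exp (-κ * (k:ℝ)^2) ≤ Real.exp (-κ) ^ k := by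
    intro k
    rw [← Real.exp_nat_mul]
    apply Real.exp_le_exp.2
    have : (k:ℝ) ≤ (k:ℝ)^2 := by exact_mod_cast (Nat.le_self_pow (by norm_num) k)
    nlinarith
  rw [← Finset.sum_filter_add_sum_filter_not (range N) (fun l => l ≤ j), two_mul]
  gcongr
  · refine le_trans (Finset.sum_le_sum fun l hl => ?_)
      (geo_sum (Real.exp (-κ)) hq0 hq1 _ (fun l => j - l) ?_)
    · have h : l ≤ j := (mem_filter.1 hl).2
      have := key (j - l)
      rwa [Nat.cast_sub h] at this
    · intro a ha b hb hab
      have := (mem_filter.1 ha).2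
      have := (mem_filter.1 hb).2
      omega
  · refine le_trans (Finset.sum_le_sum fun l hl => ?_)
      (geo_sum (Real.exp (-κ)) hq0 hq1 _ (fun l => l - j) ?_)
    · have h : j ≤ l := (not_le.1 (mem_filter.1 hl).2).le
      have := key (l - j)
      rw [Nat.cast_sub h] at this
      rwa [show ((j:ℝ) - l)^2 = ((l:ℝ) - j)^2 by ring]
    · intro a ha b hb hab
      have := (mem_filter.1 ha).2
      have := (mem_filter.1 hb).2
      omega

/-- kernel expansion -/
lemma kernel_sq (N : ℕ) (y : ℝ) :
    ((‖∑ j ∈ range N, Complex.exp (((j:ℝ) * y : ℝ) * Complex.I)‖ ^ 2 : ℝ) : ℂ)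
      = ∑ j ∈ range N, ∑ l ∈ range N, Complex.exp ((((j:ℝ) - l) * y : ℝ) * Complex.I) := by
  push_cast
  rw [← Complex.mul_conj', map_sum, Finset.sum_mul_sum]
  refine Finset.sum_congr rfl fun j _ => Finset.sum_congr rfl fun l _ => ?_
  rw [← Complex.exp_conj, ← Complex.exp_add]
  congr 1
  simp
  ring

lemma kernel_lower (N : ℕ) (y : ℝ) (hy : ∀ j < N, |(j:ℝ) * y| ≤ 1) :
    (N:ℝ) ^ 2 / 4 ≤ ‖∑ j ∈ range N, Complex.exp (((j:ℝ) * y : ℝ) * Complex.I)‖ ^ 2 := by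
  have h1 : (N:ℝ) / 2 ≤ (∑ j ∈ range N, Complex.exp (((j:ℝ) * y : ℝ) * Complex.I)).re := by
    rw [Complex.re_sum]
    calc (N:ℝ)/2 = ∑ j ∈ range N, (1/2:ℝ) := by simp; ring
      _ ≤ _ := by
        refine Finset.sum_le_sum fun j hj => ?_
        rw [Complex.exp_ofReal_mul_I_re]
        have h := hy j (mem_range.1 hj)
        have := Real.one_sub_sq_div_two_le_cos (x := (j:ℝ) * y)
        nlinarith [abs_le.1 h]
  have h2 := h1.trans (Complex.re_le_norm _)
  have := pow_le_pow_left₀ (by positivity) h2 2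
  linarith [this, show ((N:ℝ)/2)^2 = (N:ℝ)^2/4 by ring]

lemma scale_m : ∃ C > (0:ℝ), ∀ (n : ℕ), 2 ≤ n → ∀ w : Fin n → ℝ, (∑ i, w i = 0) →
    (∑ i, w i ^ 2 = 1) → ∀ m : ℝ, (∀ i, |w i| ≤ m) → 0 < m → m ≤ 1 → ∀ L : ℝ,
    ((univ.filter fun p : Equiv.Perm (Fin n) => |XX w p - L| ≤ 5 * m).card : ℝ)
      ≤ C * m * Real.exp (-|L|) * n.factorial := by
  set κ : ℝ := 1 / 115200 with hκ
  set C2 := 2 * (1 - Real.exp (-κ))⁻¹ with hC2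
  have hC2p : 0 < C2 := by
    have hq1 : Real.exp (-κ) < 1 := by rw [Real.exp_lt_one_iff, hκ]; norm_num
    have : 0 < 1 - Real.exp (-κ) := by linarith
    positivity
  refine ⟨8 * Real.exp 5 * (C2 + 7), by positivity, ?_⟩
  intro n hn w h1 h2 m hm hm0 hm1 L
  have hf : (0:ℝ) < n.factorial := by exact_mod_cast n.factorial_pos
  obtain ⟨θ, hθ, hθL⟩ : ∃ θ : ℝ, θ ^ 2 = 1 ∧ θ * L = |L| := by
    rcases le_total 0 L with h | h
    · exact ⟨1, by norm_num, by rw [abs_of_nonneg h]; ring⟩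
    · exact ⟨-1, by norm_num, by rw [abs_of_nonpos h]; ring⟩
  have hθ1 : |θ| = 1 := by
    rw [← abs_one, ← sq_eq_sq_iff_abs_eq_abs, hθ]; norm_num
  set N := ⌈1 / m⌉₊ with hN
  have hN1 : 1 / m ≤ N := Nat.le_ceil _
  have hN2 : (N:ℝ) < 1 / m + 1 := Nat.ceil_lt_add_one (by positivity)
  have hNpos : (0:ℝ) < N := lt_of_lt_of_le (by positivity) hN1
  have hjm : ∀ j < N, (j:ℝ) * m ≤ 1 := by
    intro j hj
    have : (j:ℝ) + 1 ≤ N := by exact_mod_cast hj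
    have : (j:ℝ) ≤ 1 / m := by linarith
    rwa [le_div_iff₀ hm0] at this
  set S : Equiv.Perm (Fin n) → ℝ := fun p =>
    ‖∑ j ∈ range N, Complex.exp (((j:ℝ) * ((XX w p - L) / 5) : ℝ) * Complex.I)‖ ^ 2 with hS
  -- pointwise
  have hpt : ∀ p ∈ univ.filter (fun p : Equiv.Perm (Fin n) => |XX w p - L| ≤ 5 * m),
      (N:ℝ) ^ 2 / 4 * Real.exp (|L| - 5) ≤ Real.exp (θ * XX w p) * S p := by
    intro p hp
    have hp := (mem_filter.1 hp).2
    have a1 := kernel_lower N ((XX w p - L) / 5) (by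
      intro j hj
      rw [abs_mul, abs_div, abs_of_nonneg (Nat.cast_nonneg j), abs_of_pos (by norm_num : (0:ℝ) < 5)]
      have := hjm j hj
      have h3 : |XX w p - L| / 5 ≤ m := by linarith
      exact (mul_le_mul_of_nonneg_left h3 (Nat.cast_nonneg j)).trans this)
    have a2 : Real.exp (|L| - 5) ≤ Real.exp (θ * XX w p) := by
      apply Real.exp_le_exp.2
      have h3 : |θ * (XX w p - L)| ≤ 5 := by
        rw [abs_mul, hθ1]; linarith
      have := (abs_le.1 h3).1
      nlinarith
    rw [mul_comm]
    exact mul_le_mul a2 a1 (by positivity) (by positivity)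
  have hcard : ((univ.filter fun p : Equiv.Perm (Fin n) => |XX w p - L| ≤ 5 * m).card : ℝ) *
      ((N:ℝ) ^ 2 / 4 * Real.exp (|L| - 5)) ≤ ∑ p, Real.exp (θ * XX w p) * S p := by
    rw [← nsmul_eq_mul]
    refine (Finset.card_nsmul_le_sum _ _ _ hpt).trans ?_
    exact Finset.sum_le_univ_sum_of_nonneg fun p => by simp only [hS]; positivity
  have hexp : ((∑ p, Real.exp (θ * XX w p) * S p : ℝ) : ℂ) =
      ∑ j ∈ range N, ∑ l ∈ range N, Complex.exp ((-(((j:ℝ) - l) / 5 * L) : ℝ) * Complex.I) *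
        ∑ p : Equiv.Perm (Fin n), Complex.exp ((θ + ((((j:ℝ) - l) / 5 : ℝ) : ℂ) * Complex.I) * XX w p) := by
    rw [Complex.ofReal_sum]
    simp only [hS, Complex.ofReal_mul (Real.exp _), kernel_sq, Finset.mul_sum]
    rw [Finset.sum_comm]
    refine Finset.sum_congr rfl fun j _ => ?_
    rw [Finset.sum_comm]
    refine Finset.sum_congr rfl fun l _ => ?_
    refine Finset.sum_congr rfl fun p _ => ?_
    rw [Complex.ofReal_exp, ← Complex.exp_add, ← Complex.exp_add]
    congr 1
    push_cast
    ring
  have hnorm : ∑ p, Real.exp (θ * XX w p) * S p ≤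
      ∑ j ∈ range N, ∑ l ∈ range N, n.factorial * (2 * (Real.exp (-κ * ((j:ℝ) - l) ^ 2) + 7 * m)) := by
    calc _ ≤ ‖((∑ p, Real.exp (θ * XX w p) * S p : ℝ) : ℂ)‖ := by
          rw [Complex.norm_real]; exact le_abs_self _
      _ ≤ _ := by
          rw [hexp]
          refine (norm_sum_le _ _).trans (Finset.sum_le_sum fun j hj => ?_)
          refine (norm_sum_le _ _).trans (Finset.sum_le_sum fun l hl => ?_)
          rw [norm_mul, Complex.norm_exp_ofReal_mul_I, one_mul]
          have hj' := hjm j (mem_range.1 hj)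
          have hl' := hjm l (mem_range.1 hl)
          have := fourier_tilt n hn w h1 h2 m hm hm0 hm1 θ (((j:ℝ) - l) / 5) hθ (by
            rw [show |((j:ℝ) - l) / 5| * m = |((j:ℝ) - l) / 5 * m| by rw [abs_mul, abs_of_pos hm0], abs_le]
            have : 0 ≤ (j:ℝ) * m := by positivity
            have : 0 ≤ (l:ℝ) * m := by positivity
            constructor <;> nlinarith)
          refine this.trans (le_of_eq ?_)
          rw [show -((((j:ℝ) - l) / 5) ^ 2) / 4608 = -κ * ((j:ℝ) - l) ^ 2 by rw [hκ]; ring]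
  have hsum : ∑ j ∈ range N, ∑ l ∈ range N, n.factorial * (2 * (Real.exp (-κ * ((j:ℝ) - l) ^ 2) + 7 * m))
      ≤ n.factorial * (2 * (N * C2 + 7 * m * N ^ 2)) := by
    calc _ ≤ ∑ j ∈ range N, (n.factorial * (2 * (C2 + 7 * m * N)) : ℝ) := by
          refine Finset.sum_le_sum fun j _ => ?_
          rw [← Finset.mul_sum, ← Finset.mul_sum, Finset.sum_add_distrib, Finset.sum_const, card_range, nsmul_eq_mul]
          have := gauss_sum κ (by rw [hκ]; norm_num) N j
          rw [mul_comm (N:ℝ) (7 * m)]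
          gcongr
      _ = _ := by
          rw [Finset.sum_const, card_range, nsmul_eq_mul]; ring
  have hall := hcard.trans (hnorm.trans hsum)
  have hNm : 1 ≤ N * m := by rwa [div_le_iff₀ hm0] at hN1
  have hb : n.factorial * (2 * (N * C2 + 7 * m * N ^ 2)) ≤ (n.factorial : ℝ) * (2 * ((C2 + 7) * m * N ^ 2)) := by
    gcongr
    have : C2 * N * 1 ≤ C2 * N * (N * m) := by gcongr
    nlinarith
  have hall := hall.trans hb
  have he : Real.exp (|L| - 5) * (Real.exp 5 * Real.exp (-|L|)) = 1 := by
    rw [← Real.exp_add, ← Real.exp_add, Real.exp_eq_one_iff]; ring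
  set K := ((univ.filter fun p : Equiv.Perm (Fin n) => |XX w p - L| ≤ 5 * m).card : ℝ)
  have hE : 0 < Real.exp 5 * Real.exp (-|L|) := by positivity
  have h4 := mul_le_mul_of_nonneg_right hall hE.le
  have h5 : K * ((N:ℝ) ^ 2 / 4 * Real.exp (|L| - 5)) * (Real.exp 5 * Real.exp (-|L|)) = (N:ℝ)^2 * (K / 4) := by
    linear_combination K * (N:ℝ)^2/4 * he
  rw [h5] at h4
  have h6 : (N:ℝ)^2 * (K / 4) ≤ (N:ℝ)^2 * ((n.factorial : ℝ) * (2 * ((C2 + 7) * m)) * (Real.exp 5 * Real.exp (-|L|))) := by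
    refine h4.trans (le_of_eq ?_); ring
  have h7 := le_of_mul_le_mul_left h6 (by positivity)
  linarith

def insPerm {n : ℕ} (i0 k : Fin (n + 1)) (σ : Equiv.Perm (Fin n)) : Equiv.Perm (Fin (n + 1)) :=
  (finSuccEquiv' i0).trans ((Equiv.optionCongr σ).trans (finSuccEquiv' k).symm)

lemma insPerm_self {n : ℕ} (i0 k : Fin (n + 1)) (σ : Equiv.Perm (Fin n)) : insPerm i0 k σ i0 = k := by
  simp [insPerm]

lemma insPerm_succAbove {n : ℕ} (i0 k : Fin (n + 1)) (σ : Equiv.Perm (Fin n)) (i : Fin n) :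
    insPerm i0 k σ (i0.succAbove i) = k.succAbove (σ i) := by
  simp [insPerm]

lemma sum_insPerm {n : ℕ} (i0 : Fin (n + 1)) (F : Equiv.Perm (Fin (n + 1)) → ℝ) :
    ∑ p, F p = ∑ σ : Equiv.Perm (Fin n), ∑ k, F (insPerm i0 k σ) := by
  have hb : Function.Bijective (fun x : Equiv.Perm (Fin n) × Fin (n + 1) => insPerm i0 x.2 x.1) := by
    rw [Fintype.bijective_iff_injective_and_card]
    constructor
    · rintro ⟨σ, k⟩ ⟨σ', k'⟩ h
      simp only at h
      have hk : k = k' := by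
        rw [← insPerm_self i0 k σ, h, insPerm_self]
      subst hk
      have : σ = σ' := by
        ext i
        have := insPerm_succAbove i0 k σ i
        rw [h, insPerm_succAbove] at this
        rw [Fin.succAbove_right_injective this]
      rw [this]
    · simp [Fintype.card_perm, Nat.factorial_succ, mul_comm]
  rw [← hb.sum_comp, Fintype.sum_prod_type]

lemma count_line (n : ℕ) (c y R : ℝ) (hc : c ≠ 0) (hR : 0 ≤ R) :
    ((univ.filter fun k : Fin n => |c * ((k:ℕ) + 1 : ℝ) + y| ≤ R).card : ℝ) ≤ 2 * R / |c| + 1 := by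
  set A := univ.filter fun k : Fin n => |c * ((k:ℕ) + 1 : ℝ) + y| ≤ R
  have hc' : 0 < |c| := abs_pos.2 hc
  rcases A.eq_empty_or_nonempty with h | h
  · rw [h]; simp; positivity
  have hle : A.card ≤ ((A.max' h : Fin n) : ℕ) - (A.min' h : Fin n) + 1 := by
    have hsub : A ⊆ Finset.Icc (A.min' h) (A.max' h) := by
      intro x hx
      rw [Finset.mem_Icc]
      exact ⟨A.min'_le x hx, A.le_max' x hx⟩
    have := Finset.card_le_card hsub
    rw [Fin.card_Icc] at this
    omega
  have h1 := (mem_filter.1 (A.max'_mem h)).2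
  have h2 := (mem_filter.1 (A.min'_mem h)).2
  have hmm : (A.min' h : ℕ) ≤ (A.max' h : ℕ) := A.min'_le_max' h
  have hle' : (A.card : ℝ) ≤ ((A.max' h : ℕ) : ℝ) - ((A.min' h : ℕ) : ℝ) + 1 := by
    rw [← Nat.cast_sub hmm]; exact_mod_cast hle
  have h3 : |c| * (((A.max' h : ℕ) : ℝ) - ((A.min' h : ℕ) : ℝ)) ≤ 2 * R := by
    have : (0:ℝ) ≤ ((A.max' h : ℕ) : ℝ) - ((A.min' h : ℕ) : ℝ) := by
      rw [sub_nonneg]; exact_mod_cast hmm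
    rw [← abs_of_nonneg this, ← abs_mul]
    calc _ = |(c * ((A.max' h : ℕ) + 1 : ℝ) + y) - (c * ((A.min' h : ℕ) + 1 : ℝ) + y)| := by congr 1; ring
      _ ≤ _ := (abs_sub _ _).trans (by linarith)
  have h4 : ((A.max' h : ℕ) : ℝ) - ((A.min' h : ℕ) : ℝ) ≤ 2 * R / |c| := by
    rw [le_div_iff₀ hc']; linarith
  linarith

lemma W_eq (n : ℕ) (hn : 0 < n) (w : Fin n → ℝ) (h1 : ∑ i, w i = 0) (p : Equiv.Perm (Fin n)) :
    ∑ i, w i * ((p i : ℕ) + 1 : ℝ) = n * XX w p := by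
  have hn' : (n:ℝ) ≠ 0 := by exact_mod_cast hn.ne'
  unfold XX xval
  rw [Finset.mul_sum]
  have : ∑ i, w i * (((n:ℝ) + 1) / 2) = 0 := by rw [← Finset.sum_mul, h1, zero_mul]
  rw [← sub_zero (∑ i, w i * ((p i : ℕ) + 1 : ℝ)), ← this, ← Finset.sum_sub_distrib]
  refine Finset.sum_congr rfl fun i _ => ?_
  field_simp

lemma sum_abs_le (n : ℕ) (w : Fin n → ℝ) (h2 : ∑ i, w i ^ 2 = 1) : ∑ i, |w i| ≤ Real.sqrt n := by
  apply Real.le_sqrt_of_sq_le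
  have := sq_sum_le_card_mul_sum_sq (s := (univ : Finset (Fin n))) (f := fun i => |w i|)
  simpa [h2] using this

lemma insPerm_W (n : ℕ) (w : Fin (n + 1) → ℝ) (h2 : ∑ i, w i ^ 2 = 1) (i0 k : Fin (n + 1))
    (σ : Equiv.Perm (Fin n)) :
    |∑ i, w i * ((insPerm i0 k σ i : ℕ) + 1 : ℝ) -
      (w i0 * ((k:ℕ) + 1 : ℝ) + ∑ i, w (i0.succAbove i) * ((σ i : ℕ) + 1 : ℝ))| ≤ Real.sqrt (n + 1 : ℕ) := by
  rw [Fin.sum_univ_succAbove _ i0, insPerm_self, add_sub_add_left_eq_sub, ← Finset.sum_sub_distrib]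
  refine (Finset.abs_sum_le_sum_abs _ _).trans (le_trans ?_ (sum_abs_le (n + 1) w h2))
  rw [Fin.sum_univ_succAbove _ i0]
  refine le_trans (Finset.sum_le_sum fun i _ => ?_) (le_add_of_nonneg_left (abs_nonneg _))
  rw [insPerm_succAbove, ← mul_sub, abs_mul]
  refine mul_le_of_le_one_right (abs_nonneg _) ?_
  rcases lt_or_ge (σ i).castSucc k with h | h
  · rw [Fin.succAbove_of_castSucc_lt _ _ h]; simp
  · rw [Fin.succAbove_of_le_castSucc _ _ h]; simp

theorem stmt_6 :
    ∃ C > (0:ℝ), ∃ c > (0:ℝ), ∀ (n : ℕ), 2 ≤ n → ∀ w : Fin n → ℝ,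
      (∑ i, w i = 0) → (∑ i, w i ^ 2 = 1) → ∀ L : ℝ,
      ((Finset.univ.filter (fun π : Equiv.Perm (Fin n) =>
          |∑ i, w i * ((π i : ℕ) + 1 : ℝ) - L * n| ≤ Real.sqrt n)).card : ℝ) / (n.factorial : ℝ)
        ≤ C / Real.sqrt n * Real.exp (-c * |L|) := by
  obtain ⟨C, hC, hmain⟩ := scale_m
  refine ⟨5 * C, by positivity, 1, one_pos, ?_⟩
  intro n hn w h1 h2 L
  obtain ⟨n, rfl⟩ : ∃ k, n = k + 1 := ⟨n - 1, by omega⟩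
  obtain ⟨i0, -, hi0⟩ := Finset.exists_max_image (univ : Finset (Fin (n + 1))) (fun i => |w i|) ⟨0, mem_univ _⟩
  have hm : ∀ i, |w i| ≤ |w i0| := fun i => hi0 i (mem_univ i)
  have hnm := one_le_nm (n + 1) w h2 _ hm
  set m := |w i0| with hmdef
  set M : ℝ := ((n + 1 : ℕ) : ℝ) with hM
  have hMpos : 0 < M := by rw [hM]; positivity
  have hM1 : 1 ≤ M := by rw [hM]; exact_mod_cast (by omega : 1 ≤ n + 1)
  have hm0 : 0 < m := by
    rcases (abs_nonneg (w i0)).eq_or_lt with h | h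
    · exfalso; rw [← hmdef] at h; rw [← h] at hnm; norm_num at hnm
    · exact h
  have hm1 : m ≤ 1 := by
    have : w i0 ^ 2 ≤ 1 := by
      rw [← h2]; exact Finset.single_le_sum (f := fun i => w i ^ 2) (fun i _ => sq_nonneg _) (mem_univ i0)
    exact abs_le_one_iff_mul_self_le_one.2 (by nlinarith)
  have hw0 : w i0 ≠ 0 := abs_pos.1 hm0
  set s := Real.sqrt M with hs
  have hs1 : 1 ≤ s := Real.one_le_sqrt.2 hM1
  have hss : s * s = M := Real.mul_self_sqrt hMpos.le
  have hsm : s ≤ M * m := by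
    apply Real.sqrt_le_iff.2
    refine ⟨by positivity, ?_⟩
    nlinarith
  have hf : (0:ℝ) < ((n + 1).factorial : ℝ) := by exact_mod_cast (n + 1).factorial_pos
  set W : Equiv.Perm (Fin (n + 1)) → ℝ := fun p => ∑ i, w i * ((p i : ℕ) + 1 : ℝ) with hW
  set V : Equiv.Perm (Fin n) → ℝ := fun σ => ∑ i, w (i0.succAbove i) * ((σ i : ℕ) + 1 : ℝ) with hV
  have hins : ∀ k σ, |W (insPerm i0 k σ) - (w i0 * ((k:ℕ) + 1 : ℝ) + V σ)| ≤ s :=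
    fun k σ => insPerm_W n w h2 i0 k σ
  have hk : ∀ k : Fin (n + 1), |w i0 * ((k:ℕ) + 1 : ℝ)| ≤ M * m := by
    intro k
    have hkM : ((k:ℕ) + 1 : ℝ) ≤ M := by rw [hM]; exact_mod_cast k.isLt
    rw [abs_mul, abs_of_nonneg (by positivity : (0:ℝ) ≤ ((k:ℕ) + 1 : ℝ)), mul_comm]
    exact mul_le_mul_of_nonneg_right hkM hm0.le
  set K5 := ((univ.filter fun p : Equiv.Perm (Fin (n + 1)) => |XX w p - L| ≤ 5 * m).card : ℝ) with hK5
  set K3 := ((univ.filter fun σ : Equiv.Perm (Fin n) => |V σ - L * M| ≤ 3 * (M * m)).card : ℝ) with hK3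
  set K := ((univ.filter fun p : Equiv.Perm (Fin (n + 1)) => |W p - L * M| ≤ s).card : ℝ) with hK
  have stepA : K ≤ K3 * (5 * s / m) := by
    have e : K = ∑ p : Equiv.Perm (Fin (n + 1)), if |W p - L * M| ≤ s then (1:ℝ) else 0 := by
      rw [Finset.sum_boole]
    have e3 : K3 * (5 * s / m) = ∑ σ : Equiv.Perm (Fin n), if |V σ - L * M| ≤ 3 * (M * m) then (5 * s / m) else 0 := by
      rw [← Finset.sum_filter, Finset.sum_const, nsmul_eq_mul]
    rw [e, e3, sum_insPerm i0]
    refine Finset.sum_le_sum fun σ _ => ?_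
    have hle : ∀ k, |W (insPerm i0 k σ) - L * M| ≤ s → |w i0 * ((k:ℕ) + 1 : ℝ) + (V σ - L * M)| ≤ 2 * s := by
      intro k h
      have h' := hins k σ
      rw [abs_le] at h h' ⊢
      constructor <;> linarith [h.1, h.2, h'.1, h'.2]
    rw [Finset.sum_boole]
    split_ifs with hc
    · have hsub : (univ.filter fun k => |W (insPerm i0 k σ) - L * M| ≤ s) ⊆
          univ.filter fun k : Fin (n + 1) => |w i0 * ((k:ℕ) + 1 : ℝ) + (V σ - L * M)| ≤ 2 * s :=
        Finset.monotone_filter_right _ (fun k _ h => hle k h)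
      have h5 : ((univ.filter fun k => |W (insPerm i0 k σ) - L * M| ≤ s).card : ℝ) ≤
          ((univ.filter fun k : Fin (n + 1) => |w i0 * ((k:ℕ) + 1 : ℝ) + (V σ - L * M)| ≤ 2 * s).card : ℝ) := by
        exact_mod_cast Finset.card_le_card hsub
      have h6 := count_line (n + 1) (w i0) (V σ - L * M) (2 * s) hw0 (by linarith)
      refine h5.trans (h6.trans ?_)
      rw [← hmdef, div_add_one hm0.ne']
      gcongr
      linarith
    · have : (univ.filter fun k => |W (insPerm i0 k σ) - L * M| ≤ s) = ∅ := by
        rw [Finset.filter_eq_empty_iff]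
        intro k _ h
        apply hc
        have a1 := hle k h
        have a2 := hk k
        rw [abs_le] at a1 a2 ⊢
        constructor <;> linarith [a1.1, a1.2, a2.1, a2.2]
      rw [this]; simp
  have stepB : M * K3 ≤ K5 := by
    have e5 : K5 = ∑ p : Equiv.Perm (Fin (n + 1)), if |XX w p - L| ≤ 5 * m then (1:ℝ) else 0 := by
      rw [Finset.sum_boole]
    have e3 : M * K3 = ∑ σ : Equiv.Perm (Fin n), ∑ k : Fin (n + 1), if |V σ - L * M| ≤ 3 * (M * m) then (1:ℝ) else 0 := by
      simp only [Finset.sum_const, card_univ, Fintype.card_fin, nsmul_eq_mul]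
      rw [← Finset.mul_sum, Finset.sum_boole]
    rw [e5, e3, sum_insPerm i0]
    refine Finset.sum_le_sum fun σ _ => Finset.sum_le_sum fun k _ => ?_
    by_cases hc : |V σ - L * M| ≤ 3 * (M * m)
    · rw [if_pos hc, if_pos]
      have h6 : W (insPerm i0 k σ) = M * XX w (insPerm i0 k σ) := W_eq (n + 1) (by omega) w h1 _
      have a1 := hins k σ
      have a2 := hk k
      have h7 : |M * (XX w (insPerm i0 k σ) - L)| ≤ M * (5 * m) := by
        rw [mul_sub, ← h6]
        rw [abs_le] at a1 a2 hc ⊢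
        constructor <;> linarith [a1.1, a1.2, a2.1, a2.2, hc.1, hc.2]
      rw [abs_mul, abs_of_pos hMpos] at h7
      exact le_of_mul_le_mul_left h7 hMpos
    · rw [if_neg hc]; split_ifs <;> norm_num
  have stepC := hmain (n + 1) hn w h1 h2 m hm hm0 hm1 L
  rw [div_le_iff₀ hf]
  change K ≤ _
  have hE := Real.exp_pos (-|L|)
  have h8 : M * K ≤ M * (5 * C / s * Real.exp (-1 * |L|) * ((n + 1).factorial : ℝ)) := by
    calc M * K ≤ M * (K3 * (5 * s / m)) := by gcongr
      _ = (M * K3) * (5 * s / m) := by ring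
      _ ≤ (C * m * Real.exp (-|L|) * ((n + 1).factorial : ℝ)) * (5 * s / m) := by
          have := stepB.trans stepC
          gcongr
      _ = s * s * (5 * C / s * Real.exp (-1 * |L|) * ((n + 1).factorial : ℝ)) := by
          rw [neg_one_mul]
          field_simp
      _ = _ := by rw [hss]
  exact le_of_mul_le_mul_left h8 hMpos
end

section
/- Let $u_1,\ldots,u_n$ be real numbers, not all equal, and let $\pi$ be a uniform random permutation of $\{1,\ldots,n\}$. Then for every $x\in\mathbb{R}$, $\mathbb{P}\{\sum_{i=1}^n u_i \pi(i) = x\} \le C/n$ for an absolute constant $C$. -/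
open Finset

lemma count_eq {n : ℕ} (s : Finset (Fin n)) (π₀ : Equiv.Perm (Fin n)) :
    (univ.filter (fun π : Equiv.Perm (Fin n) => ∀ x ∈ s, π x = π₀ x)).card = (n - s.card).factorial := by
  classical
  have e := Equiv.Set.compl (π₀.image (s : Set (Fin n)))
  have h1 : (univ.filter (fun π : Equiv.Perm (Fin n) => ∀ x ∈ s, π x = π₀ x)).card
      = Fintype.card {e : Equiv.Perm (Fin n) // ∀ x : (s : Set (Fin n)), e x = (π₀.image (s : Set (Fin n))) x} := by
    rw [Fintype.card_subtype]
    congr 1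
    ext π
    simp [Equiv.image]
  rw [h1, Fintype.card_congr e]
  have e2 : ((s : Set (Fin n))ᶜ : Set (Fin n)) ≃ ((π₀ '' (s : Set (Fin n)))ᶜ : Set (Fin n)) :=
    (π₀.image _).trans (Equiv.setCongr (Set.image_compl_eq π₀.bijective))
  rw [Fintype.card_equiv e2, Fintype.card_compl_set]
  simp

lemma count_le {n : ℕ} (s : Finset (Fin n)) (g : Fin n → Fin n) :
    (univ.filter (fun π : Equiv.Perm (Fin n) => ∀ x ∈ s, π x = g x)).card ≤ (n - s.card).factorial := by
  classical
  rcases (univ.filter (fun π : Equiv.Perm (Fin n) => ∀ x ∈ s, π x = g x)).eq_empty_or_nonempty with h | ⟨π₀, h⟩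
  · rw [h]; simp
  · rw [← count_eq s π₀]
    apply card_le_card
    intro π hπ
    simp only [mem_filter, mem_univ, true_and] at h hπ ⊢
    intro x hx
    rw [hπ x hx, h x hx]

lemma chain_le {n : ℕ} (u : Fin n → ℝ) (A : Finset (Fin n))
    (hA : ∀ a ∈ A, ∀ j, j ∉ A → u j < u a) (hA' : ∀ a ∈ A, ∀ j ∈ A, u j = u a) (x : ℝ)
    (a : Fin n) (ha : a ∈ A) :
    (univ.filter (fun π : Equiv.Perm (Fin n) => (∑ i, u i * ((π i : ℕ) + 1 : ℝ) = x) ∧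
      ¬ ∃ b ∈ A, (π b : ℕ) = π a + 1)).card ≤ (n - 1).factorial := by
  classical
  have hn : 0 < n := a.pos
  have : NeZero n := ⟨hn.ne'⟩
  have key : ∀ π ρ : Equiv.Perm (Fin n), (∑ i, u i * ((π i : ℕ) + 1 : ℝ) = x) →
      (∑ i, u i * ((ρ i : ℕ) + 1 : ℝ) = x) → (¬ ∃ b ∈ A, (π b : ℕ) = π a + 1) →
      Fin.cycleRange (π a) * π = Fin.cycleRange (ρ a) * ρ → ¬ (π a < ρ a) := by
    intro π ρ hπ hρ hb h hlt
    have hval : ∀ (p s : Fin n), s ≠ p → ((Fin.cycleRange p s : Fin n) : ℕ) = if s < p then (s:ℕ) + 1 else s := by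
      intro p s hs
      split_ifs with h
      · rw [Fin.coe_cycleRange_of_lt h]
      · rw [Fin.cycleRange_of_gt (lt_of_le_of_ne (not_lt.1 h) hs.symm)]
    have hj : ∀ j, j ≠ a → (ρ j : ℕ) = if (π a < π j ∧ π j ≤ ρ a) then (π j : ℕ) - 1 else π j := by
      intro j hj
      have h1 := congrArg (fun f : Equiv.Perm (Fin n) => ((f j : Fin n) : ℕ)) h
      have n1 : π j ≠ π a := fun h => hj (π.injective h)
      have n2 : ρ j ≠ ρ a := fun h => hj (ρ.injective h)
      simp only [Equiv.Perm.mul_apply] at h1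
      rw [hval _ _ n1, hval _ _ n2] at h1
      simp only [Fin.lt_def, Fin.le_def, ne_eq, Fin.ext_iff] at *
      split_ifs at * <;> omega
    have hs : ∑ i, (((ρ i : ℕ) : ℝ) - ((π i : ℕ) : ℝ)) = 0 := by
      rw [sum_sub_distrib, Equiv.sum_comp ρ (fun i => ((i : ℕ) : ℝ)), Equiv.sum_comp π (fun i => ((i : ℕ) : ℝ)), sub_self]
    have hw : ∑ i, (u a - u i) * (((π i : ℕ) : ℝ) - ((ρ i : ℕ) : ℝ)) = 0 := by
      have : ∑ i, (u a - u i) * (((π i : ℕ) : ℝ) - ((ρ i : ℕ) : ℝ)) =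
        (- u a) * ∑ i, (((ρ i : ℕ) : ℝ) - ((π i : ℕ) : ℝ)) +
          (∑ i, u i * ((ρ i : ℕ) + 1 : ℝ) - ∑ i, u i * ((π i : ℕ) + 1 : ℝ)) := by
        rw [mul_sum, ← sum_sub_distrib, ← sum_add_distrib]
        apply sum_congr rfl
        intros; ring
      rw [this, hs, hπ, hρ]; ring
    have hle : ∀ i, u i ≤ u a := by
      intro i
      by_cases hi : i ∈ A
      · exact (hA' a ha i hi).le
      · exact (hA a ha i hi).le
    have hnn : ∀ i ∈ univ, 0 ≤ (u a - u i) * (((π i : ℕ) : ℝ) - ((ρ i : ℕ) : ℝ)) := by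
      intro i _
      by_cases hi : i = a
      · simp [hi]
      · apply mul_nonneg (sub_nonneg.2 (hle i))
        rw [sub_nonneg, hj i hi]
        split_ifs
        · exact_mod_cast Nat.sub_le _ _
        · exact le_rfl
    have hz := (sum_eq_zero_iff_of_nonneg hnn).1 hw
    have hlt' : (π a : ℕ) < ρ a := hlt
    have hp : (π a : ℕ) + 1 < n := by have := (ρ a).isLt; omega
    obtain ⟨j, hj0⟩ := π.surjective ⟨(π a : ℕ) + 1, hp⟩
    have hjv : (π j : ℕ) = π a + 1 := by rw [hj0]
    have hja : j ≠ a := by rintro rfl; omega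
    have h2 := hz j (mem_univ _)
    have h3 := hj j hja
    rw [if_pos ⟨by rw [Fin.lt_def]; omega, by rw [Fin.le_def]; omega⟩, hjv] at h3
    rw [h3, hjv] at h2
    push_cast at h2
    have h4 : u j = u a := by
      simp at h2
      linarith
    apply hb
    refine ⟨j, ?_, hjv⟩
    by_contra hjA
    exact absurd h4 (hA a ha j hjA).ne
  have h0 := count_le {a} (fun _ => (0 : Fin n))
  rw [card_singleton] at h0
  refine le_trans ?_ h0
  apply card_le_card_of_injOn (fun π => Fin.cycleRange (π a) * π)
  · intro π _
    simp
  · intro π hπ ρ hρ h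
    simp only [coe_filter, mem_univ, true_and, Set.mem_ofPred_eq] at hπ hρ
    have e : π a = ρ a := le_antisymm (not_lt.1 (key ρ π hρ.1 hπ.1 hρ.2 h.symm)) (not_lt.1 (key π ρ hπ.1 hρ.1 hπ.2 h))
    simp only [e] at h
    exact mul_left_cancel h

lemma adj_one {n : ℕ} (a b : Fin n) (hab : a ≠ b) :
    (univ.filter (fun π : Equiv.Perm (Fin n) => (π b : ℕ) = π a + 1)).card = (n - 1).factorial := by
  classical
  obtain ⟨k, rfl⟩ : ∃ k, n = k + 1 := ⟨n - 1, by have := a.pos; omega⟩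
  rw [card_eq_sum_card_fiberwise (f := fun π : Equiv.Perm (Fin (k+1)) => π a) (t := univ) (by intro _ _; simp),
    Fin.sum_univ_castSucc]
  have hlast : (univ.filter (fun π : Equiv.Perm (Fin (k+1)) => (π b : ℕ) = π a + 1)).filter
      (fun π => π a = Fin.last k) = ∅ := by
    ext π
    simp only [mem_filter, mem_univ, true_and, notMem_empty, iff_false, not_and]
    intro h1 h2
    rw [h2] at h1
    have := (π b).isLt
    simp at h1
    omega
  have hmid : ∀ p : Fin k, ((univ.filter (fun π : Equiv.Perm (Fin (k+1)) => (π b : ℕ) = π a + 1)).filter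
      (fun π => π a = Fin.castSucc p)).card = (k + 1 - 2).factorial := by
    intro p
    obtain ⟨π₀, h1, h2⟩ : ∃ π₀ : Equiv.Perm (Fin (k+1)), π₀ a = Fin.castSucc p ∧ π₀ b = Fin.succ p := by
      refine ⟨Equiv.swap (Equiv.swap a (Fin.castSucc p) b) (Fin.succ p) * Equiv.swap a (Fin.castSucc p), ?_, ?_⟩
      · rw [Equiv.Perm.mul_apply, Equiv.swap_apply_left, Equiv.swap_apply_of_ne_of_ne]
        · intro h
          apply hab
          apply (Equiv.swap a (Fin.castSucc p)).injective
          rw [Equiv.swap_apply_left]; exact h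
        · exact (Fin.castSucc_lt_succ).ne
      · rw [Equiv.Perm.mul_apply, Equiv.swap_apply_left]
    have := count_eq {a, b} π₀
    rw [card_pair hab] at this
    rw [← this]
    congr 1
    ext π
    simp only [mem_filter, mem_univ, true_and, mem_insert, mem_singleton, forall_eq_or_imp, forall_eq, h1, h2]
    constructor
    · rintro ⟨h3, h4⟩
      refine ⟨h4, ?_⟩
      rw [h4] at h3
      apply Fin.ext
      simpa using h3
    · rintro ⟨h3, h4⟩
      rw [h3, h4]; simp
  rw [hlast, sum_congr rfl (fun p _ => hmid p)]
  simp only [sum_const, card_univ, Fintype.card_fin, smul_eq_mul, card_empty, add_zero]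
  rcases k with _ | k
  · exact absurd (Fin.ext (by omega)) hab
  · simp [Nat.factorial_succ]

lemma adj_path {n : ℕ} (a b c : Fin n) (hab : a ≠ b) (hbc : b ≠ c) :
    (univ.filter (fun π : Equiv.Perm (Fin n) => (π b : ℕ) = π a + 1 ∧ (π c : ℕ) = π b + 1)).card
      ≤ n * (n - 3).factorial := by
  classical
  by_cases hac : a = c
  · subst hac
    rw [filter_false_of_mem]
    · simp
    · intro π _ h
      omega
  rw [card_eq_sum_card_fiberwise (f := fun π : Equiv.Perm (Fin n) => π a) (t := univ) (by intro _ _; simp)]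
  have : n * (n-3).factorial = ∑ p : Fin n, (n-3).factorial := by simp
  rw [this]
  apply sum_le_sum
  intro p _
  rcases ((univ.filter (fun π : Equiv.Perm (Fin n) => (π b : ℕ) = π a + 1 ∧ (π c : ℕ) = π b + 1)).filter
    (fun π => π a = p)).eq_empty_or_nonempty with h | ⟨π₀, h⟩
  · rw [h]; simp
  have h3 := count_eq {a, b, c} π₀
  rw [card_eq_three.2 ⟨a, b, c, hab, hac, hbc, rfl⟩] at h3
  rw [← h3]
  apply card_le_card
  intro π hπ
  simp only [mem_filter, mem_univ, true_and, mem_insert, mem_singleton, forall_eq_or_imp, forall_eq] at h hπ ⊢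
  simp only [Fin.ext_iff] at h hπ ⊢
  omega

lemma adj_two {n : ℕ} (a b c d : Fin n) (hab : a ≠ b) (hcd : c ≠ d) (hac : a ≠ c) (hbd : b ≠ d)
    (had : a ≠ d) (hbc : b ≠ c) :
    (univ.filter (fun π : Equiv.Perm (Fin n) => (π b : ℕ) = π a + 1 ∧ (π d : ℕ) = π c + 1)).card
      ≤ n ^ 2 * (n - 4).factorial := by
  classical
  rw [card_eq_sum_card_fiberwise (f := fun π : Equiv.Perm (Fin n) => (π a, π c)) (t := univ) (by intro _ _; simp)]
  have : n ^ 2 * (n-4).factorial = ∑ p : Fin n × Fin n, (n-4).factorial := by simp [sq]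
  rw [this]
  apply sum_le_sum
  intro p _
  rcases ((univ.filter (fun π : Equiv.Perm (Fin n) => (π b : ℕ) = π a + 1 ∧ (π d : ℕ) = π c + 1)).filter
    (fun π => (π a, π c) = p)).eq_empty_or_nonempty with h | ⟨π₀, h⟩
  · rw [h]; simp
  have h3 := count_eq {a, b, c, d} π₀
  have h4 : ({a, b, c, d} : Finset (Fin n)).card = 4 := by
    rw [card_insert_of_notMem (by simp [*]), card_insert_of_notMem (by simp [*]), card_pair hcd]
  rw [h4] at h3
  rw [← h3]
  apply card_le_card
  intro π hπ
  simp only [mem_filter, mem_univ, true_and, mem_insert, mem_singleton, forall_eq_or_imp, forall_eq] at h hπ ⊢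
  simp only [Fin.ext_iff, Prod.ext_iff] at h hπ ⊢
  omega

/-- number of adjacent pairs inside `A` -/
def adjCount {n : ℕ} (A : Finset (Fin n)) (π : Equiv.Perm (Fin n)) : ℕ :=
  (A.offDiag.filter (fun e => (π e.2 : ℕ) = π e.1 + 1)).card

lemma adjCount_sum {n : ℕ} (A : Finset (Fin n)) :
    ∑ π : Equiv.Perm (Fin n), adjCount A π = A.offDiag.card * (n - 1).factorial := by
  classical
  simp only [adjCount, card_filter]
  rw [sum_comm, ← smul_eq_mul, ← sum_const]
  apply sum_congr rfl
  intro e he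
  rw [← card_filter]
  exact adj_one _ _ (mem_offDiag.1 he).2.2

lemma adj_pair_le {n : ℕ} (e f : Fin n × Fin n) (he : e.1 ≠ e.2) (hf : f.1 ≠ f.2) :
    (univ.filter (fun π : Equiv.Perm (Fin n) => (π e.2 : ℕ) = π e.1 + 1 ∧ (π f.2 : ℕ) = π f.1 + 1)).card
      ≤ (if e = f then (n-1).factorial else 0) + (if e.2 = f.1 then n * (n-3).factorial else 0)
        + (if e.1 = f.2 then n * (n-3).factorial else 0) + n ^ 2 * (n-4).factorial := by
  classical
  obtain ⟨a, b⟩ := e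
  obtain ⟨c, d⟩ := f
  simp only at he hf ⊢
  by_cases hbc : b = c
  · subst hbc
    have := adj_path a b d he hf
    rw [if_pos (rfl : b = b)]
    omega
  by_cases had : a = d
  · subst had
    have := adj_path c a b hf he
    rw [if_pos (rfl : a = a)]
    have h2 : (univ.filter (fun π : Equiv.Perm (Fin n) => (π b : ℕ) = π a + 1 ∧ (π a : ℕ) = π c + 1))
      = (univ.filter (fun π : Equiv.Perm (Fin n) => (π a : ℕ) = π c + 1 ∧ (π b : ℕ) = π a + 1)) := by
      ext; simp [and_comm]
    rw [h2]
    omega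
  by_cases hac : a = c
  · by_cases hbd : b = d
    · subst hac hbd
      have := adj_one a b he
      simp only [and_self, if_true]
      omega
    · subst hac
      rw [filter_false_of_mem]
      · simp
      · rintro π _ ⟨h1, h2⟩
        exact hbd (π.injective (Fin.ext (by omega)))
  by_cases hbd : b = d
  · subst hbd
    rw [filter_false_of_mem]
    · simp
    · rintro π _ ⟨h1, h2⟩
      exact hac (π.injective (Fin.ext (by omega)))
  have := adj_two a b c d he hf hac hbd had hbc
  omega

lemma adjCount_sq_sum {n : ℕ} (A : Finset (Fin n)) :
    ∑ π : Equiv.Perm (Fin n), (adjCount A π) ^ 2 ≤ A.card ^ 2 * (n - 1).factorial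
      + 2 * A.card ^ 3 * (n * (n-3).factorial) + A.offDiag.card ^ 2 * (n ^ 2 * (n-4).factorial) := by
  classical
  have h1 : ∀ π : Equiv.Perm (Fin n), (adjCount A π) ^ 2 = ∑ e ∈ A.offDiag, ∑ f ∈ A.offDiag,
      if ((π e.2 : ℕ) = π e.1 + 1 ∧ (π f.2 : ℕ) = π f.1 + 1) then 1 else 0 := by
    intro π
    simp only [adjCount, card_filter]
    rw [sq, sum_mul_sum]
    apply sum_congr rfl; intro e _
    apply sum_congr rfl; intro f _
    split_ifs <;> simp_all
  have hod : A.offDiag.card ≤ A.card ^ 2 := by rw [offDiag_card, sq]; omega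
  have hrow : ∀ x : Fin n, (A.offDiag.filter (fun f => x = f.1)).card ≤ A.card := by
    intro x
    apply card_le_card_of_injOn (fun f => f.2)
    · intro f hf
      simp at hf ⊢; tauto
    · rintro ⟨f1, f2⟩ hf ⟨g1, g2⟩ hg h
      simp at hf hg h ⊢
      exact ⟨hf.2.symm.trans hg.2, h⟩
  have hcol : ∀ x : Fin n, (A.offDiag.filter (fun f => x = f.2)).card ≤ A.card := by
    intro x
    apply card_le_card_of_injOn (fun f => f.1)
    · intro f hf
      simp at hf ⊢; tauto
    · rintro ⟨f1, f2⟩ hf ⟨g1, g2⟩ hg h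
      simp at hf hg h ⊢
      exact ⟨h, hf.2.symm.trans hg.2⟩
  calc ∑ π : Equiv.Perm (Fin n), (adjCount A π) ^ 2
      = ∑ e ∈ A.offDiag, ∑ f ∈ A.offDiag,
        (univ.filter (fun π : Equiv.Perm (Fin n) => (π e.2 : ℕ) = π e.1 + 1 ∧ (π f.2 : ℕ) = π f.1 + 1)).card := by
        rw [sum_congr rfl (fun π _ => h1 π), sum_comm]
        apply sum_congr rfl; intro e _
        rw [sum_comm]
        apply sum_congr rfl; intro f _
        rw [card_filter]
    _ ≤ ∑ e ∈ A.offDiag, ∑ f ∈ A.offDiag,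
        ((if e = f then (n-1).factorial else 0) + (if e.2 = f.1 then n * (n-3).factorial else 0)
        + (if e.1 = f.2 then n * (n-3).factorial else 0) + n ^ 2 * (n-4).factorial) := by
        apply sum_le_sum; intro e he
        apply sum_le_sum; intro f hf
        exact adj_pair_le e f (mem_offDiag.1 he).2.2 (mem_offDiag.1 hf).2.2
    _ ≤ ∑ e ∈ A.offDiag, ((n-1).factorial + A.card * (n * (n-3).factorial)
          + A.card * (n * (n-3).factorial) + A.offDiag.card * (n ^ 2 * (n-4).factorial)) := by
        apply sum_le_sum; intro e he
        simp only [sum_add_distrib]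
        gcongr
        · rw [sum_ite_eq, if_pos he]
        · rw [← sum_filter, sum_const, smul_eq_mul]
          exact Nat.mul_le_mul_right _ (hrow _)
        · rw [← sum_filter, sum_const, smul_eq_mul]
          exact Nat.mul_le_mul_right _ (hcol _)
        · rw [sum_const, smul_eq_mul]
    _ = A.offDiag.card * (n-1).factorial + A.offDiag.card * (2 * A.card * (n * (n-3).factorial)) +
          A.offDiag.card ^ 2 * (n ^ 2 * (n-4).factorial) := by
        rw [sum_const, smul_eq_mul]; ring
    _ ≤ A.card ^ 2 * (n-1).factorial + A.card ^ 2 * (2 * A.card * (n * (n-3).factorial)) +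
          A.offDiag.card ^ 2 * (n ^ 2 * (n-4).factorial) := by
        gcongr
    _ = _ := by ring

lemma var_arith (k m F M μ Q : ℝ) (hk : 0 ≤ k) (hm0 : 0 ≤ m) (hm2 : 2 * m ≤ k + 8) (hF : 0 ≤ F)
    (hμ0 : 0 ≤ μ) (hμm : μ ≤ m / 2) (hMμ : M = μ * (k + 8))
    (hQ : Q ≤ m ^ 2 * ((k+7) * ((k+6) * ((k+5) * F))) + 2 * m ^ 3 * ((k+8) * ((k+5) * F))
      + M ^ 2 * ((k+8)^2 * F)) :
    Q - 2 * μ * (M * ((k+7) * ((k+6) * ((k+5) * F)))) + μ ^ 2 * ((k+8) * ((k+7) * ((k+6) * ((k+5) * F))))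
      ≤ 8 * m ^ 2 * ((k+7) * ((k+6) * ((k+5) * F))) := by
  subst hMμ
  have hc1 : 2 * m ^ 3 * ((k+8) * ((k+5) * F)) ≤ 2 * m ^ 2 * ((k+7) * ((k+6) * ((k+5) * F))) := by
    have h1 : m * (k+8) ≤ (k+7) * (k+6) := by nlinarith
    have h3 : 0 ≤ 2 * m^2 * ((k+5) * F) := by positivity
    have h4 := mul_le_mul_of_nonneg_left h1 h3
    linear_combination h4
  have hp : (k+8)^4 - (k+8) * ((k+7) * ((k+6) * (k+5))) ≤ 20 * ((k+7) * ((k+6) * (k+5))) := by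
    have h2 : 0 ≤ k^2 := by positivity
    have h3 : 0 ≤ k^3 := by positivity
    nlinarith
  have hr : μ ^ 2 * ((k+8)^4 - (k+8) * ((k+7) * ((k+6) * (k+5)))) ≤
      (m/2)^2 * (20 * ((k+7) * ((k+6) * (k+5)))) := by
    calc _ ≤ μ ^ 2 * (20 * ((k+7) * ((k+6) * (k+5)))) := by gcongr
      _ ≤ _ := by gcongr
  have h5 := mul_le_mul_of_nonneg_right hr hF
  linear_combination hQ + hc1 + h5

lemma bad_le {n : ℕ} (hn : 8 ≤ n) (A : Finset (Fin n)) (hA : 0 < A.card) (hA2 : 2 * A.card ≤ n) :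
    ((univ.filter (fun π : Equiv.Perm (Fin n) => 3 * A.card ≤ 4 * adjCount A π)).card : ℝ)
      ≤ 128 / n * n.factorial := by
  classical
  obtain ⟨k, rfl⟩ : ∃ k, n = k + 8 := ⟨n - 8, by omega⟩
  have h1 := adjCount_sum A
  have h2 := adjCount_sq_sum A
  have e1 : k + 8 - 1 = k + 7 := by omega
  have e3 : k + 8 - 3 = k + 5 := by omega
  have e4 : k + 8 - 4 = k + 4 := by omega
  rw [e1] at h1 h2
  rw [e3, e4] at h2
  have hod : A.offDiag.card + A.card = A.card ^ 2 := by
    rw [offDiag_card, sq]; have := Nat.le_mul_self A.card; omega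
  have f8 : (k+8).factorial = (k+8) * ((k+7) * ((k+6) * ((k+5) * (k+4).factorial))) := by
    simp [Nat.factorial_succ]
  have f7 : (k+7).factorial = ((k+7) * ((k+6) * ((k+5) * (k+4).factorial))) := by
    simp [Nat.factorial_succ]
  have f5 : (k+5).factorial = (((k+5) * (k+4).factorial)) := by
    simp [Nat.factorial_succ]
  rw [f7] at h1 h2
  rw [f5] at h2
  rw [f8]
  have hF : (0:ℝ) < ((k+4).factorial : ℝ) := by exact_mod_cast Nat.factorial_pos _
  generalize hFdef : (k+4).factorial = F at *
  generalize hm : A.card = m at *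
  generalize hM : A.offDiag.card = M at *
  have h1' : ∑ π : Equiv.Perm (Fin (k+8)), (adjCount A π : ℝ) = M * ((k+7) * ((k+6) * ((k+5) * F))) := by
    exact_mod_cast h1
  have h2' : ∑ π : Equiv.Perm (Fin (k+8)), (adjCount A π : ℝ) ^ 2 ≤
      m ^ 2 * ((k+7) * ((k+6) * ((k+5) * F))) + 2 * m ^ 3 * ((k+8) * ((k+5) * F)) + M ^ 2 * ((k+8)^2 * F) := by
    exact_mod_cast h2
  have hod' : (M : ℝ) + m = m ^ 2 := by exact_mod_cast hod
  have hm0 : (0:ℝ) < m := by exact_mod_cast hA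
  have hm2 : 2 * (m:ℝ) ≤ k + 8 := by exact_mod_cast hA2
  have hk : (0:ℝ) ≤ k := Nat.cast_nonneg k
  have hM0 : (0:ℝ) ≤ M := Nat.cast_nonneg M
  have hn0 : (0:ℝ) < (k:ℝ) + 8 := by linarith
  set μ : ℝ := M / (k + 8) with hμ
  have hμm : μ ≤ m / 2 := by
    rw [hμ, div_le_iff₀ hn0]; nlinarith
  have hcard : ∑ π : Equiv.Perm (Fin (k+8)), (1:ℝ) = (k+8) * ((k+7) * ((k+6) * ((k+5) * F))) := by
    rw [sum_const, card_univ, Fintype.card_perm, Fintype.card_fin, f8]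
    push_cast; ring
  have hvar : ∑ π : Equiv.Perm (Fin (k+8)), ((adjCount A π : ℝ) - μ) ^ 2 ≤
      8 * m ^ 2 * ((k+7) * ((k+6) * ((k+5) * F))) := by
    have hexp : ∑ π : Equiv.Perm (Fin (k+8)), ((adjCount A π : ℝ) - μ) ^ 2 =
        ∑ π : Equiv.Perm (Fin (k+8)), (adjCount A π : ℝ) ^ 2
          - 2 * μ * ∑ π : Equiv.Perm (Fin (k+8)), (adjCount A π : ℝ)
          + μ ^ 2 * ∑ π : Equiv.Perm (Fin (k+8)), (1:ℝ) := by
      rw [mul_sum, mul_sum, ← sum_sub_distrib, ← sum_add_distrib]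
      apply sum_congr rfl; intros; ring
    rw [hexp, h1', hcard]
    exact var_arith k m F M μ _ hk hm0.le hm2 hF.le (by positivity) hμm (by rw [hμ]; field_simp) h2'
  have hcheb : ((univ.filter (fun π : Equiv.Perm (Fin (k+8)) => 3 * m ≤ 4 * adjCount A π)).card : ℝ) * (m/4:ℝ)^2
      ≤ ∑ π : Equiv.Perm (Fin (k+8)), ((adjCount A π : ℝ) - μ) ^ 2 := by
    rw [← nsmul_eq_mul, ← sum_const]
    refine le_trans (sum_le_sum (g := fun π => ((adjCount A π : ℝ) - μ) ^ 2) ?_)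
      (sum_le_sum_of_subset_of_nonneg (filter_subset _ _) (fun _ _ _ => sq_nonneg _))
    intro π hπ
    have h : 3 * (m:ℝ) ≤ 4 * adjCount A π := by exact_mod_cast (mem_filter.1 hπ).2
    have : (m/4:ℝ) ≤ adjCount A π - μ := by linarith
    gcongr
  have hfin := hcheb.trans hvar
  have hm2pos : (0:ℝ) < (m/4:ℝ)^2 := by positivity
  rw [← mul_le_mul_iff_left₀ hm2pos]
  refine hfin.trans (le_of_eq ?_)
  push_cast
  field_simp
  ring

lemma main_le {n : ℕ} (hn : 8 ≤ n) (u : Fin n → ℝ) (A : Finset (Fin n)) (hA0 : 0 < A.card)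
    (hA2 : 2 * A.card ≤ n)
    (hA : ∀ a ∈ A, ∀ j, j ∉ A → u j < u a) (hA' : ∀ a ∈ A, ∀ j ∈ A, u j = u a) (x : ℝ) :
    ((univ.filter (fun π : Equiv.Perm (Fin n) => ∑ i, u i * ((π i : ℕ) + 1 : ℝ) = x)).card : ℝ)
      ≤ 132 / n * n.factorial := by
  classical
  set T := univ.filter (fun π : Equiv.Perm (Fin n) => ∑ i, u i * ((π i : ℕ) + 1 : ℝ) = x) with hT
  set bad := univ.filter (fun π : Equiv.Perm (Fin n) => 3 * A.card ≤ 4 * adjCount A π) with hbad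
  have hb := bad_le hn A hA0 hA2
  rw [← hbad] at hb
  have hgood : (T \ bad).card * A.card ≤ 4 * (A.card * (n-1).factorial) := by
    have h1 : ∀ π ∈ T \ bad, A.card ≤ 4 * (A.filter (fun a => ¬ ∃ b ∈ A, (π b : ℕ) = π a + 1)).card := by
      intro π hπ
      have h2 : 4 * adjCount A π < 3 * A.card := by
        by_contra h
        exact (mem_sdiff.1 hπ).2 (mem_filter.2 ⟨mem_univ _, not_lt.1 h⟩)
      have h3 : (A.filter (fun a => ∃ b ∈ A, (π b : ℕ) = π a + 1)).card ≤ adjCount A π := by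
        unfold adjCount
        refine le_trans (card_le_card ?_) (card_image_le (f := fun e : Fin n × Fin n => e.1))
        intro a ha
        obtain ⟨ha, b, hb, hab⟩ := mem_filter.1 ha
        refine mem_image.2 ⟨(a, b), mem_filter.2 ⟨mem_offDiag.2 ⟨ha, hb, ?_⟩, hab⟩, rfl⟩
        intro h
        simp only at h
        subst h
        omega
      have h4 := card_filter_add_card_filter_not (s := A) (fun a => ∃ b ∈ A, (π b : ℕ) = π a + 1)
      omega
    calc (T \ bad).card * A.card = ∑ π ∈ T \ bad, A.card := by rw [sum_const, smul_eq_mul]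
      _ ≤ ∑ π ∈ T \ bad, 4 * (A.filter (fun a => ¬ ∃ b ∈ A, (π b : ℕ) = π a + 1)).card := sum_le_sum h1
      _ ≤ ∑ π ∈ T, 4 * (A.filter (fun a => ¬ ∃ b ∈ A, (π b : ℕ) = π a + 1)).card :=
          sum_le_sum_of_subset sdiff_subset
      _ = 4 * ∑ a ∈ A, (T.filter (fun π => ¬ ∃ b ∈ A, (π b : ℕ) = π a + 1)).card := by
          rw [← mul_sum]
          congr 1
          simp only [card_filter]
          rw [sum_comm]
      _ ≤ 4 * ∑ a ∈ A, (n-1).factorial := by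
          gcongr with a ha
          rw [hT, filter_filter]
          exact chain_le u A hA hA' x a ha
      _ = _ := by rw [sum_const, smul_eq_mul]
  have hgood' : (T \ bad).card ≤ 4 * (n-1).factorial := by
    apply Nat.le_of_mul_le_mul_right _ hA0
    linarith
  have hcard : T.card ≤ (T \ bad).card + bad.card := by
    have := card_le_card_sdiff_add_card (s := T) (t := bad)
    omega
  have hfac : (n:ℝ) * ((n-1).factorial : ℝ) = n.factorial := by
    exact_mod_cast Nat.mul_factorial_pred (by omega)
  have hn0 : (0:ℝ) < n := by exact_mod_cast (by omega : 0 < n)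
  have h5 : (T.card : ℝ) ≤ 4 * ((n-1).factorial : ℝ) + bad.card := by
    have : T.card ≤ 4 * (n-1).factorial + bad.card := by omega
    exact_mod_cast this
  have h6 : ((n-1).factorial : ℝ) = 1 / n * n.factorial := by
    rw [← hfac]; field_simp
  calc (T.card : ℝ) ≤ 4 * (1 / n * n.factorial) + 128 / n * n.factorial := by
        rw [← h6]; linarith
    _ = _ := by ring

lemma max_set {n : ℕ} (hn : 0 < n) (u : Fin n → ℝ) : ∃ a, ∀ j, u j ≤ u a := by
  have : Nonempty (Fin n) := ⟨⟨0, hn⟩⟩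
  exact Finite.exists_max u

theorem stmt_7 :
    ∃ C > (0:ℝ), ∀ (n : ℕ), 2 ≤ n → ∀ u : Fin n → ℝ,
      (∃ i j, u i ≠ u j) → ∀ x : ℝ,
      ((Finset.univ.filter (fun π : Equiv.Perm (Fin n) =>
          ∑ i, u i * ((π i : ℕ) + 1 : ℝ) = x)).card : ℝ) / (n.factorial : ℝ)
        ≤ C / n := by
  classical
  refine ⟨132, by norm_num, ?_⟩
  intro n hn2 u hu x
  have hF : (0:ℝ) < (n.factorial : ℝ) := by exact_mod_cast Nat.factorial_pos _
  have hn0 : (0:ℝ) < n := by exact_mod_cast (by omega : 0 < n)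
  rw [div_le_iff₀ hF]
  by_cases hn : 8 ≤ n
  swap
  · have h1 : ((Finset.univ.filter (fun π : Equiv.Perm (Fin n) =>
          ∑ i, u i * ((π i : ℕ) + 1 : ℝ) = x)).card : ℝ) ≤ n.factorial := by
      have := card_filter_le (univ : Finset (Equiv.Perm (Fin n))) (fun π => ∑ i, u i * ((π i : ℕ) + 1 : ℝ) = x)
      rw [card_univ, Fintype.card_perm, Fintype.card_fin] at this
      exact_mod_cast this
    have h2 : (1:ℝ) ≤ 132 / n := by
      rw [le_div_iff₀ hn0]
      have : (n:ℝ) ≤ 8 := by exact_mod_cast (by omega : n ≤ 8)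
      linarith
    nlinarith
  obtain ⟨a, ha⟩ := max_set (by omega) u
  obtain ⟨b, hb⟩ := max_set (by omega) (fun i => - u i)
  have hab : u b < u a := by
    obtain ⟨i, j, hij⟩ := hu
    by_contra h
    apply hij
    have := ha i; have := ha j; have := hb i; have := hb j
    linarith
  by_cases hc : 2 * (univ.filter (fun i => u i = u a)).card ≤ n
  · apply main_le hn u (univ.filter (fun i => u i = u a)) (card_pos.2 ⟨a, by simp⟩) hc
    · intro c hc j hj
      simp only [mem_filter, mem_univ, true_and] at hc hj
      rw [hc]
      exact lt_of_le_of_ne (ha j) hj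
    · intro c hc j hj
      simp only [mem_filter, mem_univ, true_and] at hc hj
      rw [hc, hj]
  · have hd : Disjoint (univ.filter (fun i => u i = u a)) (univ.filter (fun i => u i = u b)) := by
      rw [disjoint_left]
      intro i h1 h2
      simp only [mem_filter, mem_univ, true_and] at h1 h2
      linarith
    have hcard := card_le_univ ((univ.filter (fun i => u i = u a)) ∪ (univ.filter (fun i => u i = u b)))
    rw [card_union_of_disjoint hd, Fintype.card_fin] at hcard
    have := main_le hn (fun i => - u i) (univ.filter (fun i => u i = u b)) (card_pos.2 ⟨b, by simp⟩) (by omega)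
      (by
        intro c hc j hj
        simp only [mem_filter, mem_univ, true_and] at hc hj
        rw [hc]
        exact lt_of_le_of_ne (hb j) (fun h => hj (neg_injective h)))
      (by
        intro c hc j hj
        simp only [mem_filter, mem_univ, true_and] at hc hj
        rw [hc, hj]) (-x)
    simpa only [neg_mul, sum_neg_distrib, neg_inj] using this
end

section
/- Let $n\ge 2$ and let $u_1,\ldots,u_n$ be real numbers, not all zero. Let $\pi$ be a uniform random permutation of $\{1,\ldots,n\}$. Then $\mathbb{P}\{|\sum_{i=1}^n u_i\pi(i)| \le |\sum_{i=1}^n u_i|\} \le C/n$ for an absolute constant $C$. -/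
open Finset

noncomputable section



namespace S8

open Classical in
def ind (p : Prop) : ℝ := if p then 1 else 0

lemma ind_nonneg (p : Prop) : 0 ≤ ind p := by unfold ind; split_ifs <;> norm_num
lemma ind_le_one (p : Prop) : ind p ≤ 1 := by unfold ind; split_ifs <;> norm_num
lemma ind_true {p : Prop} (h : p) : ind p = 1 := by simp [ind, h]
lemma ind_false {p : Prop} (h : ¬ p) : ind p = 0 := by simp [ind, h]

def Ex {n : ℕ} (f : Equiv.Perm (Fin n) → ℝ) : ℝ := (∑ π, f π) / (n.factorial : ℝ)

lemma fact_pos (n : ℕ) : (0:ℝ) < (n.factorial : ℝ) := by exact_mod_cast Nat.factorial_pos n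

lemma Ex_add {n : ℕ} (f g : Equiv.Perm (Fin n) → ℝ) :
    Ex (fun π => f π + g π) = Ex f + Ex g := by
  simp [Ex, sum_add_distrib, add_div]

lemma Ex_sub {n : ℕ} (f g : Equiv.Perm (Fin n) → ℝ) :
    Ex (fun π => f π - g π) = Ex f - Ex g := by
  simp [Ex, sum_sub_distrib, sub_div]

lemma Ex_mul {n : ℕ} (c : ℝ) (f : Equiv.Perm (Fin n) → ℝ) :
    Ex (fun π => c * f π) = c * Ex f := by
  simp [Ex, ← mul_sum, mul_div_assoc]

lemma Ex_const {n : ℕ} (c : ℝ) : Ex (fun _ : Equiv.Perm (Fin n) => c) = c := by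
  have := fact_pos n
  simp [Ex, Fintype.card_perm]
  field_simp

lemma Ex_mono {n : ℕ} {f g : Equiv.Perm (Fin n) → ℝ} (h : ∀ π, f π ≤ g π) : Ex f ≤ Ex g := by
  unfold Ex
  gcongr
  exact h _

lemma Ex_nonneg {n : ℕ} {f : Equiv.Perm (Fin n) → ℝ} (h : ∀ π, 0 ≤ f π) : 0 ≤ Ex f := by
  unfold Ex
  exact div_nonneg (sum_nonneg fun i _ => h i) (fact_pos n).le

lemma Ex_sum {n : ℕ} {ι : Type*} (s : Finset ι) (f : ι → Equiv.Perm (Fin n) → ℝ) :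
    Ex (fun π => ∑ i ∈ s, f i π) = ∑ i ∈ s, Ex (f i) := by
  unfold Ex
  rw [sum_comm, sum_div]

lemma Ex_comp {n : ℕ} (σ : Equiv.Perm (Fin n)) (f : Equiv.Perm (Fin n) → ℝ) :
    Ex (fun π => f (π * σ)) = Ex f := by
  unfold Ex
  congr 1
  exact Equiv.sum_comp (Equiv.mulRight σ) f

/-- Jensen. -/
lemma Ex_sq_le {n : ℕ} (f : Equiv.Perm (Fin n) → ℝ) : (Ex f) ^ 2 ≤ Ex (fun π => f π ^ 2) := by
  have h : 0 ≤ Ex (fun π => (f π - Ex f) ^ 2) := Ex_nonneg fun π => sq_nonneg _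
  have : Ex (fun π => (f π - Ex f) ^ 2) = Ex (fun π => f π ^ 2) - (Ex f) ^ 2 := by
    have e : (fun π => (f π - Ex f) ^ 2)
        = fun π => (f π ^ 2 - (2 * Ex f) * f π) + (Ex f) ^ 2 := by
      funext π; ring
    rw [e, Ex_add, Ex_sub, Ex_mul, Ex_const]; ring
  linarith

def Xs {n : ℕ} (u : Fin n → ℝ) (π : Equiv.Perm (Fin n)) : ℝ := ∑ k : Fin n, ((k : ℕ) : ℝ) * u (π k)
def av {n : ℕ} (u : Fin n → ℝ) : ℝ := (∑ i, u i) / n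
def Va {n : ℕ} (u : Fin n → ℝ) : ℝ := ∑ i, (u i - av u) ^ 2
def mu {n : ℕ} (u : Fin n → ℝ) : ℝ := (∑ i, u i) * ((n : ℝ) - 1) / 2

lemma Va_nonneg {n : ℕ} (u : Fin n → ℝ) : 0 ≤ Va u := sum_nonneg fun _ _ => sq_nonneg _

lemma sum_sub_av {n : ℕ} (u : Fin n → ℝ) : ∑ i, (u i - av u) = 0 := by
  rcases Nat.eq_zero_or_pos n with h | h
  · subst h; simp
  · have : (n : ℝ) ≠ 0 := by positivity
    simp [av]; field_simp; ring

lemma Va_shift {n : ℕ} (u : Fin n → ℝ) (c : ℝ) :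
    ∑ i, (u i - c) ^ 2 = Va u + n * (av u - c) ^ 2 := by
  have h : ∀ i, (u i - c) ^ 2 = (u i - av u) ^ 2 + 2 * (av u - c) * (u i - av u) + (av u - c) ^ 2 :=
    fun i => by ring
  simp_rw [h, sum_add_distrib, ← mul_sum, sum_sub_av]
  simp [Va]

lemma Va_pair {n : ℕ} (u : Fin n → ℝ) : ∑ i, ∑ j, (u i - u j) ^ 2 = 2 * n * Va u := by
  have h : ∀ i, ∑ j, (u i - u j) ^ 2 = Va u + n * (u i - av u) ^ 2 := fun i => by
    rw [show (u i - av u) ^ 2 = (av u - u i) ^ 2 by ring, ← Va_shift]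
    exact sum_congr rfl fun j _ => by ring
  simp_rw [h, sum_add_distrib, ← mul_sum]
  simp [Va]; ring

lemma Va_comp {n : ℕ} (u : Fin n → ℝ) (π : Equiv.Perm (Fin n)) : Va (fun i => u (π i)) = Va u := by
  have h : av (fun i => u (π i)) = av u := by
    unfold av; rw [Equiv.sum_comp π u]
  unfold Va; rw [h]
  exact Equiv.sum_comp π (fun i => (u i - av u) ^ 2)

lemma Va_neg {n : ℕ} (u : Fin n → ℝ) : Va (fun i => - u i) = Va u := by
  have h : av (fun i => - u i) = - av u := by unfold av; rw [sum_neg_distrib]; ring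
  unfold Va; rw [h]; exact sum_congr rfl fun i _ => by ring

lemma mu_neg {n : ℕ} (u : Fin n → ℝ) : mu (fun i => - u i) = - mu u := by
  unfold mu; rw [sum_neg_distrib]; ring

lemma Xs_neg {n : ℕ} (u : Fin n → ℝ) (π) : Xs (fun i => - u i) π = - Xs u π := by
  unfold Xs; rw [← sum_neg_distrib]; exact sum_congr rfl fun i _ => by ring

lemma Xs_swap {n : ℕ} (u : Fin n → ℝ) (π : Equiv.Perm (Fin n)) (i j : Fin n) :
    Xs u (π * Equiv.swap i j) = Xs u π + (((j : ℕ) : ℝ) - ((i : ℕ) : ℝ)) * (u (π i) - u (π j)) := by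
  have h1 : Xs u (π * Equiv.swap i j) = ∑ k, ((Equiv.swap i j k : ℕ) : ℝ) * u (π k) := by
    unfold Xs
    rw [← Equiv.sum_comp (Equiv.swap i j)]
    exact sum_congr rfl fun k _ => by simp
  rcases eq_or_ne i j with rfl | hij
  · simp [Xs]
  have h2 : Xs u (π * Equiv.swap i j) - Xs u π
      = ∑ k, (((Equiv.swap i j k : ℕ) : ℝ) - ((k : ℕ) : ℝ)) * u (π k) := by
    rw [h1]; unfold Xs; rw [← sum_sub_distrib]; exact sum_congr rfl fun k _ => by ring
  have h3 : ∑ k, (((Equiv.swap i j k : ℕ) : ℝ) - ((k : ℕ) : ℝ)) * u (π k)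
      = ∑ k ∈ {i, j}, (((Equiv.swap i j k : ℕ) : ℝ) - ((k : ℕ) : ℝ)) * u (π k) := by
    symm
    apply sum_subset (subset_univ _)
    intro k _ hk
    simp only [mem_insert, mem_singleton, not_or] at hk
    rw [Equiv.swap_apply_of_ne_of_ne hk.1 hk.2]; simp
  rw [h3, sum_pair hij] at h2
  simp only [Equiv.swap_apply_left, Equiv.swap_apply_right] at h2
  linarith

/-- difference of consecutive entries -/
def df {m : ℕ} (u : Fin (m+1) → ℝ) (π : Equiv.Perm (Fin (m+1))) (k : Fin m) : ℝ :=
  u (π k.castSucc) - u (π k.succ)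

lemma Xs_adj {m : ℕ} (u : Fin (m+1) → ℝ) (π : Equiv.Perm (Fin (m+1))) (k : Fin m) :
    Xs u (π * Equiv.swap k.castSucc k.succ) = Xs u π + df u π k := by
  rw [Xs_swap]; simp [df]

lemma df_adj {m : ℕ} (u : Fin (m+1) → ℝ) (π : Equiv.Perm (Fin (m+1))) (k : Fin m) :
    df u (π * Equiv.swap k.castSucc k.succ) k = - df u π k := by
  simp [df]

lemma regr {m : ℕ} (u : Fin (m+1) → ℝ) (π : Equiv.Perm (Fin (m+1))) :
    ∑ k : Fin m, (((k:ℕ):ℝ) + 1) * ((m:ℝ) - ((k:ℕ):ℝ)) * df u π k = 2 * (mu u - Xs u π) := by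
  have h1 : ∑ k : Fin (m+1), (((k:ℕ):ℝ) + 1) * ((m:ℝ) - ((k:ℕ):ℝ)) * u (π k)
     = ∑ k : Fin m, (((k:ℕ):ℝ) + 1) * ((m:ℝ) - ((k:ℕ):ℝ)) * u (π k.castSucc) := by
    rw [Fin.sum_univ_castSucc]; simp
  have h2 : ∑ k : Fin (m+1), (((k:ℕ):ℝ)) * ((m:ℝ) + 1 - ((k:ℕ):ℝ)) * u (π k)
     = ∑ k : Fin m, (((k:ℕ):ℝ) + 1) * ((m:ℝ) - ((k:ℕ):ℝ)) * u (π k.succ) := by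
    rw [Fin.sum_univ_succ]; simp
  unfold df
  simp_rw [mul_sub ((((_:ℕ):ℝ) + 1) * ((m:ℝ) - ((_:ℕ):ℝ)))]
  rw [sum_sub_distrib, ← h1, ← h2, ← sum_sub_distrib]
  unfold mu Xs
  rw [← Equiv.sum_comp π u, mul_sub, mul_sum]
  have : 2 * ((∑ i, u (π i)) * (((m+1:ℕ):ℝ) - 1) / 2) = ∑ i, (m:ℝ) * u (π i) := by
    rw [← mul_sum]; push_cast; ring
  rw [this, ← sum_sub_distrib]
  exact sum_congr rfl fun k _ => by ring

lemma stein {m : ℕ} (u : Fin (m+1) → ℝ) (f : ℝ → ℝ) :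
    Ex (fun π => (mu u - Xs u π) * f (Xs u π)) =
      ∑ k : Fin m, (((k:ℕ):ℝ) + 1) * ((m:ℝ) - ((k:ℕ):ℝ)) / 4 *
        Ex (fun π => df u π k * (f (Xs u π) - f (Xs u π + df u π k))) := by
  have h : ∀ k : Fin m, Ex (fun π => df u π k * f (Xs u π))
      = - Ex (fun π => df u π k * f (Xs u π + df u π k)) := fun k => by
    rw [← Ex_comp (Equiv.swap k.castSucc k.succ)]
    simp_rw [df_adj, Xs_adj]
    rw [show (-Ex fun π => df u π k * f (Xs u π + df u π k))
      = (-1) * Ex fun π => df u π k * f (Xs u π + df u π k) by ring, ← Ex_mul]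
    congr 1; funext π; ring
  have h' : ∀ k : Fin m, Ex (fun π => df u π k * (f (Xs u π) - f (Xs u π + df u π k)))
      = 2 * Ex (fun π => df u π k * f (Xs u π)) := fun k => by
    simp_rw [mul_sub]; rw [Ex_sub]; linarith [h k]
  simp_rw [h', ← Ex_mul]
  rw [← Ex_sum]
  congr 1; funext π
  have := regr u π
  calc _ = (2 * (mu u - Xs u π)) / 2 * f (Xs u π) := by ring
    _ = _ := by
      rw [← this, sum_div, sum_mul]
      exact sum_congr rfl fun k _ => by ring

lemma Ex_Xs {m : ℕ} (u : Fin (m+1) → ℝ) : Ex (Xs u) = mu u := by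
  have := stein u (fun _ => 1)
  simp only [sub_self, mul_zero, mul_one, Ex_const, sum_const_zero, Ex_sub] at this
  linarith

/-- averages over embeddings -/
lemma Ex_emb {n t : ℕ} (F : (Fin t → Fin n) → ℝ) (x : Fin t ↪ Fin n) :
    (n.descFactorial t : ℝ) * Ex (fun π => F (fun i => π (x i))) = ∑ y : Fin t ↪ Fin n, F y := by
  have h1 : ∀ y : Fin t ↪ Fin n, Ex (fun π => F (fun i => π (y i)))
      = Ex (fun π => F (fun i => π (x i))) := fun y => by
    have := Equiv.Perm.isMultiplyPretransitive (Fin n) t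
    obtain ⟨g, hg⟩ := this.exists_smul_eq x y
    rw [← Ex_comp g (fun π => F (fun i => π (x i)))]
    congr 1; funext π; congr 1; funext i
    rw [← hg]; simp
  have h2 : ∑ y : Fin t ↪ Fin n, Ex (fun π => F (fun i => π (y i)))
      = ∑ y : Fin t ↪ Fin n, F y := by
    rw [← Ex_sum]
    have : (fun π : Equiv.Perm (Fin n) => ∑ y : Fin t ↪ Fin n, F (fun i => π (y i)))
      = fun π => ∑ y : Fin t ↪ Fin n, F y := by
      funext π
      exact Equiv.sum_comp (Equiv.embeddingCongr (Equiv.refl (Fin t)) π) (fun y : Fin t ↪ Fin n => F y)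
    rw [this, Ex_const]
  rw [← h2]; simp_rw [h1]
  simp [Fintype.card_embedding_eq]

lemma Ex_emb_le {n t : ℕ} (F : (Fin t → Fin n) → ℝ) (hF : ∀ y, 0 ≤ F y) (x : Fin t ↪ Fin n) :
    (n.descFactorial t : ℝ) * Ex (fun π => F (fun i => π (x i))) ≤ ∑ y : Fin t → Fin n, F y := by
  rw [Ex_emb]
  have : ∑ y : Fin t ↪ Fin n, F y = ∑ y ∈ univ.map ⟨fun y : Fin t ↪ Fin n => (y : Fin t → Fin n),
      DFunLike.coe_injective⟩, F y := by rw [sum_map]; rfl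
  rw [this]
  exact sum_le_sum_of_subset_of_nonneg (subset_univ _) fun y _ _ => hF y

lemma Ex_pair {n : ℕ} (G : Fin n → Fin n → ℝ) (hG : ∀ i, G i i = 0) {a b : Fin n} (hab : a ≠ b) :
    (n : ℝ) * ((n : ℝ) - 1) * Ex (fun π => G (π a) (π b)) = ∑ i, ∑ j, G i j := by
  have hn : 1 ≤ n := by have := a.2; omega
  have h := Ex_emb (fun y : Fin 2 → Fin n => G (y 0) (y 1))
    ⟨![a, b], by
      intro i j; fin_cases i <;> fin_cases j <;> simp [hab, hab.symm]⟩
  have e : (n.descFactorial 2 : ℝ) = (n : ℝ) * ((n : ℝ) - 1) := by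
    simp [Nat.descFactorial_succ, Nat.cast_sub hn]; ring
  rw [e] at h
  change _ * Ex (fun π => G (π a) (π b)) = _ at h
  rw [h]
  have : ∑ y : Fin 2 ↪ Fin n, G (y 0) (y 1) = ∑ y ∈ univ.map ⟨fun y : Fin 2 ↪ Fin n => (y : Fin 2 → Fin n),
      DFunLike.coe_injective⟩, G (y 0) (y 1) := by rw [sum_map]; rfl
  rw [this, sum_subset (subset_univ _)]
  · rw [← Equiv.sum_comp (finTwoArrowEquiv (Fin n)).symm, Fintype.sum_prod_type]
    simp
  · intro y _ hy
    have : y 0 = y 1 := by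
      by_contra hne
      apply hy
      simp only [mem_map, mem_univ, true_and, Function.Embedding.coeFn_mk]
      refine ⟨⟨y, ?_⟩, rfl⟩
      intro i j; fin_cases i <;> fin_cases j <;> simp [hne, Ne.symm hne]
    rw [this, hG]

end S8

namespace S8

lemma Ex_df_sq {m : ℕ} (u : Fin (m+1) → ℝ) (k : Fin m) :
    (m : ℝ) * Ex (fun π => df u π k ^ 2) = 2 * Va u := by
  have h := Ex_pair (fun i j => (u i - u j) ^ 2) (fun i => by simp)
    (a := k.castSucc) (b := k.succ) (by simp [Fin.ext_iff])
  rw [Va_pair] at h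
  push_cast at h
  have h0 : (0:ℝ) < (m:ℝ) + 1 := by positivity
  have : ((m:ℝ) + 1) * ((m : ℝ) * Ex (fun π => df u π k ^ 2)) = ((m:ℝ)+1) * (2 * Va u) := by
    unfold df
    linear_combination h
  exact mul_left_cancel₀ h0.ne' this

lemma var_le {n : ℕ} (u : Fin n → ℝ) :
    Ex (fun π => (Xs u π - mu u) ^ 2) ≤ (n:ℝ) ^ 2 * Va u := by
  rcases n with _ | m
  · simp [Ex, Xs, mu, Va]
  have h := stein u (fun y => - y)
  have e : Ex (fun π => (Xs u π - mu u) ^ 2) = Ex (fun π => (mu u - Xs u π) * (- Xs u π)) := by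
    have e1 : (fun π => (Xs u π - mu u) ^ 2)
      = fun π => (mu u - Xs u π) * (- Xs u π) + (mu u * mu u - mu u * Xs u π) := by
      funext π; ring
    rw [e1, Ex_add, Ex_sub, Ex_mul (mu u) (Xs u), Ex_const, Ex_Xs]; ring
  rw [e, h]
  have hV := Va_nonneg u
  have hk : ∀ k : Fin m, (((k:ℕ):ℝ) + 1) * ((m:ℝ) - ((k:ℕ):ℝ)) / 4 *
        Ex (fun π => df u π k * (- (Xs u π) - - (Xs u π + df u π k)))
        ≤ ((m:ℝ)+1)^2 / 16 * (2 * Va u / m) := fun k => by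
    have hm : (0:ℝ) < m := by exact_mod_cast (by have := k.2; omega : 0 < m)
    have e2 : Ex (fun π => df u π k * (- (Xs u π) - - (Xs u π + df u π k))) = 2 * Va u / m := by
      rw [eq_div_iff hm.ne', ← Ex_df_sq u k, mul_comm]
      congr 2; funext π; ring
    rw [e2]
    apply mul_le_mul_of_nonneg_right _ (by positivity)
    nlinarith [sq_nonneg ((((k:ℕ):ℝ) + 1) - ((m:ℝ) - ((k:ℕ):ℝ)))]
  refine (sum_le_sum fun k _ => hk k).trans ?_
  rw [sum_const, card_univ, Fintype.card_fin, nsmul_eq_mul]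
  rcases Nat.eq_zero_or_pos m with h0 | h0
  · subst h0; simp; exact hV
  · have hm : (m:ℝ) ≠ 0 := by positivity
    have : (m:ℝ) * (((m:ℝ)+1)^2 / 16 * (2 * Va u / m)) = ((m:ℝ)+1)^2 * Va u / 8 := by
      field_simp; ring
    rw [this]; push_cast
    have : 0 ≤ ((m:ℝ)+1)^2 * Va u := by positivity
    linarith

lemma abs_le {n : ℕ} (u : Fin n → ℝ) :
    Ex (fun π => |Xs u π - mu u|) ≤ (n:ℝ) * √(Va u) := by
  apply abs_le_of_sq_le_sq' _ (by positivity) |>.2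
  refine (Ex_sq_le _).trans ?_
  simp_rw [sq_abs]
  rw [mul_pow, Real.sq_sqrt (Va_nonneg u)]
  exact var_le u

def ramp (x s y : ℝ) : ℝ := max 0 (min (4*s) (x + 2*s - y))

lemma ramp_anti (x s : ℝ) {y z : ℝ} (h : y ≤ z) : ramp x s z ≤ ramp x s y := by
  unfold ramp; gcongr

lemma ramp_nonneg (x s y : ℝ) : 0 ≤ ramp x s y := le_max_left _ _
lemma ramp_le (x s y : ℝ) (hs : 0 ≤ s) : ramp x s y ≤ 4 * s := by
  unfold ramp; exact max_le (by linarith) (min_le_left _ _)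

lemma ramp_mul_nonneg (x s y a : ℝ) : 0 ≤ a * (ramp x s y - ramp x s (y + a)) := by
  rcases le_total 0 a with h | h
  · exact mul_nonneg h (sub_nonneg.2 (ramp_anti x s (by linarith)))
  · exact mul_nonneg_of_nonpos_of_nonpos h (sub_nonpos.2 (ramp_anti x s (by linarith)))

lemma ramp_mul_ge (x s y a : ℝ) (hs : 0 < s) (hy : |y - x| ≤ s) :
    |a| * min |a| s ≤ a * (ramp x s y - ramp x s (y + a)) := by
  rw [_root_.abs_le] at hy
  have e : ramp x s y = x + 2*s - y := by
    unfold ramp; rw [min_eq_right (by linarith), max_eq_right (by linarith)]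
  rcases le_total 0 a with h | h
  · rw [abs_of_nonneg h]
    apply mul_le_mul_of_nonneg_left _ h
    rw [e]
    have : ramp x s (y + a) ≤ max 0 (x + 2*s - (y+a)) := by
      unfold ramp; exact max_le_max le_rfl (min_le_right _ _)
    rcases le_total 0 (x + 2*s - (y+a)) with h1 | h1
    · rw [max_eq_right h1] at this; linarith [min_le_left a s]
    · rw [max_eq_left h1] at this; linarith [min_le_right a s]
  · rw [abs_of_nonpos h]
    rw [show a * (ramp x s y - ramp x s (y + a)) = (-a) * (ramp x s (y + a) - ramp x s y) by ring]
    apply mul_le_mul_of_nonneg_left _ (by linarith)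
    rw [e]
    have : min (4*s) (x + 2*s - (y+a)) ≤ ramp x s (y + a) := le_max_right _ _
    rcases le_total (4*s) (x + 2*s - (y+a)) with h1 | h1
    · rw [min_eq_left h1] at this; linarith [min_le_right (-a) s]
    · rw [min_eq_right h1] at this; linarith [min_le_left (-a) s]

lemma energy {ι : Type*} (K : Finset ι) (a : ι → ℝ) (s V : ℝ) (hs : 0 < s) (hV : 0 < V)
    (h : V / 32 ≤ ∑ k ∈ K, a k ^ 2) :
    min (V / 64) (s * √V / 8) ≤ ∑ k ∈ K, |a k| * min |a k| s := by
  set Φ := ∑ k ∈ K, |a k| * min |a k| s with hΦ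
  have hn : ∀ k ∈ K, 0 ≤ |a k| * min |a k| s := fun k _ => by positivity
  have hΦ0 : 0 ≤ Φ := sum_nonneg hn
  have h1 : ∀ k ∈ K, a k ^ 2 ≤ |a k| * min |a k| s + (Φ / s^2) * (|a k| * min |a k| s) := by
    intro k hk
    have h2 := single_le_sum hn hk
    have h3 := hn k hk
    rcases le_total |a k| s with h4 | h4
    · rw [min_eq_left h4] at *
      have : 0 ≤ (Φ / s^2) * (|a k| * |a k|) := by positivity
      nlinarith [sq_abs (a k)]
    · rw [min_eq_right h4] at *
      have : (|a k| * s) / s^2 * (|a k| * s) ≤ Φ / s^2 * (|a k| * s) := by gcongr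
      have e : (|a k| * s) / s^2 * (|a k| * s) = a k ^ 2 := by
        rw [← sq_abs (a k)]; field_simp
      linarith
  have h2 := sum_le_sum h1
  rw [sum_add_distrib, ← mul_sum, ← hΦ] at h2
  by_contra hc
  rw [not_le, lt_min_iff] at hc
  have h3 : Φ / s^2 * Φ < V / 64 := by
    have : Φ * Φ < (s * √V / 8) * (s * √V / 8) := mul_self_lt_mul_self hΦ0 hc.2
    rw [div_mul_eq_mul_div, div_lt_iff₀ (by positivity)]
    nlinarith [Real.mul_self_sqrt hV.le]
  linarith

lemma stein_bound_aux {m : ℕ} (u : Fin (m+1) → ℝ) (hV : 0 < Va u) (K : Finset (Fin m))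
    (hK : ∀ k ∈ K, ((m:ℝ)+1)^2 / 16 ≤ (((k:ℕ):ℝ) + 1) * ((m:ℝ) - ((k:ℕ):ℝ)))
    (x s : ℝ) (hs : 0 < s) (hx : x ≤ mu u) :
    Ex (fun π => ind (|Xs u π - x| ≤ s) * ind (Va u / 32 ≤ ∑ k ∈ K, df u π k ^ 2))
      ≤ 65536 * (1 / ((m:ℝ)+1) + s / (((m:ℝ)+1) * √(Va u) + |x - mu u|)) := by
  set n : ℝ := (m:ℝ)+1 with hn
  have hn0 : 0 < n := by positivity
  have hR : 0 < √(Va u) := Real.sqrt_pos.2 hV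
  set R := √(Va u) with hRd
  have hRR : R * R = Va u := Real.mul_self_sqrt hV.le
  have hd : |x - mu u| = mu u - x := by rw [abs_of_nonpos (by linarith)]; ring
  rw [hd]
  set d := mu u - x with hdd
  have hd0 : 0 ≤ d := by linarith
  set A := n * R with hA
  have hA0 : 0 < A := by positivity
  set P := Ex (fun π => ind (|Xs u π - x| ≤ s) * ind (Va u / 32 ≤ ∑ k ∈ K, df u π k ^ 2)) with hP
  have hP0 : 0 ≤ P := Ex_nonneg fun π => mul_nonneg (ind_nonneg _) (ind_nonneg _)
  have hP1 : P ≤ 1 := by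
    rw [← Ex_const (n := m+1) 1]
    exact Ex_mono fun π => mul_le_one₀ (ind_le_one _) (ind_nonneg _) (ind_le_one _)
  rcases le_or_gt (A + d) (8 * s) with ht | ht
  · have : 1 ≤ 8 * (s / (A + d)) := by
      rw [← mul_div_assoc, le_div_iff₀ (by positivity)]; linarith
    have : 0 ≤ 1 / n := by positivity
    have : 0 ≤ s / (A+d) := by positivity
    linarith
  set f := ramp x s with hf
  -- upper bound
  have up1 : Ex (fun π => (mu u - Xs u π) * f (Xs u π)) ≤ 4 * s * A := by
    calc _ ≤ Ex (fun π => 4 * s * |Xs u π - mu u|) := Ex_mono fun π => by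
          have h1 := ramp_nonneg x s (Xs u π)
          have h2 := ramp_le x s (Xs u π) hs.le
          have h3 : mu u - Xs u π ≤ |Xs u π - mu u| := by rw [abs_sub_comm]; exact le_abs_self _
          calc _ ≤ |Xs u π - mu u| * f (Xs u π) := mul_le_mul_of_nonneg_right h3 h1
            _ ≤ |Xs u π - mu u| * (4 * s) := mul_le_mul_of_nonneg_left h2 (abs_nonneg _)
            _ = _ := by ring
      _ ≤ _ := by
        rw [Ex_mul]
        have := abs_le u
        push_cast at this
        gcongr
  have up2 : 4 * s ≤ d → Ex (fun π => (mu u - Xs u π) * f (Xs u π)) ≤ 8 * s / d * A^2 := by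
    intro h4
    have hdp : 0 < d := by linarith
    calc _ ≤ Ex (fun π => 8 * s / d * (Xs u π - mu u)^2) := Ex_mono fun π => by
          have h1 := ramp_nonneg x s (Xs u π)
          have h2 := ramp_le x s (Xs u π) hs.le
          rcases le_or_gt (x + 2 * s) (Xs u π) with h5 | h5
          · have : f (Xs u π) = 0 := by
              rw [hf]; unfold ramp; rw [max_eq_left]; exact (min_le_right _ _).trans (by linarith)
            rw [this, mul_zero]; positivity
          · have h6 : d / 2 ≤ mu u - Xs u π := by linarith
            calc _ ≤ (mu u - Xs u π) * (4 * s) := mul_le_mul_of_nonneg_left h2 (by linarith)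
              _ ≤ _ := by
                rw [div_mul_eq_mul_div, le_div_iff₀ hdp]
                nlinarith [mul_nonneg (mul_nonneg hs.le (by linarith : 0 ≤ mu u - Xs u π)) (by linarith : 0 ≤ mu u - Xs u π - d/2)]
      _ ≤ _ := by
        rw [Ex_mul]
        have := var_le u
        push_cast at this
        rw [hA, mul_pow, pow_two R, hRR]
        gcongr
  have up : Ex (fun π => (mu u - Xs u π) * f (Xs u π)) ≤ 16 * s * A^2 / (A + d) := by
    rw [le_div_iff₀ (by positivity)]
    rcases le_or_gt (4 * s) d with h4 | h4
    · have hdp : 0 < d := by linarith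
      rcases le_total A d with h5 | h5
      · have := up2 h4
        calc _ ≤ (8 * s / d * A^2) * (A + d) := by gcongr
          _ ≤ (8 * s / d * A^2) * (2 * d) := by gcongr; linarith
          _ = _ := by field_simp; norm_num
      · calc _ ≤ (4 * s * A) * (A + d) := by gcongr
          _ ≤ (4 * s * A) * (2 * A) := by gcongr; linarith
          _ ≤ _ := by nlinarith [mul_pos hs (mul_pos hA0 hA0)]
    · calc _ ≤ (4 * s * A) * (A + d) := by gcongr
          _ ≤ (4 * s * A) * (2 * A) := by gcongr; linarith
          _ ≤ _ := by nlinarith [mul_pos hs (mul_pos hA0 hA0)]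
  -- lower bound
  set c := min (Va u / 64) (s * R / 8) with hc
  have hc0 : 0 < c := lt_min (by positivity) (by positivity)
  have low : n^2 / 64 * (c * P) ≤ Ex (fun π => (mu u - Xs u π) * f (Xs u π)) := by
    rw [stein u f]
    have hpos : ∀ k, 0 ≤ Ex (fun π => df u π k * (f (Xs u π) - f (Xs u π + df u π k))) :=
      fun k => Ex_nonneg fun π => ramp_mul_nonneg _ _ _ _
    have hw : ∀ k : Fin m, 0 ≤ (((k:ℕ):ℝ) + 1) * ((m:ℝ) - ((k:ℕ):ℝ)) / 4 := fun k => by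
      have : ((k:ℕ):ℝ) ≤ m := by exact_mod_cast k.2.le
      have : 0 ≤ (m:ℝ) - ((k:ℕ):ℝ) := by linarith
      positivity
    calc _ ≤ ∑ k ∈ K, n^2 / 64 * Ex (fun π => df u π k * (f (Xs u π) - f (Xs u π + df u π k))) := by
          rw [← mul_sum, ← Ex_sum, hP, ← Ex_mul]
          apply mul_le_mul_of_nonneg_left _ (by positivity)
          refine Ex_mono fun π => ?_
          have h0 : 0 ≤ ∑ k ∈ K, df u π k * (f (Xs u π) - f (Xs u π + df u π k)) :=
            sum_nonneg fun k _ => ramp_mul_nonneg _ _ _ _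
          by_cases h1 : |Xs u π - x| ≤ s
          · by_cases h2 : Va u / 32 ≤ ∑ k ∈ K, df u π k ^ 2
            · rw [ind_true h1, ind_true h2, mul_one, mul_one]
              refine (energy K (df u π) s (Va u) hs hV h2).trans ?_
              exact sum_le_sum fun k _ => ramp_mul_ge x s _ _ hs h1
            · rw [ind_false h2]; simpa using h0
          · rw [ind_false h1]; simpa using h0
      _ ≤ ∑ k ∈ K, (((k:ℕ):ℝ) + 1) * ((m:ℝ) - ((k:ℕ):ℝ)) / 4 *
           Ex (fun π => df u π k * (f (Xs u π) - f (Xs u π + df u π k))) := by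
          refine sum_le_sum fun k hk => mul_le_mul_of_nonneg_right ?_ (hpos k)
          have := hK k hk
          linarith
      _ ≤ _ := sum_le_sum_of_subset_of_nonneg (subset_univ _)
          fun k _ _ => mul_nonneg (hw k) (hpos k)
  have key := low.trans up
  have h1 : c * P ≤ 1024 * s * Va u / (A + d) := by
    have e : 16 * s * A^2 / (A + d) = n^2/64 * (1024 * s * Va u / (A + d)) := by
      rw [hA, mul_pow, pow_two R, hRR]; ring
    rw [e] at key
    exact le_of_mul_le_mul_left key (by positivity)
  rw [le_div_iff₀ (by positivity)] at h1
  have h2 : P * (A + d) ≤ 65536 * s + 8192 * R := by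
    rcases min_choice (Va u / 64) (s * R / 8) with h | h
    · rw [hc, h] at h1
      have : Va u * (P * (A + d)) ≤ Va u * (65536 * s) := by linarith
      have := le_of_mul_le_mul_left this hV
      linarith
    · rw [hc, h] at h1
      have : (s * R) * (P * (A + d)) ≤ (s * R) * (8192 * R) := by
        rw [← hRR] at h1; linarith
      have := le_of_mul_le_mul_left this (by positivity)
      linarith
  have h3 : P ≤ (65536 * s + 8192 * R) / (A + d) := by rwa [le_div_iff₀ (by positivity)]
  have h4 : R / (A + d) ≤ 1 / n := by
    rw [div_le_div_iff₀ (by positivity) hn0]; nlinarith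
  calc P ≤ _ := h3
    _ = 65536 * (s / (A+d)) + 8192 * (R / (A+d)) := by ring
    _ ≤ 65536 * (s / (A+d)) + 8192 * (1/n) := by gcongr
    _ ≤ _ := by
      have : 0 ≤ 1/n := by positivity
      linarith

lemma df_neg {m : ℕ} (u : Fin (m+1) → ℝ) (π k) : df (fun i => - u i) π k = - df u π k := by
  unfold df; ring

lemma stein_bound {m : ℕ} (u : Fin (m+1) → ℝ) (hV : 0 < Va u) (K : Finset (Fin m))
    (hK : ∀ k ∈ K, ((m:ℝ)+1)^2 / 16 ≤ (((k:ℕ):ℝ) + 1) * ((m:ℝ) - ((k:ℕ):ℝ)))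
    (x s : ℝ) (hs : 0 < s) :
    Ex (fun π => ind (|Xs u π - x| ≤ s) * ind (Va u / 32 ≤ ∑ k ∈ K, df u π k ^ 2))
      ≤ 65536 * (1 / ((m:ℝ)+1) + s / (((m:ℝ)+1) * √(Va u) + |x - mu u|)) := by
  rcases le_total x (mu u) with h | h
  · exact stein_bound_aux u hV K hK x s hs h
  · have := stein_bound_aux (fun i => - u i) (by rwa [Va_neg]) K hK (-x) s hs (by rw [mu_neg]; linarith)
    simp_rw [Va_neg, mu_neg, Xs_neg, df_neg, neg_sq] at this
    have e : ∀ y z : ℝ, |-y - -z| = |y - z| := fun y z => by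
      rw [← abs_neg]; ring_nf
    simp_rw [e] at this
    exact this

end S8

namespace S8

lemma Ex_df_four {m : ℕ} (u : Fin (m+1) → ℝ) (k : Fin m) (δ : ℝ)
    (hδ : ∀ i, (u i - av u) ^ 2 ≤ δ * Va u) :
    (m : ℝ) * Ex (fun π => df u π k ^ 2 * df u π k ^ 2) ≤ 8 * δ * Va u ^ 2 := by
  have h := Ex_pair (fun i j => (u i - u j) ^ 2 * (u i - u j) ^ 2) (fun i => by simp)
    (a := k.castSucc) (b := k.succ) (by simp [Fin.ext_iff])
  have h2 : ∑ i, ∑ j, (u i - u j) ^ 2 * (u i - u j) ^ 2 ≤ 4 * δ * Va u * (2 * ((m+1:ℕ):ℝ) * Va u) := by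
    rw [← Va_pair, mul_sum]
    refine sum_le_sum fun i _ => ?_
    rw [mul_sum]
    refine sum_le_sum fun j _ => ?_
    apply mul_le_mul_of_nonneg_right _ (sq_nonneg _)
    nlinarith [hδ i, hδ j, sq_nonneg ((u i - av u) + (u j - av u))]
  rw [← h] at h2
  push_cast at h2
  have h0 : (0:ℝ) < (m:ℝ) + 1 := by positivity
  have : ((m:ℝ) + 1) * ((m : ℝ) * Ex (fun π => df u π k ^ 2 * df u π k ^ 2))
      ≤ ((m:ℝ)+1) * (8 * δ * Va u ^ 2) := by
    unfold df
    linarith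
  exact le_of_mul_le_mul_left this h0

lemma Ex_df_cross {m : ℕ} (u : Fin (m+1) → ℝ) (k l : Fin m) (hkl : (k:ℕ) + 1 < l) :
    ((m:ℝ)+1) * m * (m-1) * (m-2) * Ex (fun π => df u π k ^ 2 * df u π l ^ 2)
      ≤ (2 * ((m:ℝ)+1) * Va u)^2 := by
  have hm : 3 ≤ m := by have := l.2; omega
  have h := Ex_emb_le (fun y : Fin 4 → Fin (m+1) =>
      (u (y 0) - u (y 1))^2 * (u (y 2) - u (y 3))^2) (fun y => by positivity)
    ⟨![k.castSucc, k.succ, l.castSucc, l.succ], by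
      intro i j; fin_cases i <;> fin_cases j <;> simp [Fin.ext_iff] <;> omega⟩
  have e : ((m+1).descFactorial 4 : ℝ) = ((m:ℝ)+1) * m * (m-1) * (m-2) := by
    obtain ⟨t, rfl⟩ : ∃ t, m = t + 3 := ⟨m - 3, by omega⟩
    have : (t + 3 + 1).descFactorial 4 = (t+4) * (t+3) * (t+2) * (t+1) := by
      simp [Nat.descFactorial_succ]; ring
    rw [this]; push_cast; ring
  rw [e] at h
  refine h.trans (le_of_eq ?_)
  have := Va_pair u
  push_cast at this
  rw [← this, pow_two, sum_mul_sum]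
  rw [← Equiv.sum_comp (Fin.consEquiv (fun _ : Fin 4 => Fin (m+1))), Fintype.sum_prod_type]
  simp only [sum_mul_sum]
  refine sum_congr rfl fun a _ => ?_
  rw [← Equiv.sum_comp (Fin.consEquiv (fun _ : Fin 3 => Fin (m+1))), Fintype.sum_prod_type]
  symm
  rw [sum_comm]
  symm
  refine sum_congr rfl fun b _ => ?_
  rw [← Equiv.sum_comp (finTwoArrowEquiv (Fin (m+1))).symm, Fintype.sum_prod_type]
  refine sum_congr rfl fun c _ => ?_
  refine sum_congr rfl fun d _ => ?_
  simp [Fin.consEquiv]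

lemma conc {m : ℕ} (u : Fin (m+1) → ℝ) (hV : 0 < Va u)
    (hδ : ∀ i, (u i - av u) ^ 2 ≤ (1/500000) * Va u) (K : Finset (Fin m))
    (hK : ∀ k ∈ K, ∀ l ∈ K, (k:ℕ) < l → (k:ℕ) + 1 < l)
    (hr : ((m:ℝ)+1) / 32 ≤ (#K : ℝ)) :
    Ex (fun π => ind (¬ (Va u / 32 ≤ ∑ k ∈ K, df u π k ^ 2))) ≤ 1/1600 := by
  set V := Va u with hVd
  have hn : 500000 ≤ (m:ℝ)+1 := by
    have h1 : V ≤ ∑ i : Fin (m+1), (1/500000) * V := sum_le_sum fun i _ => hδ i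
    rw [sum_const, card_univ, Fintype.card_fin, nsmul_eq_mul] at h1
    push_cast at h1
    nlinarith
  set r : ℝ := (#K : ℝ) with hrd
  have hm : (499999:ℝ) ≤ m := by linarith
  have hm0 : (0:ℝ) < m := by linarith
  have hr0 : 0 < r := by linarith
  set M := 2 * r * V / m with hM
  have hM0 : 0 < M := by positivity
  set Z : Equiv.Perm (Fin (m+1)) → ℝ := fun π => ∑ k ∈ K, df u π k ^ 2 with hZ
  have hEZ : Ex Z = M := by
    rw [hZ, Ex_sum]
    have : ∀ k ∈ K, Ex (fun π => df u π k ^ 2) = 2 * V / m := fun k _ => by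
      rw [eq_div_iff hm0.ne', ← Ex_df_sq u k, mul_comm]
    rw [sum_congr rfl this, sum_const, nsmul_eq_mul, hM]; ring
  set D : ℝ := ((m:ℝ)+1) * m * (m-1) * (m-2) with hD
  have hD0 : 0 < D := by
    have : 0 < (m:ℝ) - 1 := by linarith
    have : 0 < (m:ℝ) - 2 := by linarith
    positivity
  set c1 := 8 * (1/500000) * V^2 / m with hc1
  set c2 := (2 * ((m:ℝ)+1) * V)^2 / D with hc2
  have hc1p : 0 ≤ c1 := by positivity
  have hc2p : 0 ≤ c2 := by positivity
  have hEZ2 : Ex (fun π => Z π ^ 2) ≤ r * c1 + r^2 * c2 := by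
    have e : (fun π => Z π ^ 2) = fun π => ∑ k ∈ K, ∑ l ∈ K, df u π k ^ 2 * df u π l ^ 2 := by
      funext π; rw [pow_two, hZ]; exact sum_mul_sum _ _ _ _
    rw [e, Ex_sum]
    have : ∀ k ∈ K, Ex (fun π => ∑ l ∈ K, df u π k ^ 2 * df u π l ^ 2) ≤ c1 + r * c2 := by
      intro k hk
      rw [Ex_sum]
      have h1 : ∀ l ∈ K, Ex (fun π => df u π k ^ 2 * df u π l ^ 2) ≤ (if l = k then c1 else 0) + c2 := by
        intro l hl
        rcases lt_trichotomy (k:ℕ) (l:ℕ) with h | h | h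
        · rw [if_neg (by rintro rfl; omega), zero_add, hc2, le_div_iff₀ hD0, mul_comm]
          exact Ex_df_cross u k l (hK k hk l hl h)
        · have : l = k := (Fin.ext h).symm
          subst this
          rw [if_pos rfl]
          have := Ex_df_four u l _ hδ
          have : Ex (fun π => df u π l ^ 2 * df u π l ^ 2) ≤ c1 := by
            rw [hc1, le_div_iff₀ hm0, mul_comm]; exact this
          linarith
        · rw [if_neg (by rintro rfl; omega), zero_add, hc2, le_div_iff₀ hD0, mul_comm]
          have := Ex_df_cross u l k (hK l hl k hk h)
          simp_rw [mul_comm (df u _ l ^ 2)] at this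
          exact this
      refine (sum_le_sum h1).trans ?_
      rw [sum_add_distrib, sum_ite_eq' K k, if_pos hk, sum_const, nsmul_eq_mul]
    refine (sum_le_sum this).trans ?_
    rw [sum_const, nsmul_eq_mul]
    apply le_of_eq; rw [← hrd]; ring
  have hvar : Ex (fun π => (Z π - M)^2) ≤ r * c1 + r^2 * c2 - M^2 := by
    have e : (fun π => (Z π - M)^2) = fun π => (Z π ^ 2 - (2 * M) * Z π) + M^2 := by
      funext π; ring
    rw [e, Ex_add, Ex_sub, Ex_mul, Ex_const, hEZ]; linarith
  have hpt : ∀ π, ind (¬ (V / 32 ≤ Z π)) ≤ 4 / M^2 * (Z π - M)^2 := by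
    intro π
    by_cases h : V / 32 ≤ Z π
    · rw [ind_false (by simpa using h)]; positivity
    · rw [ind_true h]
      push Not at h
      have h1 : V / 16 ≤ M := by
        rw [hM, le_div_iff₀ hm0]; nlinarith
      rw [div_mul_eq_mul_div, le_div_iff₀ (by positivity)]
      nlinarith
  refine (Ex_mono hpt).trans ?_
  rw [Ex_mul]
  calc _ ≤ 4 / M^2 * (r * c1 + r^2 * c2 - M^2) := by gcongr
    _ ≤ 1/1600 := by
      rw [div_mul_eq_mul_div, div_le_iff₀ (by positivity)]
      have hc2' : c2 ≤ 4 * V^2 / m^2 * (1 + 5 / ((m:ℝ)+1)) := by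
        have e : 4 * V^2 / m^2 * (1 + 5 / ((m:ℝ)+1)) = 4 * V^2 * (m + 6) / (m^2 * (m+1)) := by
          field_simp; ring
        rw [e, hc2, div_le_div_iff₀ hD0 (by positivity)]
        have : 0 ≤ ((m:ℝ) + 6) * ((m-1) * (m-2)) - (m+1)^2 * m := by nlinarith
        have h2 : 0 ≤ 4 * V^2 * (m * (m+1)) * (((m:ℝ) + 6) * ((m-1) * (m-2)) - (m+1)^2 * m) :=
          mul_nonneg (by positivity) this
        rw [hD]
        nlinarith
      have h5 : 5 / ((m:ℝ)+1) ≤ 1/100000 := by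
        rw [div_le_div_iff₀ (by positivity) (by norm_num)]; linarith
      have hc2'' : c2 ≤ 4 * V^2 / m^2 * (1 + 1/100000) :=
        hc2'.trans (by gcongr)
      have hM2 : M^2 = r^2 * (4 * V^2 / m^2) := by rw [hM]; ring
      have hc1' : r * c1 ≤ 64 / 500000 * (r^2 * (4 * V^2 / m^2)) := by
        have : m ≤ 32 * r := by linarith
        have e : r * c1 = 2 / 500000 * (r * m * (4 * V^2 / m^2)) := by
          rw [hc1]; field_simp; ring
        rw [e]
        have : r * m * (4 * V^2 / m^2) ≤ r * (32 * r) * (4 * V^2 / m^2) := by gcongr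
        nlinarith
      have hW : 0 ≤ r^2 * (4 * V^2 / m^2) := by positivity
      have hc3 : r^2 * c2 ≤ r^2 * (4 * V^2 / m^2 * (1 + 1/100000)) := by gcongr
      rw [hM2]
      linarith

end S8

namespace S8

lemma Va_le {n : ℕ} (u : Fin n → ℝ) (c : ℝ) : Va u ≤ ∑ i, (u i - c) ^ 2 := by
  rw [Va_shift]; have : 0 ≤ (n:ℝ) * (av u - c)^2 := by positivity
  linarith

lemma overlap_nat {n q : ℕ} (hq : 6 * q ≤ n) (W : ℕ → ℝ) :
    Va (fun i : Fin n => W i) ≤ 6 * (Va (fun j : Fin (n - 2*q) => W (0 + j))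
      + Va (fun j : Fin (n - 2*q) => W (2*q + j))) := by
  set c1 := av (fun j : Fin (n - 2*q) => W (0 + j)) with hc1
  set c2 := av (fun j : Fin (n - 2*q) => W (2*q + j)) with hc2
  have e1 : Va (fun j : Fin (n - 2*q) => W (0 + j)) = ∑ k ∈ Ico 0 (n-2*q), (W k - c1)^2 := by
    unfold Va; rw [← hc1, Fin.sum_univ_eq_sum_range (fun j => (W (0 + j) - c1)^2)]
    simp
  have e2 : Va (fun j : Fin (n - 2*q) => W (2*q + j)) = ∑ k ∈ Ico (2*q) n, (W k - c2)^2 := by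
    unfold Va; rw [← hc2, Fin.sum_univ_eq_sum_range (fun j => (W (2*q + j) - c2)^2)]
    rw [sum_Ico_eq_sum_range]
  have e0 : Va (fun i : Fin n => W i) ≤ ∑ k ∈ Ico 0 n, (W k - c1)^2 := by
    refine (Va_le _ c1).trans ?_
    rw [Fin.sum_univ_eq_sum_range (fun j => (W j - c1)^2)]; simp
  rw [← sum_Ico_consecutive _ (Nat.zero_le (n-2*q)) (Nat.sub_le n (2*q)), ← e1] at e0
  have h1 : ∑ k ∈ Ico (n-2*q) n, (W k - c1)^2
      ≤ ∑ k ∈ Ico (n-2*q) n, (2 * (W k - c2)^2 + 2 * (c1 - c2)^2) :=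
    sum_le_sum fun k _ => by nlinarith [sq_nonneg ((W k - c2) + (c1 - c2))]
  rw [sum_add_distrib, ← mul_sum, sum_const, Nat.card_Ico, nsmul_eq_mul] at h1
  have h2 : ∑ k ∈ Ico (n-2*q) n, (W k - c2)^2 ≤ ∑ k ∈ Ico (2*q) n, (W k - c2)^2 :=
    sum_le_sum_of_subset_of_nonneg (Ico_subset_Ico (by omega) le_rfl) fun k _ _ => sq_nonneg _
  have h3 : ∑ k ∈ Ico (2*q) (n-2*q), (c1 - c2)^2
      ≤ ∑ k ∈ Ico (2*q) (n-2*q), (2 * (W k - c1)^2 + 2 * (W k - c2)^2) :=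
    sum_le_sum fun k _ => by nlinarith [sq_nonneg ((W k - c2) + (W k - c1))]
  rw [sum_add_distrib, ← mul_sum, ← mul_sum, sum_const, Nat.card_Ico, nsmul_eq_mul] at h3
  have h4 : ∑ k ∈ Ico (2*q) (n-2*q), (W k - c1)^2 ≤ ∑ k ∈ Ico 0 (n-2*q), (W k - c1)^2 :=
    sum_le_sum_of_subset_of_nonneg (Ico_subset_Ico (by omega) le_rfl) fun k _ _ => sq_nonneg _
  have h5 : ∑ k ∈ Ico (2*q) (n-2*q), (W k - c2)^2 ≤ ∑ k ∈ Ico (2*q) n, (W k - c2)^2 :=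
    sum_le_sum_of_subset_of_nonneg (Ico_subset_Ico le_rfl (by omega)) fun k _ _ => sq_nonneg _
  have h6 : ((n - (n-2*q) : ℕ):ℝ) * (2 * (c1-c2)^2) ≤ 2 * (((n-2*q-2*q : ℕ):ℝ) * (c1-c2)^2) := by
    have : ((n - (n-2*q) : ℕ):ℝ) ≤ ((n-2*q-2*q : ℕ):ℝ) := by exact_mod_cast (by omega)
    nlinarith [sq_nonneg (c1-c2)]
  rw [← e1] at h4
  rw [← e2] at h2 h5
  have := Va_nonneg (fun j : Fin (n - 2*q) => W (2*q + j))
  have := Va_nonneg (fun j : Fin (n - 2*q) => W (0 + j))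
  linarith

def bemb {n m : ℕ} (b : ℕ) (h : b + m ≤ n) : Fin m ↪ Fin n :=
  ⟨fun j => ⟨b + j, by have := j.2; omega⟩, fun i j hij => by
    simp only [Fin.mk.injEq] at hij; exact Fin.ext (by omega)⟩

@[simp] lemma bemb_val {n m : ℕ} (b : ℕ) (h : b + m ≤ n) (j : Fin m) :
    ((bemb b h j : Fin n) : ℕ) = b + j := rfl

lemma overlap {n q : ℕ} (hq : 6 * q ≤ n) (w : Fin n → ℝ) :
    Va w / 12 ≤ Va (fun j : Fin (n-2*q) => w (bemb 0 (by omega) j)) ∨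
    Va w / 12 ≤ Va (fun j : Fin (n-2*q) => w (bemb (2*q) (by omega) j)) := by
  have h := overlap_nat hq (fun k => if h : k < n then w ⟨k, h⟩ else 0)
  have e0 : (fun i : Fin n => (fun k => if h : k < n then w ⟨k, h⟩ else 0) (i:ℕ)) = w := by
    funext i; simp
  have e1 : (fun j : Fin (n-2*q) => (fun k => if h : k < n then w ⟨k, h⟩ else 0) (0 + (j:ℕ)))
      = (fun j : Fin (n-2*q) => w (bemb 0 (by omega) j)) := by
    funext j; have := j.2
    simp only; rw [dif_pos (by omega)]; rfl
  have e2 : (fun j : Fin (n-2*q) => (fun k => if h : k < n then w ⟨k, h⟩ else 0) (2*q + (j:ℕ)))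
      = (fun j : Fin (n-2*q) => w (bemb (2*q) (by omega) j)) := by
    funext j; have := j.2
    simp only; rw [dif_pos (by omega)]; rfl
  rw [e0, e1, e2] at h
  by_contra hc
  push Not at hc
  linarith [hc.1, hc.2]

def TB (C : ℝ) (n : ℕ) : Prop := ∀ u : Fin n → ℝ, 0 < Va u → ∀ x s : ℝ, 0 < s →
  Ex (fun π => ind (|Xs u π - x| ≤ s)) ≤ C * (1 / (n:ℝ) + s / ((n:ℝ) * √(Va u) + |x - mu u|))

lemma Ex_swap {n m : ℕ} (f : Equiv.Perm (Fin n) → Equiv.Perm (Fin m) → ℝ) :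
    Ex (fun π => Ex (fun σ => f π σ)) = Ex (fun σ => Ex (fun π => f π σ)) := by
  unfold Ex
  simp_rw [← sum_div]
  rw [sum_comm]; ring

def cst {n m : ℕ} (b : ℕ) (h : b + m ≤ n) (u : Fin n → ℝ) (π : Equiv.Perm (Fin n)) : ℝ :=
  ∑ k ∈ (univ.map (bemb b h))ᶜ, ((k:ℕ):ℝ) * u (π k) + b * ∑ j, u (π (bemb b h j))

lemma Xs_block {n m : ℕ} (b : ℕ) (h : b + m ≤ n) (u : Fin n → ℝ) (π : Equiv.Perm (Fin n))
    (σ : Equiv.Perm (Fin m)) :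
    Xs u (π * σ.viaFintypeEmbedding (bemb b h))
      = cst b h u π + Xs (fun j => u (π (bemb b h j))) σ := by
  unfold Xs
  rw [← sum_add_sum_compl (univ.map (bemb b h)), sum_map]
  have h1 : ∑ k ∈ (univ.map (bemb b h))ᶜ,
      ((k:ℕ):ℝ) * u ((π * σ.viaFintypeEmbedding (bemb b h)) k)
      = ∑ k ∈ (univ.map (bemb b h))ᶜ, ((k:ℕ):ℝ) * u (π k) := by
    refine sum_congr rfl fun k hk => ?_
    rw [Equiv.Perm.mul_apply, Equiv.Perm.viaFintypeEmbedding_apply_notMem_range]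
    simpa using hk
  rw [h1]
  simp only [Equiv.Perm.mul_apply, Equiv.Perm.viaFintypeEmbedding_apply_image, bemb_val,
    Nat.cast_add, add_mul, sum_add_distrib, cst]
  rw [← mul_sum, Equiv.sum_comp σ (fun j => u (π (bemb b h j)))]
  ring

lemma Ex_block {n m : ℕ} (b : ℕ) (h : b + m ≤ n) (f : Equiv.Perm (Fin n) → ℝ) :
    Ex f = Ex (fun π => Ex (fun σ : Equiv.Perm (Fin m) => f (π * σ.viaFintypeEmbedding (bemb b h)))) := by
  rw [Ex_swap]
  simp_rw [Ex_comp]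
  rw [Ex_const]

lemma recur {n m : ℕ} (b : ℕ) (h : b + m ≤ n) (hm : 0 < m) (hmn : 3 * (n:ℝ) / 4 ≤ m)
    (C : ℝ) (hC : 0 ≤ C) (hTB : TB C m)
    (u : Fin n → ℝ) (hV : 0 < Va u) (x s : ℝ) (hs : 0 < s) (G : Equiv.Perm (Fin n) → Prop)
    (hG : ∀ (π : Equiv.Perm (Fin n)) (σ : Equiv.Perm (Fin m)), G (π * σ.viaFintypeEmbedding (bemb b h)) ↔ G π)
    (hGV : ∀ π, G π → Va u / 12 ≤ Va (fun j => u (π (bemb b h j))))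
    (hε : Ex (fun π => ind (G π)) ≤ 1/1600) :
    Ex (fun π => ind (|Xs u π - x| ≤ s) * ind (G π))
      ≤ C / 4 * (1 / (n:ℝ) + s / ((n:ℝ) * √(Va u) + |x - mu u|)) := by
  have hn : (0:ℝ) < n := by exact_mod_cast (by omega)
  have hm' : (0:ℝ) < m := by exact_mod_cast hm
  set R := √(Va u) with hR
  have hR0 : 0 < R := Real.sqrt_pos.2 hV
  have hRR : R ^ 2 = Va u := Real.sq_sqrt hV.le
  set A := (n:ℝ) * R with hA
  have hA0 : 0 < A := by positivity
  set d := |x - mu u| with hd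
  have hd0 : 0 ≤ d := abs_nonneg _
  set Y : Equiv.Perm (Fin n) → ℝ := fun π => cst b h u π + mu (fun j => u (π (bemb b h j))) with hY
  have hYE : ∀ π, Y π - mu u = Ex (fun σ : Equiv.Perm (Fin m) =>
      Xs u (π * σ.viaFintypeEmbedding (bemb b h)) - mu u) := by
    intro π
    simp_rw [Xs_block]
    rw [Ex_sub, Ex_add, Ex_const, Ex_const, hY]
    obtain ⟨m', rfl⟩ : ∃ m', m = m' + 1 := ⟨m - 1, by omega⟩
    have := Ex_Xs (fun j => u (π (bemb b h j)))
    simp only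
    rw [← this]
  have hYv : Ex (fun π => (Y π - mu u)^2) ≤ A^2 := by
    calc _ ≤ Ex (fun π => Ex (fun σ : Equiv.Perm (Fin m) =>
          (Xs u (π * σ.viaFintypeEmbedding (bemb b h)) - mu u)^2)) := Ex_mono fun π => by
            rw [hYE]; exact Ex_sq_le _
      _ = Ex (fun π => (Xs u π - mu u)^2) := (Ex_block b h (fun π => (Xs u π - mu u)^2)).symm
      _ ≤ _ := by rw [hA, mul_pow, hRR]; exact var_le u
  rw [Ex_block b h]
  have key : ∀ π, Ex (fun σ : Equiv.Perm (Fin m) =>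
      ind (|Xs u (π * σ.viaFintypeEmbedding (bemb b h)) - x| ≤ s)
        * ind (G (π * σ.viaFintypeEmbedding (bemb b h))))
      ≤ C * ((4/3/(n:ℝ) + 105 * s / (A + d)) * ind (G π)
          + (s / (16 * (A + d) * A^2)) * (Y π - mu u)^2) := by
    intro π
    have hsq : 0 ≤ (s / (16 * (A + d) * A^2)) * (Y π - mu u)^2 := by positivity
    by_cases hGp : G π
    · have e1 : ∀ σ : Equiv.Perm (Fin m), ind (G (π * σ.viaFintypeEmbedding (bemb b h))) = 1 :=
        fun σ => ind_true ((hG π σ).2 hGp)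
      simp_rw [e1, mul_one, ind_true hGp, mul_one, Xs_block]
      have e2 : ∀ σ : Equiv.Perm (Fin m), |cst b h u π + Xs (fun j => u (π (bemb b h j))) σ - x|
          = |Xs (fun j => u (π (bemb b h j))) σ - (x - cst b h u π)| := fun σ => by
        congr 1; ring
      simp_rw [e2]
      have hv := hGV π hGp
      set V' := Va (fun j => u (π (bemb b h j))) with hV'
      have hV'0 : 0 < V' := by linarith
      refine (hTB _ hV'0 _ s hs).trans ?_
      apply mul_le_mul_of_nonneg_left _ hC
      have e3 : x - cst b h u π - mu (fun j => u (π (bemb b h j))) = x - Y π := by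
        rw [hY]; ring
      rw [e3]
      have h1 : 1 / (m:ℝ) ≤ 4/3/(n:ℝ) := by
        rw [div_le_div_iff₀ hm' hn]; linarith
      have hrt : R * (4/15) ≤ √V' := by
        apply Real.le_sqrt_of_sq_le
        rw [mul_pow, hRR]; linarith
      have h2 : A / 5 ≤ m * √V' := by
        calc A / 5 = (3 * (n:ℝ)/4) * (R * (4/15)) := by rw [hA]; ring
          _ ≤ _ := by gcongr
      set y := |Y π - mu u| with hy
      have hy0 : 0 ≤ y := abs_nonneg _
      have hdy : d ≤ |x - Y π| + y := by
        have := abs_sub_le x (Y π) (mu u); exact this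
      set z := |x - Y π| with hz
      have hz0 : 0 ≤ z := abs_nonneg _
      have h3 : s / (m * √V' + z) ≤ s / (A/5 + z) := by gcongr
      have h4 : s / (A/5 + z) ≤ 5 * s * (1 + y / A) / (A + d) := by
        rw [div_le_div_iff₀ (by positivity) (by positivity)]
        have : A + d ≤ 5 * (1 + y/A) * (A/5 + z) := by
          have e : 5 * (1 + y/A) * (A/5 + z) = A + 5 * z + y + 5 * (y/A) * z := by
            field_simp; ring
          rw [e]
          have : 0 ≤ 5 * (y/A) * z := by positivity
          linarith
        nlinarith
      have h5 : y / A ≤ 20 + (y/A)^2 / 80 := by nlinarith [sq_nonneg (y/A - 40)]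
      have h6 : 5 * s * (1 + y / A) / (A + d) ≤ 5 * s * (21 + (y/A)^2/80) / (A + d) := by
        apply div_le_div_of_nonneg_right _ (by positivity)
        apply mul_le_mul_of_nonneg_left _ (by positivity)
        linarith
      have e7 : 5 * s * (21 + (y/A)^2/80) / (A + d)
          = 105 * s / (A + d) + s / (16 * (A + d) * A^2) * (Y π - mu u)^2 := by
        rw [hy, div_pow, sq_abs]; field_simp; ring
      linarith
    · have e1 : ∀ σ : Equiv.Perm (Fin m), ind (G (π * σ.viaFintypeEmbedding (bemb b h))) = 0 :=
        fun σ => ind_false (fun hh => hGp ((hG π σ).1 hh))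
      simp_rw [e1, mul_zero, ind_false hGp, mul_zero, zero_add, Ex_const]
      positivity
  refine (Ex_mono key).trans ?_
  rw [Ex_mul, Ex_add, Ex_mul, Ex_mul]
  rw [show C / 4 * (1 / (n:ℝ) + s / (A + d)) = C * ((1 / (n:ℝ) + s / (A + d)) / 4) by ring]
  apply mul_le_mul_of_nonneg_left _ hC
  have t1 : (4/3/(n:ℝ) + 105 * s / (A + d)) * Ex (fun π => ind (G π))
     ≤ (4/3/(n:ℝ) + 105 * s / (A + d)) * (1/1600) := by gcongr
  have t2 : (s / (16 * (A + d) * A^2)) * Ex (fun π => (Y π - mu u)^2)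
     ≤ (s / (16 * (A + d) * A^2)) * A^2 := by gcongr
  have e2 : (s / (16 * (A + d) * A^2)) * A^2 = s / (A+d) / 16 := by field_simp
  have e1 : 4/3/(n:ℝ) + 105 * s / (A + d) = 4/3 * (1/(n:ℝ)) + 105 * (s / (A+d)) := by ring
  rw [e1] at t1 ⊢
  have p1 : 0 ≤ 1/(n:ℝ) := by positivity
  have p2 : 0 ≤ s / (A+d) := by positivity
  linarith

end S8

namespace S8

lemma cyc_succ {m : ℕ} (k : Fin m) :
    Fin.cycleRange k.succ = Fin.cycleRange k.castSucc * Equiv.swap k.castSucc k.succ := by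
  ext j
  rw [Equiv.Perm.mul_apply]
  rcases lt_trichotomy j k.castSucc with h | h | h
  · have h' : j < k.succ := h.trans k.castSucc_lt_succ
    rw [Equiv.swap_apply_of_ne_of_ne h.ne h'.ne, Fin.coe_cycleRange_of_lt h,
      Fin.coe_cycleRange_of_lt h']
  · subst h
    rw [Equiv.swap_apply_left, Fin.cycleRange_of_gt k.castSucc_lt_succ,
      Fin.coe_cycleRange_of_lt k.castSucc_lt_succ]
    simp
  · rcases eq_or_ne j k.succ with h2 | h2
    · subst h2
      rw [Equiv.swap_apply_right, Fin.cycleRange_self, Fin.cycleRange_self]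
    · have h3 : k.succ < j := by
        refine lt_of_le_of_ne ?_ h2.symm
        rw [Fin.le_def]; rw [Fin.lt_def] at h; simp at h ⊢; omega
      rw [Equiv.swap_apply_of_ne_of_ne h.ne' h2, Fin.cycleRange_of_gt h, Fin.cycleRange_of_gt h3]

lemma chain {m : ℕ} (u : Fin (m+1) → ℝ) (π : Equiv.Perm (Fin (m+1))) (p : Fin (m+1)) :
    Xs u (π * Fin.cycleRange p) = Xs u π + ∑ j ∈ Ioc 0 p, (u (π 0) - u (π j)) := by
  induction p using Fin.induction with
  | zero => simp
  | succ k ih =>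
    rw [cyc_succ, ← mul_assoc, Xs_adj, ih]
    have : Ioc 0 k.succ = insert k.succ (Ioc 0 k.castSucc) := by
      ext j; simp only [mem_Ioc, mem_insert, Fin.lt_def, Fin.le_def, Fin.ext_iff, Fin.val_succ, Fin.val_castSucc, Fin.val_zero]
      omega
    rw [this, sum_insert (by simp [Fin.le_def])]
    simp [df, Fin.cycleRange_of_gt k.castSucc_lt_succ]
    ring

lemma chain_diff {m : ℕ} (u : Fin (m+1) → ℝ) (π : Equiv.Perm (Fin (m+1))) (p q : Fin (m+1))
    (h : p ≤ q) :
    Xs u (π * Fin.cycleRange q) - Xs u (π * Fin.cycleRange p)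
      = ∑ j ∈ Ioc p q, (u (π 0) - u (π j)) := by
  rw [chain, chain]
  have : Ioc 0 q = Ioc 0 p ∪ Ioc p q := (Ioc_union_Ioc_eq_Ioc (Fin.zero_le p) h).symm
  rw [this, sum_union]
  · ring
  · rw [disjoint_left]; intro a ha hb
    simp only [mem_Ioc] at ha hb
    exact absurd ha.2 (not_le.2 hb.1)

lemma count_chain {m : ℕ} (u : Fin (m+1) → ℝ) (π : Equiv.Perm (Fin (m+1)))
    (hmax : ∀ i, u i ≤ u (π 0)) (t : ℝ) (ht : 0 < t) (L : ℝ)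
    (hL0 : 0 ≤ L)
    (hL : (#{j | u (π 0) - u (π j) < t} : ℝ) ≤ L) (x s : ℝ) (hs : 0 < s) :
    ∑ p : Fin (m+1), ind (|Xs u (π * Fin.cycleRange p) - x| ≤ s) ≤ 1 + L + 2 * s / t := by
  classical
  set P : Finset (Fin (m+1)) := {p | |Xs u (π * Fin.cycleRange p) - x| ≤ s} with hP
  have e : ∑ p : Fin (m+1), ind (|Xs u (π * Fin.cycleRange p) - x| ≤ s) = #P := by
    rw [hP, card_filter]; push_cast
    exact sum_congr rfl fun p _ => by simp [ind]
  rw [e]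
  rcases P.eq_empty_or_nonempty with h0 | h0
  · rw [h0]; simp; positivity
  set a := P.min' h0
  set b := P.max' h0
  have ha : a ∈ P := min'_mem _ _
  have hb : b ∈ P := max'_mem _ _
  have hab : a ≤ b := min'_le _ _ hb
  have hsub : P ⊆ Icc a b := fun p hp => mem_Icc.2 ⟨min'_le _ _ hp, le_max' _ _ hp⟩
  have hc : #P ≤ #(Ioc a b) + 1 := by
    have := card_le_card hsub
    rw [Fin.card_Icc] at this
    rw [Fin.card_Ioc]
    omega
  have hd := chain_diff u π a b hab
  rw [hP, mem_filter] at ha hb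
  have h1 := _root_.abs_le.1 ha.2
  have h2 := _root_.abs_le.1 hb.2
  have hle : ∑ j ∈ Ioc a b, (u (π 0) - u (π j)) ≤ 2 * s := by rw [← hd]; linarith
  have hge : ∑ j ∈ Ioc a b, (t - t * ind (u (π 0) - u (π j) < t))
      ≤ ∑ j ∈ Ioc a b, (u (π 0) - u (π j)) := sum_le_sum fun j _ => by
    by_cases hj : u (π 0) - u (π j) < t
    · rw [ind_true hj]; have := hmax (π j); linarith
    · rw [ind_false hj]; push Not at hj; linarith
  rw [sum_sub_distrib, sum_const, nsmul_eq_mul, ← mul_sum] at hge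
  have hi : ∑ j ∈ Ioc a b, ind (u (π 0) - u (π j) < t) ≤ L := by
    refine le_trans (sum_le_sum_of_subset_of_nonneg (subset_univ _) fun j _ _ => ind_nonneg _) ?_
    refine le_trans (le_of_eq ?_) hL
    rw [card_filter]; push_cast
    exact sum_congr rfl fun p _ => by simp [ind]
  have hc' : (#P : ℝ) ≤ #(Ioc a b) + 1 := by exact_mod_cast hc
  have h3 : t * #P ≤ t * (1 + L + 2 * s / t) := by
    have : t * (1 + L + 2 * s / t) = t + t * L + 2 * s := by field_simp
    rw [this]
    nlinarith
  exact le_of_mul_le_mul_left h3 ht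

lemma Ex_first {m : ℕ} (e : Fin (m+1)) (f : Equiv.Perm (Fin (m+1)) → ℝ) :
    Ex f = Ex (fun π => ind (π 0 = e) * ∑ p : Fin (m+1), f (π * Fin.cycleRange p)) := by
  simp_rw [mul_sum]
  rw [Ex_sum]
  have h : ∀ p : Fin (m+1), Ex (fun π => ind (π 0 = e) * f (π * Fin.cycleRange p))
      = Ex (fun π => ind (π p = e) * f π) := fun p => by
    rw [← Ex_comp (Fin.cycleRange p) (fun π => ind (π p = e) * f π)]
    simp
  simp_rw [h]
  rw [← Ex_sum]
  congr 1; funext π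
  rw [← sum_mul]
  have : ∑ p, ind (π p = e) = 1 := by
    rw [Equiv.sum_comp π (fun i => ind (i = e))]
    rw [sum_eq_single e (fun i _ hi => ind_false hi) (fun h => absurd (mem_univ _) h)]
    exact ind_true rfl
  rw [this, one_mul]

lemma Ex_zero {m : ℕ} (e : Fin (m+1)) :
    Ex (fun π : Equiv.Perm (Fin (m+1)) => ind (π 0 = e)) = 1 / ((m:ℝ)+1) := by
  have h := Ex_first e (fun _ => 1)
  rw [Ex_const] at h
  simp only [sum_const, card_univ, Fintype.card_fin, nsmul_eq_mul, mul_one] at h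
  have h2 : (fun π : Equiv.Perm (Fin (m+1)) => ind (π 0 = e) * ((m+1:ℕ):ℝ))
     = fun π => ((m+1:ℕ):ℝ) * ind (π 0 = e) := by funext π; ring
  rw [h2, Ex_mul] at h
  push_cast at h
  have : (0:ℝ) < (m:ℝ)+1 := by positivity
  field_simp; linarith

lemma dom_aux {m : ℕ} (u : Fin (m+1) → ℝ) (hV : 0 < Va u) (e : Fin (m+1))
    (hmax : ∀ i, u i ≤ u e) (hpos : 0 < u e - av u)
    (hdom : (1/500000) * Va u ≤ (u e - av u)^2) (x s : ℝ) (hs : 0 < s) :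
    Ex (fun π => ind (|Xs u π - x| ≤ s))
      ≤ 2000001 * (1 / ((m:ℝ)+1) + s / (((m:ℝ)+1) * √(Va u) + |x - mu u|)) := by
  set n : ℝ := (m:ℝ)+1 with hn
  have hn0 : 0 < n := by positivity
  set v := u e - av u with hv
  set R := √(Va u) with hR
  have hR0 : 0 < R := Real.sqrt_pos.2 hV
  have hRR : R ^ 2 = Va u := Real.sq_sqrt hV.le
  set A := n * R with hA
  have hA0 : 0 < A := by positivity
  set d := |x - mu u| with hd
  have hd0 : 0 ≤ d := abs_nonneg _
  have p1 : 0 ≤ 1/n := by positivity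
  have p2 : 0 ≤ s / (A+d) := by positivity
  by_cases htriv : A + d ≤ 2 * s
  · have h1 : Ex (fun π => ind (|Xs u π - x| ≤ s)) ≤ 1 := by
      refine (Ex_mono fun π => ind_le_one _).trans ?_
      rw [Ex_const]
    have h2 : 1/2 ≤ s / (A+d) := by
      rw [div_le_div_iff₀ (by norm_num) (by positivity)]; linarith
    linarith
  push Not at htriv
  have hvR : v ≤ R := by
    apply Real.le_sqrt_of_sq_le
    exact single_le_sum (f := fun i => (u i - av u)^2) (fun i _ => sq_nonneg _) (mem_univ e)
  have hRv : R ≤ 708 * v := by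
    apply Real.sqrt_le_iff.2 ⟨by positivity, ?_⟩
    nlinarith
  have hL : (#{i | u e - u i < v/2} : ℝ) ≤ 2000000 := by
    have h1 : ∑ i ∈ ({i | u e - u i < v/2} : Finset (Fin (m+1))), (v/2)^2 ≤ Va u := by
      unfold Va
      refine le_trans (sum_le_sum fun i hi => ?_)
        (sum_le_sum_of_subset_of_nonneg (subset_univ _) fun i _ _ => sq_nonneg (u i - av u))
      rw [mem_filter] at hi
      have : v/2 ≤ u i - av u := by rw [hv] at hi ⊢; linarith [hi.2]
      exact pow_le_pow_left₀ (by positivity) this 2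
    rw [sum_const, nsmul_eq_mul] at h1
    have hv2 : 0 < v^2 := by positivity
    by_contra hc
    push Not at hc
    nlinarith
  have hsumv : ∑ i, (u e - u i) = n * v := by
    have := sum_sub_av u
    rw [sum_sub_distrib] at this ⊢
    simp only [sum_const, card_univ, Fintype.card_fin, nsmul_eq_mul] at this ⊢
    push_cast at this ⊢
    rw [hv, hn]; linarith
  set h : Equiv.Perm (Fin (m+1)) → ℝ := fun π => 2 * (2 * A + |Xs u π - mu u|) / (A + d) with hh
  have hh0 : ∀ π, 0 ≤ h π := fun π => by rw [hh]; positivity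
  have key : ∀ π : Equiv.Perm (Fin (m+1)), ind (π 0 = e) *
      ∑ p : Fin (m+1), ind (|Xs u (π * Fin.cycleRange p) - x| ≤ s)
      ≤ 2000001 * ind (π 0 = e)
        + 2832 * s / A * (ind (π 0 = e) * ∑ p : Fin (m+1), h (π * Fin.cycleRange p)) := by
    intro π
    by_cases hπ : π 0 = e
    swap
    · rw [ind_false hπ]; simp
    rw [ind_true hπ, one_mul, one_mul, mul_one]
    have hS0 : 0 ≤ ∑ p : Fin (m+1), h (π * Fin.cycleRange p) := sum_nonneg fun p _ => hh0 _
    by_cases hex : ∃ p0, |Xs u (π * Fin.cycleRange p0) - x| ≤ s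
    swap
    · push Not at hex
      rw [sum_eq_zero fun p _ => ind_false (not_le.2 (hex p))]
      positivity
    obtain ⟨p0, hp0⟩ := hex
    have hcnt := count_chain u π (by rw [hπ]; exact hmax) (v/2) (by positivity) 2000000 (by norm_num)
      (by
        refine le_trans (le_of_eq ?_) hL
        rw [hπ]
        norm_cast
        refine card_bij (fun j _ => π j) (fun j hj => by simpa using hj)
          (fun i _ j _ hij => π.injective hij) (fun i hi => ⟨π.symm i, by simpa using hi, by simp⟩))
      x s hs
    have hrange : ∀ p q : Fin (m+1), p ≤ q →
        |Xs u (π * Fin.cycleRange q) - Xs u (π * Fin.cycleRange p)| ≤ A := by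
      intro p q hpq
      rw [chain_diff u π p q hpq, hπ]
      have h0 : ∀ j, 0 ≤ u e - u (π j) := fun j => sub_nonneg.2 (hmax _)
      rw [abs_of_nonneg (sum_nonneg fun j _ => h0 j)]
      refine (sum_le_sum_of_subset_of_nonneg (subset_univ _) fun j _ _ => h0 j).trans ?_
      rw [Equiv.sum_comp π (fun i => u e - u i), hsumv]
      exact mul_le_mul_of_nonneg_left hvR hn0.le
    have hrange' : ∀ p, |Xs u (π * Fin.cycleRange p) - Xs u (π * Fin.cycleRange p0)| ≤ A := by
      intro p
      rcases le_total p p0 with hp | hp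
      · rw [abs_sub_comm]; exact hrange _ _ hp
      · exact hrange _ _ hp
    have hone : ∀ p : Fin (m+1), 1 ≤ h (π * Fin.cycleRange p) := by
      intro p
      rw [hh]; simp only
      rw [le_div_iff₀ (by positivity), one_mul]
      have t1 := abs_sub_le x (Xs u (π * Fin.cycleRange p0)) (mu u)
      have t2 := abs_sub_le (Xs u (π * Fin.cycleRange p0)) (Xs u (π * Fin.cycleRange p)) (mu u)
      rw [abs_sub_comm x (Xs u (π * Fin.cycleRange p0))] at t1
      have t3 := hrange' p
      rw [abs_sub_comm] at t3
      rw [← hd] at t1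
      linarith
    have hsum : n ≤ ∑ p : Fin (m+1), h (π * Fin.cycleRange p) := by
      calc n = ∑ p : Fin (m+1), (1:ℝ) := by simp [hn]
        _ ≤ _ := sum_le_sum fun p _ => hone p
    have h5 : 2 * s / (v/2) ≤ 2832 * s / R := by
      rw [div_le_div_iff₀ (by positivity) hR0]; nlinarith
    have h6 : 2832 * s / R = 2832 * s / A * n := by rw [hA]; field_simp
    have h7 : 2832 * s / A * n ≤ 2832 * s / A * ∑ p : Fin (m+1), h (π * Fin.cycleRange p) :=
      mul_le_mul_of_nonneg_left hsum (by positivity)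
    linarith
  rw [Ex_first e]
  refine (Ex_mono key).trans ?_
  rw [Ex_add, Ex_mul, Ex_mul, ← Ex_first e h, Ex_zero, ← hn]
  have hEh : Ex h ≤ 6 * A / (A + d) := by
    have e1 : h = fun π => (2/(A+d)) * (2 * A + |Xs u π - mu u|) := by
      funext π; rw [hh]; simp only; ring
    rw [e1, Ex_mul, Ex_add, Ex_const]
    have := S8.abs_le u
    push_cast at this
    rw [← hn, ← hR, ← hA] at this
    calc _ ≤ (2/(A+d)) * (2 * A + A) := by gcongr
      _ = _ := by ring
  have h8 : 2832 * s / A * Ex h ≤ 2832 * s / A * (6 * A / (A+d)) :=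
    mul_le_mul_of_nonneg_left hEh (by positivity)
  have h9 : 2832 * s / A * (6 * A / (A+d)) = 16992 * (s / (A+d)) := by field_simp; norm_num
  linarith

lemma dom {m : ℕ} (u : Fin (m+1) → ℝ) (hV : 0 < Va u)
    (hdom : ∃ i, (1/500000) * Va u < (u i - av u)^2) (x s : ℝ) (hs : 0 < s) :
    Ex (fun π => ind (|Xs u π - x| ≤ s))
      ≤ 2000001 * (1 / ((m:ℝ)+1) + s / (((m:ℝ)+1) * √(Va u) + |x - mu u|)) := by
  obtain ⟨i, hi⟩ := hdom
  obtain ⟨e, -, he⟩ := exists_max_image (univ : Finset (Fin (m+1))) (fun i => |u i - av u|) ⟨0, mem_univ _⟩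
  have hie : (u i - av u)^2 ≤ (u e - av u)^2 := sq_le_sq.2 (he i (mem_univ _))
  have hne : u e - av u ≠ 0 := fun h0 => by
    rw [h0] at hie; nlinarith
  rcases lt_or_gt_of_ne hne with hlt | hgt
  · have hav : av (fun i => - u i) = - av u := by unfold av; rw [sum_neg_distrib]; ring
    have := dom_aux (fun i => - u i) (by rwa [Va_neg]) e (fun j => by
      have := he j (mem_univ _)
      rw [abs_of_neg hlt] at this
      have := _root_.abs_le.1 this
      linarith [this.1]) (by rw [hav]; linarith) (by rw [hav, Va_neg]; nlinarith) (-x) s hs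
    rw [Va_neg, mu_neg] at this
    have e1 : ∀ π, |Xs (fun i => - u i) π - -x| = |Xs u π - x| := fun π => by
      rw [Xs_neg, ← abs_neg]; congr 1; ring
    have e2 : |-x - -mu u| = |x - mu u| := by rw [← abs_neg]; congr 1; ring
    simp_rw [e1] at this
    rwa [e2] at this
  · exact dom_aux u hV e (fun j => by
      have := he j (mem_univ _)
      rw [abs_of_pos hgt] at this
      have := _root_.abs_le.1 this
      linarith [this.2]) hgt (by linarith) x s hs

end S8

namespace S8

def kemb {m : ℕ} (a r : ℕ) (h : a + 2 * r ≤ m) : Fin r ↪ Fin m :=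
  ⟨fun j => ⟨a + 2 * j, by have := j.2; omega⟩, fun i j hij => by
    simp only [Fin.mk.injEq] at hij; exact Fin.ext (by omega)⟩

def KK {m : ℕ} (a r : ℕ) (h : a + 2 * r ≤ m) : Finset (Fin m) := univ.map (kemb a r h)

lemma KK_card {m : ℕ} (a r : ℕ) (h : a + 2 * r ≤ m) : #(KK a r h) = r := by simp [KK]

lemma KK_mem {m : ℕ} {a r : ℕ} {h : a + 2 * r ≤ m} {k : Fin m} (hk : k ∈ KK a r h) :
    ∃ j, j < r ∧ (k:ℕ) = a + 2 * j := by
  simp only [KK, mem_map, mem_univ, true_and] at hk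
  obtain ⟨j, rfl⟩ := hk
  exact ⟨j, j.2, rfl⟩

lemma df_via {m l : ℕ} (b : ℕ) (h : b + l ≤ m + 1) (u : Fin (m+1) → ℝ) (π : Equiv.Perm (Fin (m+1)))
    (σ : Equiv.Perm (Fin l)) (k : Fin m) (hk : (k:ℕ) + 1 < b ∨ b + l ≤ k) :
    df u (π * σ.viaFintypeEmbedding (bemb b h)) k = df u π k := by
  unfold df
  rw [Equiv.Perm.mul_apply, Equiv.Perm.mul_apply,
    Equiv.Perm.viaFintypeEmbedding_apply_notMem_range,
    Equiv.Perm.viaFintypeEmbedding_apply_notMem_range]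
  · rintro ⟨j, hj⟩
    have := congrArg Fin.val hj
    have := j.2
    simp at *; omega
  · rintro ⟨j, hj⟩
    have := congrArg Fin.val hj
    have := j.2
    simp at *; omega

lemma Va_via {n l : ℕ} (b : ℕ) (h : b + l ≤ n) (u : Fin n → ℝ) (π : Equiv.Perm (Fin n))
    (σ : Equiv.Perm (Fin l)) :
    Va (fun j => u ((π * σ.viaFintypeEmbedding (bemb b h)) (bemb b h j)))
      = Va (fun j => u (π (bemb b h j))) := by
  simp only [Equiv.Perm.mul_apply, Equiv.Perm.viaFintypeEmbedding_apply_image]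
  exact Va_comp (fun j => u (π (bemb b h j))) σ

lemma ind_and_le (p q : Prop) : ind (p ∧ q) ≤ ind p := by
  by_cases hp : p
  · rw [ind_true hp]; exact ind_le_one _
  · rw [ind_false (fun h => hp h.1)]; exact ind_nonneg _

lemma weight_aux (N a b : ℝ) (hN : 48 ≤ N) (ha : N/8 - 2 ≤ a) (hb : 3*N/4 ≤ b) : N^2/16 ≤ a * b := by
  have := mul_le_mul ha hb (by linarith) (by linarith)
  nlinarith

lemma nondom {m : ℕ} (C : ℝ) (hC : 262144 ≤ C) (hIH : ∀ l, l < m + 1 → TB C l)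
    (u : Fin (m+1) → ℝ) (hV : 0 < Va u)
    (hδ : ∀ i, (u i - av u)^2 ≤ (1/500000) * Va u) (x s : ℝ) (hs : 0 < s) :
    Ex (fun π => ind (|Xs u π - x| ≤ s))
      ≤ C * (1 / ((m:ℝ)+1) + s / (((m:ℝ)+1) * √(Va u) + |x - mu u|)) := by
  have hn : 500000 ≤ m + 1 := by
    have h1 : Va u ≤ ∑ i : Fin (m+1), (1/500000) * Va u := sum_le_sum fun i _ => hδ i
    rw [sum_const, card_univ, Fintype.card_fin, nsmul_eq_mul] at h1
    by_contra hc
    have hc' : ((m+1:ℕ):ℝ) < 500000 := by exact_mod_cast (not_le.1 hc)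
    nlinarith
  obtain ⟨r, hr1, hr2⟩ : ∃ r : ℕ, 16 * r ≤ m + 1 ∧ m + 1 < 16 * r + 16 :=
    ⟨(m+1)/16, by omega, by omega⟩
  obtain ⟨q, hq⟩ : ∃ q : ℕ, q = 2 * r := ⟨_, rfl⟩
  have R1 : (16:ℝ) * r ≤ (m:ℝ) + 1 := by exact_mod_cast hr1
  have R2 : (m:ℝ) + 1 < 16 * r + 16 := by exact_mod_cast hr2
  have R3 : (500000:ℝ) ≤ (m:ℝ) + 1 := by exact_mod_cast hn
  have a1 : q + 2 * r ≤ m := by omega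
  have a2 : (m + 1 - 2 * q) + 2 * r ≤ m := by omega
  set K1 : Finset (Fin m) := KK q r a1 with hK1
  set K2 : Finset (Fin m) := KK (m + 1 - 2 * q) r a2 with hK2
  have w1 : ∀ k ∈ K1, ((m:ℝ)+1)^2/16 ≤ (((k:ℕ):ℝ)+1)*((m:ℝ)-((k:ℕ):ℝ)) := by
    intro k hk
    obtain ⟨j, hj, hkj⟩ := KK_mem hk
    have t1 : 2 * r ≤ (k:ℕ) := by omega
    have t2 : (k:ℕ) + 1 ≤ 4 * r := by omega
    have t1' : (2:ℝ) * r ≤ (k:ℕ) := by exact_mod_cast t1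
    have t2' : ((k:ℕ):ℝ) + 1 ≤ 4 * r := by exact_mod_cast t2
    have z1 : ((m:ℝ)+1)/8 - 2 ≤ ((k:ℕ):ℝ)+1 := by linarith
    have z2 : 3*((m:ℝ)+1)/4 ≤ (m:ℝ)-((k:ℕ):ℝ) := by linarith
    exact weight_aux _ _ _ (by linarith) z1 z2
  have w2 : ∀ k ∈ K2, ((m:ℝ)+1)^2/16 ≤ (((k:ℕ):ℝ)+1)*((m:ℝ)-((k:ℕ):ℝ)) := by
    intro k hk
    obtain ⟨j, hj, hkj⟩ := KK_mem hk
    have t1 : m + 1 ≤ (k:ℕ) + 4 * r := by omega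
    have t2 : (k:ℕ) + 2 * r + 1 ≤ m := by omega
    have t1' : (m:ℝ) + 1 ≤ (k:ℕ) + 4 * r := by exact_mod_cast t1
    have t2' : ((k:ℕ):ℝ) + 2 * r + 1 ≤ m := by exact_mod_cast t2
    have z1 : ((m:ℝ)+1)/8 - 2 ≤ (m:ℝ)-((k:ℕ):ℝ) := by linarith
    have z2 : 3*((m:ℝ)+1)/4 ≤ ((k:ℕ):ℝ)+1 := by linarith
    rw [mul_comm]
    exact weight_aux _ _ _ (by linarith) z1 z2
  have sep : ∀ (a : ℕ) (h : a + 2 * r ≤ m), ∀ k ∈ KK a r h, ∀ l ∈ KK a r h, (k:ℕ) < l → (k:ℕ)+1 < l := by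
    intro a h k hk l hl hkl
    obtain ⟨j, hj, hkj⟩ := KK_mem hk
    obtain ⟨i, hi, hli⟩ := KK_mem hl
    omega
  have rr : ((m:ℝ)+1)/32 ≤ r := by linarith
  have c1 := conc u hV hδ K1 (sep _ _) (by rw [hK1, KK_card]; exact rr)
  have c2 := conc u hV hδ K2 (sep _ _) (by rw [hK2, KK_card]; exact rr)
  have b1 := stein_bound u hV K1 w1 x s hs
  have b2 := stein_bound u hV K2 w2 x s hs
  have hb0 : 0 + (m + 1 - 2 * q) ≤ m + 1 := by omega
  have hb2 : 2 * q + (m + 1 - 2 * q) ≤ m + 1 := by omega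
  have hl : m + 1 - 2 * q < m + 1 := by omega
  have hmn : 3 * ((m + 1 : ℕ):ℝ) / 4 ≤ ((m + 1 - 2 * q : ℕ):ℝ) := by
    rw [Nat.cast_sub (by omega)]; push_cast; rw [hq]; push_cast; linarith
  have r1 := recur 0 hb0 (by omega) hmn C (by linarith) (hIH _ hl) u hV x s hs
    (fun π => ¬ (Va u / 32 ≤ ∑ k ∈ K2, df u π k ^ 2) ∧
      Va u / 12 ≤ Va (fun j => u (π (bemb 0 hb0 j))))
    (fun π σ => by
      rw [Va_via]
      have : ∑ k ∈ K2, df u (π * σ.viaFintypeEmbedding (bemb 0 hb0)) k ^ 2 = ∑ k ∈ K2, df u π k ^ 2 :=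
        sum_congr rfl fun k hk => by
          obtain ⟨j, hj, hkj⟩ := KK_mem hk
          rw [df_via]; right; omega
      rw [this])
    (fun π h => h.2) ((Ex_mono fun π => ind_and_le _ _).trans c2)
  have r2 := recur (2*q) hb2 (by omega) hmn C (by linarith) (hIH _ hl) u hV x s hs
    (fun π => ¬ (Va u / 32 ≤ ∑ k ∈ K1, df u π k ^ 2) ∧
      Va u / 12 ≤ Va (fun j => u (π (bemb (2*q) hb2 j))))
    (fun π σ => by
      rw [Va_via]
      have : ∑ k ∈ K1, df u (π * σ.viaFintypeEmbedding (bemb (2*q) hb2)) k ^ 2 = ∑ k ∈ K1, df u π k ^ 2 :=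
        sum_congr rfl fun k hk => by
          obtain ⟨j, hj, hkj⟩ := KK_mem hk
          rw [df_via]; left; omega
      rw [this])
    (fun π h => h.2) ((Ex_mono fun π => ind_and_le _ _).trans c1)
  push_cast at r1 r2
  set Q := 1 / ((m:ℝ)+1) + s / (((m:ℝ)+1) * √(Va u) + |x - mu u|) with hQ
  have hQ0 : 0 ≤ Q := by rw [hQ]; positivity
  have hsplit : Ex (fun π => ind (|Xs u π - x| ≤ s)) ≤
      Ex (fun π => (ind (|Xs u π - x| ≤ s) * ind (Va u / 32 ≤ ∑ k ∈ K1, df u π k ^ 2)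
        + ind (|Xs u π - x| ≤ s) * ind (Va u / 32 ≤ ∑ k ∈ K2, df u π k ^ 2))
        + (ind (|Xs u π - x| ≤ s) * ind (¬ (Va u / 32 ≤ ∑ k ∈ K2, df u π k ^ 2) ∧
              Va u / 12 ≤ Va (fun j => u (π (bemb 0 hb0 j))))
        + ind (|Xs u π - x| ≤ s) * ind (¬ (Va u / 32 ≤ ∑ k ∈ K1, df u π k ^ 2) ∧
              Va u / 12 ≤ Va (fun j => u (π (bemb (2*q) hb2 j)))))) := by
    refine Ex_mono fun π => ?_
    rw [← mul_add, ← mul_add, ← mul_add]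
    apply le_mul_of_one_le_right (ind_nonneg _)
    by_cases h1 : Va u / 32 ≤ ∑ k ∈ K1, df u π k ^ 2
    · rw [ind_true h1]
      have := ind_nonneg (Va u / 32 ≤ ∑ k ∈ K2, df u π k ^ 2)
      have := ind_nonneg (¬ (Va u / 32 ≤ ∑ k ∈ K2, df u π k ^ 2) ∧
              Va u / 12 ≤ Va (fun j => u (π (bemb 0 hb0 j))))
      have := ind_nonneg (¬ (Va u / 32 ≤ ∑ k ∈ K1, df u π k ^ 2) ∧
              Va u / 12 ≤ Va (fun j => u (π (bemb (2*q) hb2 j))))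
      linarith
    by_cases h2 : Va u / 32 ≤ ∑ k ∈ K2, df u π k ^ 2
    · rw [ind_true h2]
      have := ind_nonneg (Va u / 32 ≤ ∑ k ∈ K1, df u π k ^ 2)
      have := ind_nonneg (¬ (Va u / 32 ≤ ∑ k ∈ K2, df u π k ^ 2) ∧
              Va u / 12 ≤ Va (fun j => u (π (bemb 0 hb0 j))))
      have := ind_nonneg (¬ (Va u / 32 ≤ ∑ k ∈ K1, df u π k ^ 2) ∧
              Va u / 12 ≤ Va (fun j => u (π (bemb (2*q) hb2 j))))
      linarith
    have ho := overlap (q := q) (by omega) (fun i => u (π i))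
    rw [Va_comp] at ho
    rw [ind_false h1, ind_false h2]
    rcases ho with ho | ho
    · rw [ind_true (p := ¬ (Va u / 32 ≤ ∑ k ∈ K2, df u π k ^ 2) ∧
              Va u / 12 ≤ Va (fun j => u (π (bemb 0 hb0 j)))) ⟨h2, ho⟩]
      have := ind_nonneg (¬ (Va u / 32 ≤ ∑ k ∈ K1, df u π k ^ 2) ∧
              Va u / 12 ≤ Va (fun j => u (π (bemb (2*q) hb2 j))))
      linarith
    · rw [ind_true (p := ¬ (Va u / 32 ≤ ∑ k ∈ K1, df u π k ^ 2) ∧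
              Va u / 12 ≤ Va (fun j => u (π (bemb (2*q) hb2 j)))) ⟨h1, ho⟩]
      have := ind_nonneg (¬ (Va u / 32 ≤ ∑ k ∈ K2, df u π k ^ 2) ∧
              Va u / 12 ≤ Va (fun j => u (π (bemb 0 hb0 j))))
      linarith
  rw [Ex_add, Ex_add, Ex_add] at hsplit
  have : 262144 * Q ≤ C * Q := mul_le_mul_of_nonneg_right hC hQ0
  linarith

lemma TB_all (n : ℕ) : TB 2000001 n := by
  induction n using Nat.strong_induction_on with
  | _ n ih =>
    intro u hV x s hs
    rcases n with _ | m
    · simp [Va] at hV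
    push_cast
    by_cases hd : ∃ i, (1/500000) * Va u < (u i - av u)^2
    · exact dom u hV hd x s hs
    · push Not at hd
      exact nondom 2000001 (by norm_num) ih u hV hd x s hs

lemma main_bound {n : ℕ} (hn : 2 ≤ n) (u : Fin n → ℝ) (hu : u ≠ 0) :
    Ex (fun π => ind (|Xs u π - (-∑ i, u i)| ≤ |∑ i, u i|)) ≤ 6000003 / (n:ℝ) := by
  have hn' : (2:ℝ) ≤ n := by exact_mod_cast hn
  set S := ∑ i, u i with hS
  have hmu : mu u = S * ((n:ℝ) - 1)/2 := rfl
  rcases (Va_nonneg u).eq_or_lt with h0 | hV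
  · have hc : ∀ i, u i = av u := fun i => by
      have := (sum_eq_zero_iff_of_nonneg (fun i _ => sq_nonneg (u i - av u))).1 h0.symm i (mem_univ _)
      have := pow_eq_zero_iff (two_ne_zero) |>.1 this
      linarith
    have hSn : S = n * av u := by
      rw [hS, sum_congr rfl fun i _ => hc i]; simp
    have hav : av u ≠ 0 := fun h => hu (funext fun i => by rw [hc, h]; rfl)
    have hS0 : 0 < |S| := abs_pos.2 (by rw [hSn]; positivity)
    have hX : ∀ π, Xs u π = mu u := fun π => by
      obtain ⟨m, rfl⟩ : ∃ m, n = m + 1 := ⟨n - 1, by omega⟩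
      have h1 : ∀ π, Xs u π = Xs u 1 := fun π => by
        unfold Xs; refine sum_congr rfl fun k _ => ?_
        rw [hc (π k), hc ((1 : Equiv.Perm (Fin (m+1))) k)]
      have h2 := Ex_Xs u
      rw [show Xs u = fun _ => Xs u 1 from funext h1, Ex_const] at h2
      rw [h1, h2]
    have hz : ∀ π, ind (|Xs u π - (-S)| ≤ |S|) = 0 := fun π => by
      apply ind_false
      rw [hX, hmu, show S * ((n:ℝ)-1)/2 - -S = S * (((n:ℝ)+1)/2) by ring, abs_mul,
        abs_of_nonneg (a := ((n:ℝ)+1)/2) (by positivity)]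
      nlinarith
    simp_rw [hz]
    rw [Ex_const]; positivity
  · have hR : 0 < √(Va u) := Real.sqrt_pos.2 hV
    have hd : |(-S) - mu u| = |S| * (((n:ℝ)+1)/2) := by
      rw [hmu, show -S - S * ((n:ℝ)-1)/2 = -(S * (((n:ℝ)+1)/2)) by ring, abs_neg, abs_mul,
        abs_of_nonneg (a := ((n:ℝ)+1)/2) (by positivity)]
    rcases (abs_nonneg S).eq_or_lt with hs0 | hs0
    · have h := TB_all n u hV (-S) (√(Va u)) hR
      refine (Ex_mono (g := fun π => ind (|Xs u π - (-S)| ≤ √(Va u))) fun π => ?_).trans (h.trans ?_)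
      · by_cases hp : |Xs u π - -S| ≤ |S|
        · rw [ind_true (p := |Xs u π - (-S)| ≤ √(Va u)) (by linarith)]; exact ind_le_one _
        · rw [ind_false hp]; exact ind_nonneg _
      · rw [hd, ← hs0, zero_mul, add_zero]
        have : √(Va u) / ((n:ℝ) * √(Va u)) = 1 / n := by field_simp
        rw [this, ← add_div, mul_div_assoc']
        gcongr; norm_num
    · refine (TB_all n u hV (-S) |S| hs0).trans ?_
      rw [hd]
      have h1 : |S| / ((n:ℝ) * √(Va u) + |S| * (((n:ℝ)+1)/2)) ≤ 2 / n := by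
        rw [div_le_div_iff₀ (by positivity) (by positivity)]
        have : 0 < (n:ℝ) * √(Va u) := by positivity
        nlinarith
      calc _ ≤ 2000001 * (1 / (n:ℝ) + 2 / n) := by gcongr
        _ = _ := by ring

end S8
end

theorem stmt_8 :
    ∃ C > (0:ℝ), ∀ (n : ℕ), 2 ≤ n → ∀ u : Fin n → ℝ, u ≠ 0 →
      ((Finset.univ.filter (fun π : Equiv.Perm (Fin n) =>
          |∑ i, u i * ((π i : ℕ) + 1 : ℝ)| ≤ |∑ i, u i|)).card : ℝ) / (n.factorial : ℝ)
        ≤ C / n := by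
  refine ⟨6000003, by norm_num, fun n hn u hu => ?_⟩
  refine le_trans (le_of_eq ?_) (S8.main_bound hn u hu)
  unfold S8.Ex
  congr 1
  rw [card_filter]; push_cast
  rw [← Equiv.sum_comp (Equiv.inv (Equiv.Perm (Fin n)))]
  refine sum_congr rfl fun π _ => ?_
  have h : ∑ i, u i * ((((Equiv.inv (Equiv.Perm (Fin n))) π i : Fin n) : ℕ) + 1 : ℝ)
      = S8.Xs u π - (-∑ i, u i) := by
    unfold S8.Xs
    rw [sub_neg_eq_add, ← Equiv.sum_comp π (fun i => u i * _)]
    have e := Equiv.sum_comp π u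
    rw [← e, ← sum_add_distrib]
    refine sum_congr rfl fun k _ => ?_
    simp; ring
  rw [h]
  simp [S8.ind]
end

section
/- Let $w=(w_1,\ldots,w_n)\in\mathbb{R}^n$, let $\sigma\in\mathrm{Sym}_n$, and let $V_\sigma$ be uniformly distributed on the simplex $\Delta_\sigma=\{x\in[0,1]^n : x_{\sigma(1)}<x_{\sigma(2)}<\cdots<x_{\sigma(n)}\}$. Then $\mathrm{Var}[\langle w, V_\sigma\rangle] \le \frac{w(\sigma)^2}{(n+1)(n+2)}$, where $w(\sigma)^2 = \sum_{j=1}^n (w_{\sigma(j)}+w_{\sigma(j+1)}+\cdots+w_{\sigma(n)})^2$. -/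
open Finset MeasureTheory
open scoped ENNReal

/-- The ordered simplex with upper bound `t`. -/
def oSimp (n : ℕ) (t : ℝ) : Set (Fin n → ℝ) :=
  {x | (∀ i, x i ∈ Set.Ico (0:ℝ) t) ∧ ∀ i j : Fin n, i < j → x i < x j}

lemma oSimp_incr_meas (n : ℕ) :
    MeasurableSet {x : Fin n → ℝ | ∀ i j : Fin n, i < j → x i < x j} := by
  simp only [Set.ofPred_forall]
  refine MeasurableSet.iInter fun i => MeasurableSet.iInter fun j => MeasurableSet.iInter fun _ => ?_
  exact measurableSet_lt (measurable_pi_apply i) (measurable_pi_apply j)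

lemma oSimp_eq (n : ℕ) (t : ℝ) : oSimp n t =
    (Set.univ.pi fun _ => Set.Ico (0:ℝ) t) ∩ {x | ∀ i j : Fin n, i < j → x i < x j} := by
  ext x; simp [oSimp]

lemma oSimp_meas (n : ℕ) (t : ℝ) : MeasurableSet (oSimp n t) := by
  rw [oSimp_eq]
  exact (MeasurableSet.univ_pi fun _ => measurableSet_Ico).inter (oSimp_incr_meas n)

lemma oSimp_int (n : ℕ) (t : ℝ) (f : (Fin n → ℝ) → ℝ) (hf : Continuous f) :
    IntegrableOn f (oSimp n t) := by
  have h : IntegrableOn f (Set.Icc (fun _ => 0) (fun _ => t)) :=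
    hf.continuousOn.integrableOn_compact isCompact_Icc
  refine h.mono_set ?_
  intro x hx
  exact ⟨fun i => (hx.1 i).1, fun i => (hx.1 i).2.le⟩

lemma oSimp_snoc (n : ℕ) (t s : ℝ) (x : Fin n → ℝ) :
    (Fin.snoc x s : Fin (n+1) → ℝ) ∈ oSimp (n+1) t ↔ s ∈ Set.Ico 0 t ∧ x ∈ oSimp n s := by
  simp only [oSimp, Set.mem_ofPred_eq, Fin.forall_fin_succ', Fin.snoc_castSucc, Fin.snoc_last,
    Fin.castSucc_lt_castSucc_iff, Fin.castSucc_lt_last, Set.mem_Ico, lt_irrefl]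
  constructor
  · rintro ⟨⟨h1, h2⟩, h3, h4⟩
    exact ⟨h2, fun i => ⟨(h1 i).1, (h3 i).2 trivial⟩, fun i j hij => (h3 i).1 j hij⟩
  · rintro ⟨h1, h2, h3⟩
    refine ⟨⟨fun i => ⟨(h2 i).1, (h2 i).2.trans h1.2⟩, h1⟩,
      fun i => ⟨fun j hij => h3 i j hij, fun _ => (h2 i).2⟩, fun i h => ?_, fun h => h.elim⟩
    exact absurd h (not_lt.2 (Fin.le_last _))

lemma oSimp_fubini (n : ℕ) (t : ℝ) (ht : 0 ≤ t) (f : (Fin (n+1) → ℝ) → ℝ) (hf : Continuous f) :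
    ∫ x in oSimp (n+1) t, f x =
      ∫ s in (0:ℝ)..t, ∫ x in oSimp n s, f (Fin.snoc x s) := by
  have hmp := (volume_preserving_piFinSuccAbove (fun _ : Fin (n+1) => ℝ) (Fin.last n)).symm
  have hI : Integrable ((oSimp (n+1) t).indicator f) :=
    (integrable_indicator_iff (oSimp_meas _ _)).2 (oSimp_int _ _ f hf)
  rw [← integral_indicator (oSimp_meas _ _), ← hmp.integral_comp', Measure.volume_eq_prod,
    integral_prod]
  · rw [intervalIntegral.integral_of_le ht, ← integral_Ico_eq_integral_Ioc,
      ← integral_indicator measurableSet_Ico]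
    congr 1
    ext s
    have key : ∀ x : Fin n → ℝ, (oSimp (n+1) t).indicator f
        ((MeasurableEquiv.piFinSuccAbove (fun _ : Fin (n+1) => ℝ) (Fin.last n)).symm (s, x))
        = (Set.Ico 0 t).indicator (fun s => (oSimp n s).indicator
            (fun x => f (Fin.snoc x s)) x) s := by
      intro x
      have : (MeasurableEquiv.piFinSuccAbove (fun _ : Fin (n+1) => ℝ) (Fin.last n)).symm (s, x)
        = (Fin.snoc x s : Fin (n+1) → ℝ) := by
        simp [MeasurableEquiv.piFinSuccAbove, Fin.insertNthEquiv]
      rw [this]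
      classical
      simp only [Set.indicator_apply, oSimp_snoc, ite_and]
    refine (integral_congr_ae (Filter.Eventually.of_forall key)).trans ?_
    by_cases hs : s ∈ Set.Ico 0 t
    · simp only [Set.indicator_of_mem hs]
      rw [integral_indicator (oSimp_meas _ _)]
    · simp only [Set.indicator_of_notMem hs, integral_zero]
  · exact hmp.integrable_comp_of_integrable hI

lemma sum_snoc {n : ℕ} (w : Fin (n+1) → ℝ) (x : Fin n → ℝ) (s : ℝ) :
    ∑ i, w i * (Fin.snoc x s : Fin (n+1) → ℝ) i
      = ∑ i : Fin n, w i.castSucc * x i + w (Fin.last n) * s := by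
  simp [Fin.sum_univ_castSucc]

lemma sum_Ici_castSucc {n : ℕ} (w : Fin (n+1) → ℝ) (j : Fin n) :
    ∑ i ∈ Ici j.castSucc, w i = ∑ i ∈ Ici j, w i.castSucc + w (Fin.last n) := by
  have h1 : ∀ (m : ℕ) (j : Fin m) (w : Fin m → ℝ),
      ∑ i ∈ Ici j, w i = ∑ i, if j ≤ i then w i else 0 := by
    intro m j w
    rw [← Finset.sum_filter]
    congr 1
    ext; simp
  rw [h1, h1, Fin.sum_univ_castSucc]
  simp [Fin.le_last]

lemma sum_Ici_last {n : ℕ} (w : Fin (n+1) → ℝ) :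
    ∑ i ∈ Ici (Fin.last n), w i = w (Fin.last n) := by
  have : Ici (Fin.last n) = {Fin.last n} := by
    ext i; simp [Fin.last_le_iff]
  simp [this]

lemma moment0 (n : ℕ) : ∀ t : ℝ, 0 ≤ t → ∫ _x in oSimp n t, (1:ℝ) = t ^ n / n.factorial := by
  induction n with
  | zero =>
    intro t _
    have : oSimp 0 t = Set.univ := by ext x; simp [oSimp]
    simp [this, measureReal_def, volume_pi, Measure.pi_of_empty]
  | succ n ih =>
    intro t ht
    rw [oSimp_fubini n t ht _ continuous_const]
    rw [intervalIntegral.integral_congr (g := fun s => s ^ n / n.factorial)]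
    · rw [intervalIntegral.integral_div, integral_pow, Nat.factorial_succ]
      push_cast
      field_simp
      simp
    · intro s hs
      rw [Set.uIcc_of_le ht] at hs
      exact ih s hs.1

lemma moment1 (n : ℕ) : ∀ (w : Fin n → ℝ) (t : ℝ), 0 ≤ t → ∫ x in oSimp n t, (∑ i, w i * x i)
    = t ^ (n+1) / (n+1).factorial * ∑ j, ∑ i ∈ Ici j, w i := by
  induction n with
  | zero => intro w t _; simp
  | succ n ih =>
    intro w t ht
    rw [oSimp_fubini n t ht _ (by fun_prop)]
    rw [intervalIntegral.integral_congr (g := fun s => s ^ (n+1) *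
      ((∑ j, ∑ i ∈ Ici j, w (Fin.castSucc i) + (n+1) * w (Fin.last n)) / (n+1).factorial))]
    · rw [intervalIntegral.integral_mul_const, integral_pow, Fin.sum_univ_castSucc]
      simp only [sum_Ici_castSucc, sum_Ici_last, Finset.sum_add_distrib]
      rw [Nat.factorial_succ (n+1)]
      push_cast
      simp
      field_simp
      ring
    · intro s hs
      rw [Set.uIcc_of_le ht] at hs
      simp only [sum_snoc]
      rw [integral_add (oSimp_int _ _ _ (by fun_prop)) (oSimp_int _ _ _ (by fun_prop)),
        ih _ s hs.1]
      have := moment0 n s hs.1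
      have h2 : ∫ _x in oSimp n s, w (Fin.last n) * s = w (Fin.last n) * s * (s ^ n / n.factorial) := by
        rw [← this, ← integral_const_mul]; simp
      rw [h2, Nat.factorial_succ n]
      push_cast
      field_simp
      ring

lemma moment2 (n : ℕ) : ∀ (w : Fin n → ℝ) (t : ℝ), 0 ≤ t →
    ∫ x in oSimp n t, (∑ i, w i * x i) ^ 2
    = t ^ (n+2) / (n+2).factorial *
      ((∑ j, ∑ i ∈ Ici j, w i) ^ 2 + ∑ j, (∑ i ∈ Ici j, w i) ^ 2) := by
  induction n with
  | zero => intro w t _; simp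
  | succ n ih =>
    intro w t ht
    rw [oSimp_fubini n t ht _ (by fun_prop)]
    set A := ∑ j, ∑ i ∈ Ici j, w (Fin.castSucc i) with hA
    set R := ∑ j, (∑ i ∈ Ici j, w (Fin.castSucc i)) ^ 2 with hR
    set v := w (Fin.last n) with hv
    rw [intervalIntegral.integral_congr (g := fun s => s ^ (n+2) *
      ((A ^ 2 + R + 2 * v * (n+2) * A + v ^ 2 * (n+2) * (n+1)) / (n+2).factorial))]
    · rw [intervalIntegral.integral_mul_const, integral_pow, Fin.sum_univ_castSucc,
        Fin.sum_univ_castSucc]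
      simp only [sum_Ici_castSucc, sum_Ici_last, add_sq, Finset.sum_add_distrib,
        ← Finset.sum_mul, ← Finset.mul_sum]
      rw [← hA, ← hR, ← hv, Nat.factorial_succ (n+2)]
      push_cast
      simp
      field_simp
      ring
    · intro s hs
      rw [Set.uIcc_of_le ht] at hs
      simp only [sum_snoc]
      have h0 := moment0 n s hs.1
      have h1 := moment1 n (fun i => w i.castSucc) s hs.1
      have e : ∀ x : Fin n → ℝ, (∑ i : Fin n, w i.castSucc * x i + v * s) ^ 2
        = (∑ i : Fin n, w i.castSucc * x i) ^ 2
          + ((2 * v * s) * (∑ i : Fin n, w i.castSucc * x i) + (v * s) ^ 2 * 1) := by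
        intro x; ring
      rw [← hv]
      simp only [e]
      rw [integral_add (oSimp_int _ _ _ (by fun_prop)) (oSimp_int _ _ _ (by fun_prop)),
        integral_add (oSimp_int _ _ _ (by fun_prop)) (oSimp_int _ _ _ (by fun_prop)),
        integral_const_mul, integral_const_mul, h0, h1, ih _ s hs.1]
      rw [Nat.factorial_succ (n+1), Nat.factorial_succ n]
      push_cast
      rw [← hA, ← hR]
      field_simp
      ring

lemma perm_int (n : ℕ) (σ : Equiv.Perm (Fin n)) (w : Fin n → ℝ) (k : ℕ) :
    ∫ x in {x : Fin n → ℝ | (∀ i, x i ∈ Set.Icc (0:ℝ) 1) ∧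
      ∀ i j : Fin n, i < j → x (σ i) < x (σ j)}, (∑ i, w i * x i) ^ k
    = ∫ x in oSimp n 1, (∑ i, w (σ i) * x i) ^ k := by
  have hmp := volume_measurePreserving_piCongrLeft (fun _ : Fin n => ℝ) σ
  rw [← hmp.setIntegral_preimage_emb (MeasurableEquiv.measurableEmbedding _)]
  have hap : ∀ (y : Fin n → ℝ) i,
      (MeasurableEquiv.piCongrLeft (fun _ : Fin n => ℝ) σ) y (σ i) = y i := fun y i =>
    Equiv.piCongrLeft_apply_apply (fun _ : Fin n => ℝ) σ y i
  have hs : ∀ (y : Fin n → ℝ),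
      ∑ i, w i * (MeasurableEquiv.piCongrLeft (fun _ : Fin n => ℝ) σ) y i
        = ∑ i, w (σ i) * y i := by
    intro y
    rw [← Equiv.sum_comp σ]
    simp only [hap]
  simp only [hs]
  apply setIntegral_congr_set
  have hset : (MeasurableEquiv.piCongrLeft (fun _ : Fin n => ℝ) σ) ⁻¹'
      {x : Fin n → ℝ | (∀ i, x i ∈ Set.Icc (0:ℝ) 1) ∧
      ∀ i j : Fin n, i < j → x (σ i) < x (σ j)} =
      Set.Icc (fun _ => 0) (fun _ => 1) ∩ {x | ∀ i j : Fin n, i < j → x i < x j} := by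
    ext y
    simp only [Set.mem_preimage, Set.mem_ofPred_eq, hap, Set.mem_inter_iff]
    refine and_congr_left fun _ => ?_
    rw [← σ.forall_congr_right]
    simp only [hap]
    simp [Pi.le_def, forall_and]
  rw [hset, oSimp_eq]
  exact (Measure.univ_pi_Ico_ae_eq_Icc (μ := fun _ : Fin n => (volume : Measure ℝ))).symm.inter
    (Filter.EventuallyEq.refl _ _)

-- `μσ` is the uniform probability measure on the simplex `Δσ` (its Lebesgue
-- volume is `1/n!`); the variance of `⟨w, V_σ⟩` is at most `w(σ)²/((n+1)(n+2))`.
theorem stmt_13 (n : ℕ) (hn : 1 ≤ n) (w : Fin n → ℝ) (σ : Equiv.Perm (Fin n)) :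
    let Δσ : Set (Fin n → ℝ) :=
      {x | (∀ i, x i ∈ Set.Icc (0:ℝ) 1) ∧ ∀ i j : Fin n, i < j → x (σ i) < x (σ j)}
    let μσ : Measure (Fin n → ℝ) := (n.factorial : ℝ≥0∞) • volume.restrict Δσ
    (∫ x, (∑ i, w i * x i) ^ 2 ∂μσ) - (∫ x, (∑ i, w i * x i) ∂μσ) ^ 2
      ≤ (∑ j : Fin n, (∑ i ∈ Finset.Ici j, w (σ i)) ^ 2) / ((n + 1) * (n + 2)) := by
  intro Δσ μσ
  have p1 := perm_int n σ w 1
  have p2 := perm_int n σ w 2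
  simp only [pow_one] at p1
  rw [moment1 n (fun i => w (σ i)) 1 zero_le_one] at p1
  rw [moment2 n (fun i => w (σ i)) 1 zero_le_one] at p2
  simp only [μσ, integral_smul_measure, Δσ]
  rw [p1, p2]
  set A := ∑ j, ∑ i ∈ Ici j, w (σ i)
  set R := ∑ j, (∑ i ∈ Ici j, w (σ i)) ^ 2
  rw [Nat.factorial_succ (n+1), Nat.factorial_succ n]
  have hf : (n.factorial : ℝ) ≠ 0 := by positivity
  simp only [one_pow, ENNReal.toReal_natCast, smul_eq_mul]
  push_cast
  have e : (n.factorial : ℝ) * (1 / ((n + 1 + 1) * ((n + 1) * n.factorial)) * (A ^ 2 + R))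
      - (n.factorial * (1 / ((n + 1) * n.factorial) * A)) ^ 2
      = R / ((n + 1) * (n + 2)) - A ^ 2 / ((n + 1) ^ 2 * (n + 2)) := by
    field_simp
    ring
  rw [e]
  have : 0 ≤ A ^ 2 / (((n:ℝ) + 1) ^ 2 * (n + 2)) := by positivity
  linarith
end
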